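/- arXiv:1103.3423 — 2 statements merged into one kernel-verified Lean document; each statement's English description precedes it below -/
import Mathlib

section
/- Let d ≥ 1. There is a constant C(d) > 0 with the following property: for every finite simple graph Γ with N ≥ 1 vertices and maximum degree at most d, regarded as a 1-dimensional simplicial complex, there exists a topological embedding I of |Γ| into the closed ball of radius C(d)·N^{1/3} in ℝ³ such that the closed 1-neighborhood of I(|Γ|) admits a retraction onto I(|Γ|). -/
open scoped Classical
open Metric Set Function

/-- `RetractsOnto B A` : there is a retraction from `B` onto `A`, i.e. a continuous map
`B → A` restricting to the identity on `A`. -/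
def RetractsOnto {α : Type*} [TopologicalSpace α] (B A : Set α) : Prop :=
  ∃ r : B → A, Continuous r ∧ ∀ x : B, (x : α) ∈ A → ((r x : α) = (x : α))

/-- A geometric simplicial complex `K` (together with a vertex map `f`) is a realization
of the simple graph `G`, regarded as a 1-dimensional simplicial complex. -/
def IsGraphRealization {V E : Type*} [NormedAddCommGroup E] [NormedSpace ℝ E]
    (G : SimpleGraph V) (K : Geometry.SimplicialComplex ℝ E) (f : V → E) : Prop :=
  Function.Injective f ∧
    K.faces = {s : Finset E | (∃ v : V, s = {f v}) ∨ ∃ u v : V, G.Adj u v ∧ s = {f u, f v}}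

theorem glue_closed {X Y ι : Type*} [TopologicalSpace X] [TopologicalSpace Y] [Nonempty Y]
    [Finite ι] (C : ι → Set X) (hC : ∀ i, IsClosed (C i)) (f : ι → X → Y)
    (hf : ∀ i, ContinuousOn (f i) (C i))
    (hcomp : ∀ i j x, x ∈ C i → x ∈ C j → f i x = f j x) :
    ∃ g : X → Y, ContinuousOn g (⋃ i, C i) ∧ ∀ i x, x ∈ C i → g x = f i x := by
  let g : X → Y := fun x => if h : ∃ i, x ∈ C i then f h.choose x else Classical.arbitrary Y
  have hg : ∀ i x, x ∈ C i → g x = f i x := by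
    intro i x hx
    have h : ∃ i, x ∈ C i := ⟨i, hx⟩
    simp only [g, dif_pos h]
    exact hcomp _ _ _ h.choose_spec hx
  refine ⟨g, ?_, hg⟩
  apply LocallyFinite.continuousOn_iUnion (locallyFinite_of_finite C) hC
  intro i
  exact (hf i).congr (fun x hx => hg i x hx)

/-- absolute extensor for closed subsets of `X` -/
def AE {X : Type} [MetricSpace X] (Y : Set X) : Prop :=
  ∀ (C : Set X) (f : X → X), IsClosed C → ContinuousOn f C → MapsTo f C Y →
    ∃ g : X → X, Continuous g ∧ (∀ x, g x ∈ Y) ∧ EqOn g f C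

theorem tietze_real {X : Type} [MetricSpace X] (C : Set X) (hC : IsClosed C) (f : X → ℝ)
    (hf : ContinuousOn f C) : ∃ g : X → ℝ, Continuous g ∧ EqOn g f C := by
  obtain ⟨g, hg⟩ := ContinuousMap.exists_restrict_eq hC
    (⟨C.domRestrict f, continuousOn_iff_continuous_domRestrict.1 hf⟩ : C(C, ℝ))
  refine ⟨g, g.continuous, fun x hx => ?_⟩
  have := congrArg (fun h => h ⟨x, hx⟩) hg
  exact this

theorem AE_singleton {X : Type} [MetricSpace X] (p : X) : AE ({p} : Set X) := by
  intro C f hC hf hm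
  exact ⟨fun _ => p, continuous_const, fun _ => rfl, fun x hx => (hm hx).symm⟩

theorem AE_arc {X : Type} [MetricSpace X] (γ : ℝ → X) (hγ : Continuous γ) (a b : ℝ) (hab : a ≤ b)
    (hinj : InjOn γ (Icc a b)) : AE (γ '' Icc a b) := by
  intro C f hC hf hm
  let e : Icc a b → X := fun t => γ t
  have he : Topology.IsClosedEmbedding e := by
    apply Continuous.isClosedEmbedding (f := e) (by fun_prop)
    intro s t hst
    exact Subtype.ext (hinj s.2 t.2 hst)
  have hr : range e = γ '' Icc a b := by
    ext x; simp [e]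
  let h : Icc a b ≃ₜ range e := he.isEmbedding.toHomeomorph
  have hm' : ∀ x : C, f x ∈ range e := fun x => by rw [hr]; exact hm x.2
  let F : C → ℝ := fun x => (h.symm ⟨f x, hm' x⟩ : Icc a b)
  have hF : Continuous F := by
    apply continuous_subtype_val.comp
    apply h.symm.continuous.comp
    apply Continuous.subtype_mk
    exact continuousOn_iff_continuous_domRestrict.1 hf
  obtain ⟨g, hg⟩ := ContinuousMap.exists_restrict_eq hC (⟨F, hF⟩ : C(C, ℝ))
  refine ⟨fun x => γ (projIcc a b hab (g x)), ?_, fun x => ⟨_, (projIcc a b hab (g x)).2, rfl⟩, ?_⟩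
  · have := g.continuous
    fun_prop
  · intro x hx
    have h1 : g x = F ⟨x, hx⟩ := by
      have := congrArg (fun h => h ⟨x, hx⟩) hg
      simpa using this
    have h2 : projIcc a b hab (g x) = h.symm ⟨f x, hm' ⟨x, hx⟩⟩ := by
      rw [h1]; exact projIcc_val hab _
    show γ (projIcc a b hab (g x)) = f x
    rw [h2]
    have := congrArg Subtype.val (h.apply_symm_apply ⟨f x, hm' ⟨x, hx⟩⟩)
    exact this

theorem AE_union {X : Type} [MetricSpace X] (Y₁ Y₂ : Set X) (p : X) (h1 : AE Y₁) (h2 : AE Y₂)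
    (hc1 : IsClosed Y₁) (hc2 : IsClosed Y₂) (hp : Y₁ ∩ Y₂ = {p}) : AE (Y₁ ∪ Y₂) := by
  intro C f hC hf hm
  have hp1 : p ∈ Y₁ := (hp.symm ▸ rfl : p ∈ Y₁ ∩ Y₂).1
  have hp2 : p ∈ Y₂ := (hp.symm ▸ rfl : p ∈ Y₁ ∩ Y₂).2
  have hpe : ∀ x, x ∈ Y₁ → x ∈ Y₂ → x = p := fun x a b => by
    have : x ∈ Y₁ ∩ Y₂ := ⟨a, b⟩
    rw [hp] at this; exact this
  have hC1 : IsClosed (C ∩ f ⁻¹' Y₁) := hf.preimage_isClosed_of_isClosed hC hc1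
  have hC2 : IsClosed (C ∩ f ⁻¹' Y₂) := hf.preimage_isClosed_of_isClosed hC hc2
  -- sign function
  obtain ⟨d, hd, hdeq⟩ := glue_closed (ι := Bool)
    (fun i => cond i (C ∩ f ⁻¹' Y₁) (C ∩ f ⁻¹' Y₂)) (by intro i; cases i <;> assumption)
    (fun i x => cond i (dist (f x) p) (-dist (f x) p))
    (by
      intro i; cases i
      · exact ((by fun_prop : Continuous (fun y : X => dist y p)).comp_continuousOn (hf.mono inter_subset_left)).neg
      · exact ((by fun_prop : Continuous (fun y : X => dist y p)).comp_continuousOn (hf.mono inter_subset_left)))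
    (by
      rintro (_|_) (_|_) x hx hx' <;> try rfl
      · have := hpe _ hx'.2 hx.2; simp [this]
      · have := hpe _ hx.2 hx'.2; simp [this])
  have hun : (⋃ i : Bool, cond i (C ∩ f ⁻¹' Y₁) (C ∩ f ⁻¹' Y₂)) = C := by
    ext x; simp only [mem_iUnion, Bool.exists_bool, cond_false, cond_true]
    constructor
    · rintro (h|h) <;> exact h.1
    · intro hx; rcases hm hx with h | h
      · exact Or.inr ⟨hx, h⟩
      · exact Or.inl ⟨hx, h⟩
  rw [hun] at hd
  obtain ⟨G, hG, hGd⟩ := tietze_real C hC d hd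
  have hG1 : ∀ x ∈ C, f x ∈ Y₁ → G x = dist (f x) p := fun x hx h =>
    (hGd hx).trans (hdeq true x ⟨hx, h⟩)
  have hG2 : ∀ x ∈ C, f x ∈ Y₂ → G x = -dist (f x) p := fun x hx h =>
    (hGd hx).trans (hdeq false x ⟨hx, h⟩)
  have key : ∀ (Y : Set X), AE Y → IsClosed Y → p ∈ Y →
      (∀ x ∈ C, f x ∈ Y → |G x| = dist (f x) p) →
      ∃ g : X → X, Continuous g ∧ (∀ x, g x ∈ Y) ∧ (∀ x ∈ C, f x ∈ Y → g x = f x) ∧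
        ∀ x, G x = 0 → g x = p := by
    intro Y hY hYc hpY hGY
    have hCY : IsClosed (C ∩ f ⁻¹' Y) := hf.preimage_isClosed_of_isClosed hC hYc
    have hZ : IsClosed {x | G x = 0} := isClosed_eq hG continuous_const
    have : Nonempty X := ⟨p⟩
    obtain ⟨f', hf', hfe⟩ := glue_closed (ι := Bool)
      (fun i => cond i (C ∩ f ⁻¹' Y) {x | G x = 0}) (by intro i; cases i <;> assumption)
      (fun i x => cond i (f x) p)
      (by
        intro i; cases i
        · exact continuousOn_const
        · exact hf.mono inter_subset_left)
      (by
        rintro (_|_) (_|_) x hx hx' <;> try rfl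
        · have h := hGY x hx'.1 hx'.2
          have h0 : G x = 0 := hx
          rw [h0, abs_zero] at h
          exact (dist_eq_zero.1 h.symm).symm
        · have h := hGY x hx.1 hx.2
          have h0 : G x = 0 := hx'
          rw [h0, abs_zero] at h
          exact (dist_eq_zero.1 h.symm))
    obtain ⟨g, hg, hgY, hge⟩ := hY _ f' (isClosed_iUnion_of_finite (by intro i; cases i <;> assumption))
      hf' (by
        intro x hx
        obtain ⟨i, hi⟩ := mem_iUnion.1 hx
        rw [hfe i x hi]
        cases i
        · exact hpY
        · exact hi.2)
    refine ⟨g, hg, hgY, ?_, ?_⟩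
    · intro x hx hxY
      rw [hge (mem_iUnion.2 ⟨true, ⟨hx, hxY⟩⟩), hfe true x ⟨hx, hxY⟩]; rfl
    · intro x hx
      rw [hge (mem_iUnion.2 ⟨false, hx⟩), hfe false x hx]; rfl
  obtain ⟨g1, hg1, hg1Y, hg1f, hg1p⟩ := key Y₁ h1 hc1 hp1 (by
    intro x hx h; rw [hG1 x hx h, abs_of_nonneg dist_nonneg])
  obtain ⟨g2, hg2, hg2Y, hg2f, hg2p⟩ := key Y₂ h2 hc2 hp2 (by
    intro x hx h; rw [hG2 x hx h, abs_neg, abs_of_nonneg dist_nonneg])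
  refine ⟨fun x => if 0 ≤ G x then g1 x else g2 x, ?_, ?_, ?_⟩
  · apply Continuous.if_le hg1 hg2 continuous_const hG
    intro x hx
    rw [hg1p x hx.symm, hg2p x hx.symm]
  · intro x
    dsimp only
    split_ifs
    · exact Or.inl (hg1Y x)
    · exact Or.inr (hg2Y x)
  · intro x hx
    dsimp only
    split_ifs with h
    · rcases hm hx with h' | h'
      · exact hg1f x hx h'
      · have h3 := hG2 x hx h'
        have h4 : f x = p := by
          apply dist_eq_zero.1
          have := dist_nonneg (x := f x) (y := p)
          linarith
        exact hg1f x hx (h4 ▸ hp1)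
    · rcases hm hx with h' | h'
      · exfalso; apply h; rw [hG1 x hx h']; exact dist_nonneg
      · exact hg2f x hx h'

structure ArcSys {V ι X : Type} [MetricSpace X] (a b : ι → V) (m : ℝ) (P : V → X)
    (γ : ι → ℝ → X) : Prop where
  hm : 0 < m
  hab : ∀ e, a e ≠ b e
  cont : ∀ e, Continuous (γ e)
  left : ∀ e, γ e 0 = P (a e)
  right : ∀ e, γ e m = P (b e)
  Pinj : Injective P
  ginj : ∀ e e' s s', s ∈ Ioo 0 m → s' ∈ Ioo 0 m → γ e s = γ e' s' → e = e' ∧ s = s'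
  gP : ∀ e s v, s ∈ Ioo 0 m → γ e s ≠ P v

namespace ArcSys
variable {V ι X : Type} [MetricSpace X] {a b : ι → V} {m : ℝ} {P : V → X} {γ : ι → ℝ → X}

theorem tri {s : ℝ} (hs : s ∈ Icc 0 m) : s = 0 ∨ s = m ∨ s ∈ Ioo 0 m := by
  rcases eq_or_lt_of_le hs.1 with h | h
  · exact Or.inl h.symm
  rcases eq_or_lt_of_le hs.2 with h' | h'
  · exact Or.inr (Or.inl h')
  · exact Or.inr (Or.inr ⟨h, h'⟩)

theorem eqP (A : ArcSys a b m P γ) {e : ι} {s : ℝ} {v : V} (hs : s ∈ Icc 0 m)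
    (h : γ e s = P v) : (s = 0 ∧ v = a e) ∨ (s = m ∧ v = b e) := by
  rcases tri hs with h' | h' | h'
  · left; refine ⟨h', ?_⟩
    rw [h', A.left] at h; exact (A.Pinj h).symm
  · right; refine ⟨h', ?_⟩
    rw [h', A.right] at h; exact (A.Pinj h).symm
  · exact absurd h (A.gP e s v h')

theorem eqg (A : ArcSys a b m P γ) {e e' : ι} {s s' : ℝ} (hs : s ∈ Icc 0 m) (hs' : s' ∈ Icc 0 m)
    (h : γ e s = γ e' s') : (e = e' ∧ s = s') ∨ (s = 0 ∧ (a e = a e' ∨ a e = b e')) ∨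
      (s = m ∧ (b e = a e' ∨ b e = b e')) := by
  rcases tri hs with h' | h' | h'
  · rw [h', A.left] at h
    rcases A.eqP hs' h.symm with h2 | h2
    · exact Or.inr (Or.inl ⟨h', Or.inl h2.2⟩)
    · exact Or.inr (Or.inl ⟨h', Or.inr h2.2⟩)
  · rw [h', A.right] at h
    rcases A.eqP hs' h.symm with h2 | h2
    · exact Or.inr (Or.inr ⟨h', Or.inl h2.2⟩)
    · exact Or.inr (Or.inr ⟨h', Or.inr h2.2⟩)
  · rcases tri hs' with h2 | h2 | h2
    · rw [h2, A.left] at h; exact absurd h (A.gP _ _ _ h')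
    · rw [h2, A.right] at h; exact absurd h (A.gP _ _ _ h')
    · exact Or.inl (A.ginj _ _ _ _ h' h2 h)

theorem injOn (A : ArcSys a b m P γ) (e : ι) : InjOn (γ e) (Icc 0 m) := by
  intro s hs s' hs' h
  rcases tri hs with h1 | h1 | h1
  · rw [h1, A.left] at h
    rcases A.eqP hs' h.symm with h2 | h2
    · rw [h1, h2.1]
    · exact absurd h2.2 (A.hab e)
  · rw [h1, A.right] at h
    rcases A.eqP hs' h.symm with h2 | h2
    · exact absurd h2.2.symm (A.hab e)
    · rw [h1, h2.1]
  · rcases tri hs' with h2 | h2 | h2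
    · rw [h2, A.left] at h; exact absurd h (A.gP _ _ _ h1)
    · rw [h2, A.right] at h; exact absurd h (A.gP _ _ _ h1)
    · exact (A.ginj _ _ _ _ h1 h2 h).2

theorem closed_arc (A : ArcSys a b m P γ) (e : ι) (s t : ℝ) : IsClosed (γ e '' Icc s t) :=
  (isCompact_Icc.image (A.cont e)).isClosed

theorem closed_tree (A : ArcSys a b m P γ) [Finite V] [Finite ι] (S : Set V) (F : Set ι) :
    IsClosed (P '' S ∪ ⋃ e ∈ F, γ e '' Icc 0 m) := by
  apply IsClosed.union ((toFinite S).image P).isClosed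
  exact (toFinite F).isClosed_biUnion (fun e _ => A.closed_arc e 0 m)

theorem extend_tree (A : ArcSys a b m P γ) [Finite V] [Finite ι] (S : Set V) (F : Set ι)
    (hF : ∀ e ∈ F, a e ∈ S ∧ b e ∈ S) (hAE : AE (P '' S ∪ ⋃ e ∈ F, γ e '' Icc 0 m))
    (e : ι) (v w : V) (hv : v ∈ S) (hw : w ∉ S)
    (hvw : (v = a e ∧ w = b e) ∨ (v = b e ∧ w = a e)) :
    AE (P '' (insert w S) ∪ ⋃ e' ∈ insert e F, γ e' '' Icc 0 m) := by
  have hPv : P v ∈ γ e '' Icc 0 m := by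
    rcases hvw with h | h
    · exact ⟨0, ⟨le_rfl, A.hm.le⟩, by rw [A.left, h.1]⟩
    · exact ⟨m, ⟨A.hm.le, le_rfl⟩, by rw [A.right, h.1]⟩
  have hPw : P w ∈ γ e '' Icc 0 m := by
    rcases hvw with h | h
    · exact ⟨m, ⟨A.hm.le, le_rfl⟩, by rw [A.right, h.2]⟩
    · exact ⟨0, ⟨le_rfl, A.hm.le⟩, by rw [A.left, h.2]⟩
  have hset : P '' (insert w S) ∪ ⋃ e' ∈ insert e F, γ e' '' Icc 0 m =
      (P '' S ∪ ⋃ e ∈ F, γ e '' Icc 0 m) ∪ γ e '' Icc 0 m := by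
    rw [image_insert_eq, biUnion_insert]
    ext x
    simp only [mem_union, mem_insert_iff]
    constructor
    · rintro ((rfl | h) | (h | h)) <;> tauto
    · tauto
  rw [hset]
  refine AE_union _ _ (P v) hAE (AE_arc _ (A.cont e) _ _ A.hm.le (A.injOn e))
    (A.closed_tree S F) (A.closed_arc e 0 m) ?_
  have hgS : ∀ u, u ∈ S → (u = a e ∨ u = b e) → u = v := by
    intro u hu h
    rcases hvw with ⟨h1, h2⟩ | ⟨h1, h2⟩ <;> rcases h with h | h
    · rw [h, h1]
    · exact absurd (h2 ▸ h ▸ hu) hw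
    · exact absurd (h2 ▸ h ▸ hu) hw
    · rw [h, h1]
  apply Subset.antisymm
  · rintro x ⟨hx | hx, s, hs, rfl⟩
    · obtain ⟨u, hu, hux⟩ := hx
      rcases A.eqP hs hux.symm with h | h
      · rw [← hux, hgS u hu (Or.inl h.2)]; rfl
      · rw [← hux, hgS u hu (Or.inr h.2)]; rfl
    · simp only [mem_iUnion] at hx
      obtain ⟨e', he', s', hs', h⟩ := hx
      have hne : e ≠ e' := by
        rintro rfl
        have := hF e he'
        rcases hvw with h | h
        · exact hw (h.2 ▸ this.2)
        · exact hw (h.2 ▸ this.1)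
      have hF' := hF e' he'
      rcases A.eqg hs hs' h.symm with h2 | h2 | h2
      · exact absurd h2.1 hne
      · rw [h2.1, A.left]
        have : a e ∈ S := by rcases h2.2 with h3 | h3 <;> rw [h3]; exacts [hF'.1, hF'.2]
        rw [hgS _ this (Or.inl rfl)]; rfl
      · rw [h2.1, A.right]
        have : b e ∈ S := by rcases h2.2 with h3 | h3 <;> rw [h3]; exacts [hF'.1, hF'.2]
        rw [hgS _ this (Or.inr rfl)]; rfl
  · rintro x rfl
    exact ⟨Or.inl ⟨v, hv, rfl⟩, hPv⟩

theorem exists_tree (A : ArcSys a b m P γ) [Finite V] [Finite ι] [Nonempty V]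
    (hconn : ∀ S : Set V, S.Nonempty → (∀ e, a e ∈ S ↔ b e ∈ S) → S = univ) :
    ∃ F : Set ι, AE (P '' univ ∪ ⋃ e ∈ F, γ e '' Icc 0 m) := by
  let Q : Set V → Prop := fun S => S.Nonempty ∧ ∃ F : Set ι, (∀ e ∈ F, a e ∈ S ∧ b e ∈ S) ∧
    AE (P '' S ∪ ⋃ e ∈ F, γ e '' Icc 0 m)
  obtain ⟨v0⟩ := ‹Nonempty V›
  have h0 : Q {v0} := by
    refine ⟨⟨v0, rfl⟩, ∅, by simp, ?_⟩
    simpa using AE_singleton (P v0)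
  obtain ⟨S, hS⟩ := (toFinite {S : Set V | Q S}).exists_maximal ⟨_, h0⟩
  obtain ⟨hSn, F, hF, hAE⟩ := hS.prop
  have key : ∀ e v w, v ∈ S → w ∉ S → ((v = a e ∧ w = b e) ∨ (v = b e ∧ w = a e)) → False := by
    intro e v w hv hw hvw
    have hQ : Q (insert w S) := by
      refine ⟨⟨v, Or.inr hv⟩, insert e F, ?_, A.extend_tree S F hF hAE e v w hv hw hvw⟩
      rintro e' (rfl | he')
      · rcases hvw with ⟨h1, h2⟩ | ⟨h1, h2⟩
        · rw [← h1, ← h2]; exact ⟨Or.inr hv, Or.inl rfl⟩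
        · rw [← h1, ← h2]; exact ⟨Or.inl rfl, Or.inr hv⟩
      · exact ⟨Or.inr (hF e' he').1, Or.inr (hF e' he').2⟩
    exact hw (hS.le_of_ge hQ (subset_insert w S) (Or.inl rfl))
  have hSu : S = univ := by
    apply hconn S hSn
    intro e
    constructor
    · intro h; by_contra h'; exact key e _ _ h h' (Or.inl ⟨rfl, rfl⟩)
    · intro h; by_contra h'; exact key e _ _ h h' (Or.inr ⟨rfl, rfl⟩)
  exact ⟨F, hSu ▸ hAE⟩

/-- the hairs -/
def hair (γ : ι → ℝ → X) (m : ℝ) (s1 s2 : ι → ℝ) (h : ι × Bool) : Set X :=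
  cond h.2 (γ h.1 '' Icc (s2 h.1) m) (γ h.1 '' Icc 0 (s1 h.1))

theorem AE_hairs (A : ArcSys a b m P γ) [Finite V] [Finite ι] (F : Set ι)
    (hAE : AE (P '' univ ∪ ⋃ e ∈ F, γ e '' Icc 0 m)) (s1 s2 : ι → ℝ)
    (h1 : ∀ e, 0 < s1 e) (h12 : ∀ e, s1 e < s2 e) (h2 : ∀ e, s2 e < m)
    (T : Finset (ι × Bool)) (hT : ∀ h ∈ T, h.1 ∉ F) :
    AE ((P '' univ ∪ ⋃ e ∈ F, γ e '' Icc 0 m) ∪ ⋃ h ∈ T, hair γ m s1 s2 h) := by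
  have hcl : ∀ h, IsClosed (hair γ m s1 s2 h) := by
    rintro ⟨e, _ | _⟩ <;> exact A.closed_arc _ _ _
  have hmem : ∀ (h : ι × Bool) x, x ∈ hair γ m s1 s2 h → ∃ s ∈ Icc 0 m, γ h.1 s = x ∧
      (cond h.2 (s2 h.1 ≤ s) (s ≤ s1 h.1)) := by
    rintro ⟨e, _ | _⟩ x ⟨s, hs, rfl⟩
    · exact ⟨s, ⟨hs.1, hs.2.trans ((h12 e).trans (h2 e)).le⟩, rfl, hs.2⟩
    · exact ⟨s, ⟨((h1 e).trans (h12 e)).le.trans hs.1, hs.2⟩, rfl, hs.1⟩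
  induction T using Finset.induction_on with
  | empty => simpa using hAE
  | insert h T hnT ih =>
    have ih := ih (fun h' hh' => hT h' (Finset.mem_insert_of_mem hh'))
    have hset : (P '' univ ∪ ⋃ e ∈ F, γ e '' Icc 0 m) ∪ ⋃ h' ∈ insert h T, hair γ m s1 s2 h' =
      ((P '' univ ∪ ⋃ e ∈ F, γ e '' Icc 0 m) ∪ ⋃ h' ∈ T, hair γ m s1 s2 h') ∪
        hair γ m s1 s2 h := by
      rw [Finset.set_biUnion_insert, union_comm (hair γ m s1 s2 h), union_assoc, union_assoc, union_assoc]
    rw [hset]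
    have hhF : h.1 ∉ F := hT h (Finset.mem_insert_self _ _)
    have hp : P (cond h.2 (b h.1) (a h.1)) ∈ hair γ m s1 s2 h := by
      obtain ⟨e, _ | _⟩ := h
      · exact ⟨0, ⟨le_rfl, (h1 e).le⟩, A.left e⟩
      · exact ⟨m, ⟨(h2 e).le, le_rfl⟩, A.right e⟩
    refine AE_union _ _ (P (cond h.2 (b h.1) (a h.1))) ih ?_ ?_ (hcl h) ?_
    · obtain ⟨e, _ | _⟩ := h
      · exact AE_arc _ (A.cont e) _ _ (h1 e).le
          ((A.injOn e).mono (Icc_subset_Icc_right ((h12 e).trans (h2 e)).le))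
      · exact AE_arc _ (A.cont e) _ _ (h2 e).le
          ((A.injOn e).mono (Icc_subset_Icc_left ((h1 e).trans (h12 e)).le))
    · exact (A.closed_tree univ F).union (isClosed_biUnion_finset (fun h _ => hcl h))
    · apply Subset.antisymm
      · rintro x ⟨hx, hxh⟩
        obtain ⟨s, hs, rfl, hsh⟩ := hmem h x hxh
        -- endpoints
        have hend0 : s = 0 → γ h.1 s ∈ ({P (cond h.2 (b h.1) (a h.1))} : Set X) := by
          intro h0
          obtain ⟨e, _ | _⟩ := h
          · rw [h0, A.left]; rfl
          · simp only [cond_true] at hsh; have := h1 e; have := h12 e; exfalso; linarith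
        have hendm : s = m → γ h.1 s ∈ ({P (cond h.2 (b h.1) (a h.1))} : Set X) := by
          intro h0
          obtain ⟨e, _ | _⟩ := h
          · simp only [cond_false] at hsh; have := h2 e; have := h12 e; exfalso; linarith
          · rw [h0, A.right]; rfl
        rcases hx with (⟨v, -, hv⟩ | hx) | hx
        · rcases A.eqP hs hv.symm with h' | h'
          · exact hend0 h'.1
          · exact hendm h'.1
        · simp only [mem_iUnion] at hx
          obtain ⟨e', he', s', hs', h'⟩ := hx
          rcases A.eqg hs hs' h'.symm with h3 | h3 | h3
          · exact absurd (h3.1 ▸ he') hhF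
          · exact hend0 h3.1
          · exact hendm h3.1
        · simp only [mem_iUnion] at hx
          obtain ⟨h', hh', hx⟩ := hx
          obtain ⟨s', hs', hss, hsh'⟩ := hmem h' _ hx
          rcases A.eqg hs hs' hss.symm with h3 | h3 | h3
          · exfalso
            have hne : h ≠ h' := fun hh => hnT (hh ▸ hh')
            obtain ⟨e, β⟩ := h
            obtain ⟨e', β'⟩ := h'
            obtain ⟨h4, h5⟩ := h3
            simp only at h4
            subst h4; subst h5
            have := h12 e
            cases β <;> cases β'
            · exact hne rfl
            · simp only [cond_true, cond_false] at hsh hsh'; linarith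
            · simp only [cond_true, cond_false] at hsh hsh'; linarith
            · exact hne rfl
          · exact hend0 h3.1
          · exact hendm h3.1
      · rintro x rfl
        exact ⟨Or.inl (Or.inl ⟨_, mem_univ _, rfl⟩), hp⟩

theorem retract_conn (A : ArcSys a b m P γ) [Finite V] [Finite ι] [Nonempty V]
    (hconn : ∀ S : Set V, S.Nonempty → (∀ e, a e ∈ S ↔ b e ∈ S) → S = univ)
    (s1 s2 : ι → ℝ)
    (h1 : ∀ e, 0 < s1 e) (h12 : ∀ e, s1 e < s2 e) (h2 : ∀ e, s2 e < m)
    (Z : Set X) (hZ : IsClosed Z) (O B : ι → Set X) (hO : ∀ e, IsOpen (O e))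
    (hB : ∀ e, IsClosed (B e)) (hOB : ∀ e, O e ⊆ B e)
    (hdisj : ∀ e e' x, x ∈ B e → x ∈ B e' → e = e')
    (ρ : ι → X → ℝ) (hρ : ∀ e, Continuous (ρ e))
    (hbd : ∀ e x, x ∈ Z → x ∈ B e → x ∉ O e → ρ e x = s1 e ∨ ρ e x = s2 e)
    (hin : ∀ e x, x ∈ Z → x ∈ B e → ρ e x ∈ Icc (s1 e) (s2 e))
    (hAB : ∀ e x, x ∈ (range P ∪ ⋃ e, γ e '' Icc 0 m) → x ∈ B e → γ e (ρ e x) = x)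
    (hAO : ∀ e τ, τ ∈ Ioo (s1 e) (s2 e) → γ e τ ∈ O e) :
    ∃ r : X → X, ContinuousOn r Z ∧ MapsTo r Z (range P ∪ ⋃ e, γ e '' Icc 0 m) ∧
      ∀ x ∈ Z, x ∈ (range P ∪ ⋃ e, γ e '' Icc 0 m) → r x = x := by
  obtain ⟨F, hF⟩ := A.exists_tree hconn
  have : Fintype ι := Fintype.ofFinite ι
  let T : Finset (ι × Bool) := Finset.univ.filter (fun h => h.1 ∉ F)
  have hY := A.AE_hairs F hF s1 s2 h1 h12 h2 T (by intro h hh; simpa [T] using hh)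
  set Y := (P '' univ ∪ ⋃ e ∈ F, γ e '' Icc 0 m) ∪ ⋃ h ∈ T, hair γ m s1 s2 h with hYdef
  set AA := (range P ∪ ⋃ e, γ e '' Icc 0 m) with hAA
  have hYc : IsClosed Y := by
    refine (A.closed_tree univ F).union (isClosed_biUnion_finset ?_)
    rintro ⟨e, _ | _⟩ _ <;> exact A.closed_arc _ _ _
  have hmg : ∀ e s, s ∈ Icc 0 m → γ e s ∈ AA := fun e s hs =>
    Or.inr (mem_iUnion.2 ⟨e, s, hs, rfl⟩)
  have hYA : Y ⊆ AA := by
    rintro x ((⟨v, -, rfl⟩ | hx) | hx)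
    · exact Or.inl ⟨v, rfl⟩
    · simp only [mem_iUnion] at hx
      obtain ⟨e, -, s, hs, rfl⟩ := hx
      exact hmg e s hs
    · simp only [mem_iUnion] at hx
      obtain ⟨⟨e, _ | _⟩, -, s, hs, rfl⟩ := hx
      · exact hmg e s ⟨hs.1, hs.2.trans ((h12 e).trans (h2 e)).le⟩
      · exact hmg e s ⟨((h1 e).trans (h12 e)).le.trans hs.1, hs.2⟩
  have hhairY : ∀ e, e ∉ F → ∀ s, (s ∈ Icc 0 (s1 e) ∨ s ∈ Icc (s2 e) m) → γ e s ∈ Y := by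
    intro e he s hs
    refine Or.inr ?_
    simp only [mem_iUnion]
    rcases hs with hs | hs
    · exact ⟨(e, false), by simp [T, he], s, hs, rfl⟩
    · exact ⟨(e, true), by simp [T, he], s, hs, rfl⟩
  have hne : Nonempty X := ⟨P (Classical.arbitrary V)⟩
  -- the map on C
  let ι' := {e : ι // e ∉ F}
  let CC : Option ι' → Set X := fun o => match o with
    | none => Y
    | some e => Z ∩ B e.1 ∩ (O e.1)ᶜ
  have hCC : ∀ o, IsClosed (CC o) := by
    rintro (_ | e)
    · exact hYc
    · exact (hZ.inter (hB _)).inter (hO _).isClosed_compl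
  let ff : Option ι' → X → X := fun o => match o with
    | none => id
    | some e => fun x => γ e.1 (ρ e.1 x)
  have hff : ∀ o, Continuous (ff o) := by
    rintro (_ | e)
    · exact continuous_id
    · exact (A.cont e.1).comp (hρ e.1)
  obtain ⟨f, hf, hfe⟩ := glue_closed CC hCC ff (fun o => (hff o).continuousOn) (by
    rintro (_ | e) (_ | e') x hx hx'
    · rfl
    · exact (hAB e'.1 x (hYA hx) hx'.1.2).symm
    · exact (hAB e.1 x (hYA hx') hx.1.2)
    · have : e = e' := Subtype.ext (hdisj _ _ x hx.1.2 hx'.1.2)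
      rw [this])
  obtain ⟨g, hg, hgY, hge⟩ := hY _ f (isClosed_iUnion_of_finite hCC) hf (by
    intro x hx
    obtain ⟨o, ho⟩ := mem_iUnion.1 hx
    rw [hfe o x ho]
    rcases o with _ | e
    · exact ho
    · apply hhairY e.1 e.2
      rcases hbd e.1 x ho.1.1 ho.1.2 ho.2 with h | h
      · left; rw [h]; exact ⟨(h1 _).le, le_rfl⟩
      · right; rw [h]; exact ⟨le_rfl, (h2 _).le⟩)
  -- final map
  let DD : Option ι' → Set X := fun o => match o with
    | none => Z ∩ ⋂ e : ι', (O e.1)ᶜ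
    | some e => Z ∩ B e.1
  have hDD : ∀ o, IsClosed (DD o) := by
    rintro (_ | e)
    · exact hZ.inter (isClosed_iInter (fun e => (hO e.1).isClosed_compl))
    · exact (hZ.inter (hB _))
  let rr : Option ι' → X → X := fun o => match o with
    | none => g
    | some e => fun x => γ e.1 (ρ e.1 x)
  have hrr : ∀ o, Continuous (rr o) := by
    rintro (_ | e)
    · exact hg
    · exact (A.cont e.1).comp (hρ e.1)
  have hgB : ∀ (e : ι') x, x ∈ DD none → x ∈ DD (some e) → g x = γ e.1 (ρ e.1 x) := by
    intro e x hx hx'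
    have hxC : x ∈ CC (some e) := ⟨hx', by have := hx.2; rw [mem_iInter] at this; exact this e⟩
    rw [hge (mem_iUnion.2 ⟨some e, hxC⟩), hfe (some e) x hxC]
  obtain ⟨r, hr, hre⟩ := glue_closed DD hDD rr (fun o => (hrr o).continuousOn) (by
    rintro (_ | e) (_ | e') x hx hx'
    · rfl
    · exact hgB e' x hx hx'
    · exact (hgB e x hx' hx).symm
    · have : e = e' := Subtype.ext (hdisj _ _ x hx.2 hx'.2)
      rw [this])
  have hcov : ∀ x ∈ Z, (x ∈ DD none) ∨ ∃ e : ι', x ∈ DD (some e) := by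
    intro x hx
    by_cases h : ∃ e : ι', x ∈ O e.1
    · obtain ⟨e, he⟩ := h
      exact Or.inr ⟨e, hx, hOB _ he⟩
    · left
      push Not at h
      exact ⟨hx, mem_iInter.2 h⟩
  refine ⟨r, hr.mono ?_, ?_, ?_⟩
  · intro x hx
    rcases hcov x hx with h | ⟨e, h⟩
    · exact mem_iUnion.2 ⟨none, h⟩
    · exact mem_iUnion.2 ⟨some e, h⟩
  · intro x hx
    rcases hcov x hx with h | ⟨e, h⟩
    · rw [hre none x h]; exact hYA (hgY x)
    · rw [hre (some e) x h]
      have := hin e.1 x hx h.2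
      exact hmg _ _ ⟨(h1 _).le.trans this.1, this.2.trans (h2 _).le⟩
  · intro x hx hxA
    by_cases h : ∃ e : ι', x ∈ DD (some e)
    · obtain ⟨e, he⟩ := h
      rw [hre (some e) x he]
      exact hAB e.1 x hxA he.2
    · have hn : x ∈ DD none := (hcov x hx).resolve_right h
      rw [hre none x hn]
      have hxY : x ∈ Y := by
        rcases hxA with ⟨v, rfl⟩ | hxA
        · exact Or.inl (Or.inl ⟨v, mem_univ _, rfl⟩)
        · obtain ⟨e, s, hs, rfl⟩ := mem_iUnion.1 hxA
          by_cases he : e ∈ F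
          · exact Or.inl (Or.inr (mem_biUnion he ⟨s, hs, rfl⟩))
          · apply hhairY e he
            by_contra hcon
            apply h
            refine ⟨⟨e, he⟩, hx, hOB _ (hAO e s ?_)⟩
            simp only [mem_Icc, not_or, not_and_or, not_le] at hcon
            obtain ⟨h3, h4⟩ := hcon
            have := hs.1; have := hs.2
            refine ⟨?_, ?_⟩
            · rcases h3 with h3 | h3 <;> linarith
            · rcases h4 with h4 | h4 <;> linarith
      have hxC : x ∈ CC none := hxY
      show g x = x
      rw [hge (mem_iUnion.2 ⟨none, hxC⟩), hfe none x hxC]; rfl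

end ArcSys

namespace ArcSys

theorem eqP_iff {V ι X : Type} [MetricSpace X] {a b : ι → V} {m : ℝ} {P : V → X} {γ : ι → ℝ → X}
    (A : ArcSys a b m P γ) {e : ι} {s : ℝ} {v : V} (hs : s ∈ Icc 0 m) :
    γ e s = P v ↔ (s = 0 ∧ v = a e) ∨ (s = m ∧ v = b e) := by
  refine ⟨A.eqP hs, ?_⟩
  rintro (⟨rfl, rfl⟩ | ⟨rfl, rfl⟩)
  · exact A.left e
  · exact A.right e

theorem eqg_iff {V ι X : Type} [MetricSpace X] {a b : ι → V} {m : ℝ} {P : V → X} {γ : ι → ℝ → X}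
    (A : ArcSys a b m P γ) {e e' : ι} {s s' : ℝ} (hs : s ∈ Icc 0 m) (hs' : s' ∈ Icc 0 m) :
    γ e s = γ e' s' ↔ (e = e' ∧ s = s') ∨ (∃ v, ((s = 0 ∧ v = a e) ∨ (s = m ∧ v = b e)) ∧
      ((s' = 0 ∧ v = a e') ∨ (s' = m ∧ v = b e'))) := by
  constructor
  · intro h
    rcases tri hs with h' | h' | h'
    · right
      refine ⟨a e, Or.inl ⟨h', rfl⟩, A.eqP hs' ?_⟩
      rw [← h, h', A.left]
    · right
      refine ⟨b e, Or.inr ⟨h', rfl⟩, A.eqP hs' ?_⟩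
      rw [← h, h', A.right]
    · left
      rcases tri hs' with h2 | h2 | h2
      · rw [h2, A.left] at h; exact absurd h (A.gP _ _ _ h')
      · rw [h2, A.right] at h; exact absurd h (A.gP _ _ _ h')
      · exact (A.ginj _ _ _ _ h' h2 h)
  · rintro (⟨rfl, rfl⟩ | ⟨v, h1, h2⟩)
    · rfl
    · rw [(A.eqP_iff hs).2 h1, (A.eqP_iff hs').2 h2]

theorem lift {V ι X X' : Type} [MetricSpace X] [MetricSpace X'] [Finite V] [Finite ι]
    {a b : ι → V} {m : ℝ} {P : V → X} {γ : ι → ℝ → X} {P' : V → X'} {γ' : ι → ℝ → X'}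
    (A : ArcSys a b m P γ) (A' : ArcSys a b m P' γ') (K : Set X)
    (hK : K = range P ∪ ⋃ e, γ e '' Icc 0 m) :
    ∃ I : K → X', Continuous I ∧ Injective I ∧ range I = range P' ∪ ⋃ e, γ' e '' Icc 0 m := by
  let _ : TopologicalSpace V := ⊥
  have : DiscreteTopology V := ⟨rfl⟩
  let _ : TopologicalSpace ι := ⊥
  have : DiscreteTopology ι := ⟨rfl⟩
  let q0 : V ⊕ ι × Icc 0 m → X := Sum.elim P (fun x => γ x.1 x.2)
  have hcg : ∀ {Z : Type} [TopologicalSpace Z] (δ : ι → ℝ → Z), (∀ e, Continuous (δ e)) →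
      Continuous (fun x : ι × Icc 0 m => δ x.1 x.2) := by
    intro Z _ δ hδ
    rw [continuous_prod_of_discrete_left]
    intro e
    exact (hδ e).comp continuous_subtype_val
  have hq0 : Continuous q0 := continuous_of_discreteTopology.sumElim (hcg γ A.cont)
  let g : V ⊕ ι × Icc 0 m → X' := Sum.elim P' (fun x => γ' x.1 x.2)
  have hg : Continuous g := continuous_of_discreteTopology.sumElim (hcg γ' A'.cont)
  have hqK : ∀ y, q0 y ∈ K := by
    rw [hK]
    rintro (v | ⟨e, s⟩)
    · exact Or.inl ⟨v, rfl⟩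
    · exact Or.inr (mem_iUnion.2 ⟨e, s, s.2, rfl⟩)
  let q : V ⊕ ι × Icc 0 m → K := fun y => ⟨q0 y, hqK y⟩
  have hq : Continuous q := hq0.subtype_mk _
  have hqs : Surjective q := by
    rintro ⟨x, hx⟩
    have hx' := hx
    rw [hK] at hx'
    rcases hx' with ⟨v, rfl⟩ | hx'
    · exact ⟨Sum.inl v, rfl⟩
    · obtain ⟨e, s, hs, rfl⟩ := mem_iUnion.1 hx'
      exact ⟨Sum.inr (e, ⟨s, hs⟩), rfl⟩
  have hquot : Topology.IsQuotientMap q := hq.isClosedMap.isQuotientMap hq hqs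
  have hiff : ∀ y y', q y = q y' ↔ g y = g y' := by
    intro y y'
    have : q y = q y' ↔ q0 y = q0 y' := Subtype.ext_iff
    rw [this]
    rcases y with v | ⟨e, s, hs⟩ <;> rcases y' with v' | ⟨e', s', hs'⟩
    · exact A.Pinj.eq_iff.trans A'.Pinj.eq_iff.symm
    · show P v = γ e' s' ↔ P' v = γ' e' s'
      rw [eq_comm (a := P v), A.eqP_iff hs', eq_comm (a := P' v), A'.eqP_iff hs']
    · show γ e s = P v' ↔ γ' e s = P' v'
      rw [A.eqP_iff hs, A'.eqP_iff hs]
    · show γ e s = γ e' s' ↔ γ' e s = γ' e' s'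
      rw [A.eqg_iff hs hs', A'.eqg_iff hs hs']
  choose σ hσ using hqs
  have hI : ∀ y, g (σ (q y)) = g y := fun y => (hiff _ _).1 (hσ _)
  refine ⟨fun x => g (σ x), ?_, ?_, ?_⟩
  · rw [hquot.continuous_iff]
    have : (fun x => g (σ x)) ∘ q = g := funext hI
    rw [this]; exact hg
  · intro x x' h
    have := (hiff _ _).2 h
    rwa [hσ, hσ] at this
  · ext z
    constructor
    · rintro ⟨x, rfl⟩
      dsimp only
      rcases σ x with v | ⟨e, s⟩
      · exact Or.inl ⟨v, rfl⟩
      · exact Or.inr (mem_iUnion.2 ⟨e, s, s.2, rfl⟩)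
    · rintro (⟨v, rfl⟩ | hz)
      · exact ⟨q (Sum.inl v), hI _⟩
      · obtain ⟨e, s, hs, rfl⟩ := mem_iUnion.1 hz
        exact ⟨q (Sum.inr (e, ⟨s, hs⟩)), hI _⟩

end ArcSys

theorem real_arcs {V E : Type} [NormedAddCommGroup E] [NormedSpace ℝ E]
    (G : SimpleGraph V) (K : Geometry.SimplicialComplex ℝ E) (f : V → E)
    (hK : IsGraphRealization G K f) (m : ℝ) (hm : 0 < m)
    (a b : G.edgeSet → V) (hab : ∀ e : G.edgeSet, (e : Sym2 V) = s(a e, b e)) :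
    ArcSys a b m f (fun e s => AffineMap.lineMap (f (a e)) (f (b e)) (s / m)) ∧
    K.space = range f ∪ ⋃ e : G.edgeSet,
      (fun s : ℝ => AffineMap.lineMap (f (a e)) (f (b e)) (s / m)) '' Icc 0 m := by
  obtain ⟨hinj, hfaces⟩ := hK
  have hadj : ∀ e, G.Adj (a e) (b e) := by
    intro e
    have := e.2
    rw [hab e] at this
    exact this
  have hne : ∀ e, f (a e) ≠ f (b e) := fun e h => (hadj e).ne (hinj h)
  have hfe : ∀ e, ({f (a e), f (b e)} : Finset E) ∈ K.faces := by
    intro e; rw [hfaces]; exact Or.inr ⟨_, _, hadj e, rfl⟩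
  have hfv : ∀ v, ({f v} : Finset E) ∈ K.faces := by
    intro e; rw [hfaces]; exact Or.inl ⟨_, rfl⟩
  have hIcc : ∀ s ∈ Icc 0 m, s / m ∈ Icc (0:ℝ) 1 := fun s hs =>
    ⟨div_nonneg hs.1 hm.le, (div_le_one hm).2 hs.2⟩
  have hhull : ∀ e, convexHull ℝ (({f (a e), f (b e)} : Finset E) : Set E) =
      (fun s : ℝ => AffineMap.lineMap (f (a e)) (f (b e)) (s / m)) '' Icc 0 m := by
    intro e
    rw [Finset.coe_pair, convexHull_pair, segment_eq_image_lineMap]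
    ext x; constructor
    · rintro ⟨t, ht, rfl⟩
      refine ⟨t * m, ⟨mul_nonneg ht.1 hm.le, by nlinarith [ht.2]⟩, ?_⟩
      simp only; rw [mul_div_cancel_right₀ _ hm.ne']
    · rintro ⟨s, hs, rfl⟩
      exact ⟨s / m, hIcc s hs, rfl⟩
  -- key: interior point
  have key : ∀ e s (t : Finset E), s ∈ Ioo 0 m → t ∈ K.faces →
      AffineMap.lineMap (f (a e)) (f (b e)) (s / m) ∈ convexHull ℝ (t : Set E) →
      f (a e) ∈ t ∧ f (b e) ∈ t := by
    intro e s t hs ht hx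
    have hxe : AffineMap.lineMap (f (a e)) (f (b e)) (s / m) ∈
        convexHull ℝ (({f (a e), f (b e)} : Finset E) : Set E) := by
      rw [hhull]; exact ⟨s, ⟨hs.1.le, hs.2.le⟩, rfl⟩
    have h := K.inter_subset_convexHull (hfe e) ht ⟨hxe, hx⟩
    have h0 : s / m ≠ 0 := (div_pos hs.1 hm).ne'
    have h1 : s / m ≠ 1 := ((div_lt_one hm).2 hs.2).ne
    by_contra hcon
    rw [not_and_or] at hcon
    rcases hcon with hcon | hcon
    · have hsub : (({f (a e), f (b e)} : Finset E) : Set E) ∩ (t : Set E) ⊆ {f (b e)} := by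
        rintro y ⟨hy, hyt⟩
        simp only [Finset.coe_insert, Finset.coe_singleton, mem_insert_iff, mem_singleton_iff] at hy
        rcases hy with rfl | rfl
        · exact absurd hyt hcon
        · rfl
      have h2 := convexHull_mono hsub h
      rw [convexHull_singleton, mem_singleton_iff, AffineMap.lineMap_eq_right_iff] at h2
      rcases h2 with h2 | h2
      · exact hne e h2
      · exact h1 h2
    · have hsub : (({f (a e), f (b e)} : Finset E) : Set E) ∩ (t : Set E) ⊆ {f (a e)} := by
        rintro y ⟨hy, hyt⟩
        simp only [Finset.coe_insert, Finset.coe_singleton, mem_insert_iff, mem_singleton_iff] at hy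
        rcases hy with rfl | rfl
        · rfl
        · exact absurd hyt hcon
      have h2 := convexHull_mono hsub h
      rw [convexHull_singleton, mem_singleton_iff, AffineMap.lineMap_eq_left_iff] at h2
      rcases h2 with h2 | h2
      · exact hne e h2
      · exact h0 h2
  refine ⟨⟨hm, fun e => (hadj e).ne, ?_, ?_, ?_, hinj, ?_, ?_⟩, ?_⟩
  · intro e
    exact AffineMap.lineMap_continuous.comp (continuous_id.div_const m)
  · intro e; simp
  · intro e; simp [div_self hm.ne']
  · intro e e' s s' hs hs' h
    have hx : AffineMap.lineMap (f (a e)) (f (b e)) (s / m) ∈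
        convexHull ℝ (({f (a e'), f (b e')} : Finset E) : Set E) := by
      rw [hhull, ]; exact ⟨s', ⟨hs'.1.le, hs'.2.le⟩, h.symm⟩
    obtain ⟨k1, k2⟩ := key e s _ hs (hfe e') hx
    have hee : e = e' := by
      apply Subtype.ext
      rw [hab e, hab e']
      simp only [Finset.mem_insert, Finset.mem_singleton, hinj.eq_iff] at k1 k2
      have := (hadj e).ne
      rw [Sym2.eq_iff]
      rcases k1 with k1 | k1 <;> rcases k2 with k2 | k2
      · exact absurd (k1.trans k2.symm) this
      · exact Or.inl ⟨k1, k2⟩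
      · exact Or.inr ⟨k1, k2⟩
      · exact absurd (k1.trans k2.symm) this
    subst hee
    refine ⟨rfl, ?_⟩
    have := AffineMap.lineMap_injective ℝ (hne e) h
    field_simp at this
    exact this
  · intro e s v hs h
    have hx : AffineMap.lineMap (f (a e)) (f (b e)) (s / m) ∈
        convexHull ℝ (({f v} : Finset E) : Set E) := by
      rw [Finset.coe_singleton, convexHull_singleton]; exact h
    obtain ⟨k1, k2⟩ := key e s _ hs (hfv v) hx
    rw [Finset.mem_singleton] at k1 k2
    exact hne e (k1.trans k2.symm)
  · ext x
    rw [Geometry.SimplicialComplex.mem_space_iff]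
    constructor
    · rintro ⟨s, hs, hx⟩
      rw [hfaces] at hs
      rcases hs with ⟨v, rfl⟩ | ⟨u, v, huv, rfl⟩
      · rw [Finset.coe_singleton, convexHull_singleton] at hx
        exact Or.inl ⟨v, hx.symm⟩
      · right
        let e : G.edgeSet := ⟨s(u, v), huv⟩
        refine mem_iUnion.2 ⟨e, ?_⟩
        rw [← hhull]
        have h := hab e
        have h' : s(u, v) = s(a e, b e) := h
        rw [Sym2.eq_iff] at h'
        rcases h' with ⟨h1, h2⟩ | ⟨h1, h2⟩
        · rw [← h1, ← h2]; exact hx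
        · rw [← h1, ← h2, Finset.pair_comm]; exact hx
    · rintro (⟨v, rfl⟩ | hx)
      · exact ⟨_, hfv v, by simp⟩
      · obtain ⟨e, he⟩ := mem_iUnion.1 hx
        exact ⟨_, hfe e, by rw [hhull]; exact he⟩

namespace ArcSys

def part {V ι X 𝒦 : Type} (a : ι → V) (m : ℝ) (P : V → X) (γ : ι → ℝ → X) (κ : V → 𝒦) (k : 𝒦) :
    Set X := {x | (∃ v, κ v = k ∧ x = P v) ∨ ∃ e s, κ (a e) = k ∧ s ∈ Icc 0 m ∧ x = γ e s}

theorem retract_all {V ι X 𝒦 : Type} [MetricSpace X] [Finite V] [Finite ι] [Finite 𝒦]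
    {a b : ι → V} {m : ℝ} {P : V → X} {γ : ι → ℝ → X}
    (A : ArcSys a b m P γ) (κ : V → 𝒦) (hκs : Surjective κ) (hκ : ∀ e, κ (a e) = κ (b e))
    (hconn : ∀ k (S : Set V), (∃ v ∈ S, κ v = k) → (∀ e, a e ∈ S ↔ b e ∈ S) →
      ∀ v, κ v = k → v ∈ S)
    (hsep : ∀ k k', k ≠ k' → ∀ x ∈ part a m P γ κ k, ∀ y ∈ part a m P γ κ k', 2 < dist x y)
    (s1 s2 : ι → ℝ)
    (h1 : ∀ e, 0 < s1 e) (h12 : ∀ e, s1 e < s2 e) (h2 : ∀ e, s2 e < m)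
    (O B : ι → Set X) (hO : ∀ e, IsOpen (O e))
    (hB : ∀ e, IsClosed (B e)) (hOB : ∀ e, O e ⊆ B e)
    (hdisj : ∀ e e' x, x ∈ B e → x ∈ B e' → e = e')
    (ρ : ι → X → ℝ) (hρ : ∀ e, Continuous (ρ e))
    (hbd : ∀ e x y, y ∈ (range P ∪ ⋃ e, γ e '' Icc 0 m) → dist x y ≤ 1 →
      x ∈ B e → x ∉ O e → ρ e x = s1 e ∨ ρ e x = s2 e)
    (hin : ∀ e x, x ∈ B e → ρ e x ∈ Icc (s1 e) (s2 e))
    (hAB : ∀ e x, x ∈ (range P ∪ ⋃ e, γ e '' Icc 0 m) → x ∈ B e → γ e (ρ e x) = x)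
    (hAO : ∀ e τ, τ ∈ Ioo (s1 e) (s2 e) → γ e τ ∈ O e) :
    RetractsOnto (cthickening 1 (range P ∪ ⋃ e, γ e '' Icc 0 m))
      (range P ∪ ⋃ e, γ e '' Icc 0 m) := by
  set AA := (range P ∪ ⋃ e, γ e '' Icc 0 m) with hAA
  have hpart : ∀ k, part a m P γ κ k ⊆ AA := by
    rintro k x (⟨v, -, rfl⟩ | ⟨e, s, -, hs, rfl⟩)
    · exact Or.inl ⟨v, rfl⟩
    · exact Or.inr (mem_iUnion.2 ⟨e, s, hs, rfl⟩)
  have hpart' : ∀ x ∈ AA, ∃ k, x ∈ part a m P γ κ k := by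
    rintro x (⟨v, rfl⟩ | hx)
    · exact ⟨κ v, Or.inl ⟨v, rfl, rfl⟩⟩
    · obtain ⟨e, s, hs, rfl⟩ := mem_iUnion.1 hx
      exact ⟨κ (a e), Or.inr ⟨e, s, rfl, hs, rfl⟩⟩
  have hpe : ∀ k, part a m P γ κ k = range (fun v : {v // κ v = k} => P v.1) ∪
      ⋃ e : {e // κ (a e) = k}, γ e.1 '' Icc 0 m := by
    intro k
    ext x; constructor
    · rintro (⟨v, hv, rfl⟩ | ⟨e, s, he, hs, rfl⟩)
      · exact Or.inl ⟨⟨v, hv⟩, rfl⟩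
      · exact Or.inr (mem_iUnion.2 ⟨⟨e, he⟩, s, hs, rfl⟩)
    · rintro (⟨v, rfl⟩ | hx)
      · exact Or.inl ⟨v.1, v.2, rfl⟩
      · obtain ⟨e, s, hs, rfl⟩ := mem_iUnion.1 hx
        exact Or.inr ⟨e.1, s, e.2, hs, rfl⟩
  have hcomp : ∀ k, IsCompact (part a m P γ κ k) := by
    intro k; rw [hpe]
    exact (finite_range _).isCompact.union
      (isCompact_iUnion (fun e => isCompact_Icc.image (A.cont e.1)))
  have hcompA : IsCompact AA :=
    (finite_range _).isCompact.union (isCompact_iUnion (fun e => isCompact_Icc.image (A.cont e)))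
  have hth : ∀ k x, x ∈ cthickening 1 (part a m P γ κ k) → ∃ y ∈ part a m P γ κ k, dist x y ≤ 1 := by
    intro k x hx
    rw [(hcomp k).cthickening_eq_biUnion_closedBall zero_le_one] at hx
    simpa using hx
  have main : ∀ k, ∃ r : X → X, ContinuousOn r (cthickening 1 (part a m P γ κ k)) ∧
      MapsTo r (cthickening 1 (part a m P γ κ k)) (part a m P γ κ k) ∧
      ∀ x ∈ cthickening 1 (part a m P γ κ k), x ∈ part a m P γ κ k → r x = x := by
    intro k
    let a' : {e // κ (a e) = k} → {v // κ v = k} := fun e => ⟨a e.1, e.2⟩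
    let b' : {e // κ (a e) = k} → {v // κ v = k} := fun e => ⟨b e.1, (hκ e.1) ▸ e.2⟩
    have A' : ArcSys a' b' m (fun v => P v.1) (fun e => γ e.1) :=
      { hm := A.hm
        hab := fun e h => A.hab e.1 (congrArg Subtype.val h)
        cont := fun e => A.cont e.1
        left := fun e => A.left e.1
        right := fun e => A.right e.1
        Pinj := fun v w h => Subtype.ext (A.Pinj h)
        ginj := fun e e' s s' hs hs' h =>
          ⟨Subtype.ext (A.ginj _ _ _ _ hs hs' h).1, (A.ginj _ _ _ _ hs hs' h).2⟩
        gP := fun e s v hs => A.gP e.1 s v.1 hs }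
    have hne : Nonempty {v // κ v = k} := by
      obtain ⟨v, hv⟩ := hκs k; exact ⟨⟨v, hv⟩⟩
    have hconn' : ∀ S : Set {v // κ v = k}, S.Nonempty → (∀ e, a' e ∈ S ↔ b' e ∈ S) → S = univ := by
      intro S hS hSe
      have := hconn k (Subtype.val '' S) (by
        obtain ⟨v, hv⟩ := hS
        exact ⟨v.1, ⟨v, hv, rfl⟩, v.2⟩) (by
        intro e
        constructor
        · rintro ⟨v, hv, hva⟩
          have he : κ (a e) = k := hva ▸ v.2
          have h3 := (hSe ⟨e, he⟩).1 (by
            have : a' ⟨e, he⟩ = v := Subtype.ext hva.symm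
            rw [this]; exact hv)
          exact ⟨_, h3, rfl⟩
        · rintro ⟨v, hv, hva⟩
          have he : κ (a e) = k := by rw [hκ, ← hva]; exact v.2
          have h3 := (hSe ⟨e, he⟩).2 (by
            have : b' ⟨e, he⟩ = v := Subtype.ext hva.symm
            rw [this]; exact hv)
          exact ⟨_, h3, rfl⟩)
      ext v
      simp only [mem_univ, iff_true]
      obtain ⟨w, hw, hwv⟩ := this v.1 v.2
      rwa [← Subtype.ext hwv]
    have := A'.retract_conn hconn' (fun e => s1 e.1) (fun e => s2 e.1) (fun e => h1 e.1)
      (fun e => h12 e.1) (fun e => h2 e.1) (cthickening 1 (part a m P γ κ k)) isClosed_cthickening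
      (fun e => O e.1) (fun e => B e.1) (fun e => hO e.1) (fun e => hB e.1) (fun e => hOB e.1)
      (fun e e' x hx hx' => Subtype.ext (hdisj _ _ x hx hx')) (fun e => ρ e.1) (fun e => hρ e.1)
      (by
        intro e x hx hxB hxO
        obtain ⟨y, hy, hxy⟩ := hth k x hx
        exact hbd e.1 x y (hpart k hy) hxy hxB hxO)
      (fun e x _ => hin e.1 x)
      (by
        intro e x hx
        rw [← hpe] at hx
        exact hAB e.1 x (hpart k hx))
      (fun e => hAO e.1)
    rw [← hpe] at this
    exact this
  choose r hr hrm hrid using main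
  by_cases hV : Nonempty V
  swap
  · have hAe : AA = ∅ := by
      ext x
      simp only [mem_empty_iff_false, iff_false]
      intro hx
      obtain ⟨k, _⟩ := hpart' x hx
      exact hV ⟨(hκs k).choose⟩
    rw [hAe, cthickening_empty]
    exact ⟨id, continuous_id, fun x _ => rfl⟩
  obtain ⟨v0⟩ := hV
  have hXne : Nonempty X := ⟨P v0⟩
  obtain ⟨R, hR, hRe⟩ := glue_closed (fun k => cthickening 1 (part a m P γ κ k))
    (fun k => isClosed_cthickening) r hr (by
      intro k k' x hx hx'
      by_cases hkk : k = k'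
      · rw [hkk]
      · exfalso
        obtain ⟨y, hy, hxy⟩ := hth k x hx
        obtain ⟨y', hy', hxy'⟩ := hth k' x hx'
        have h3 := hsep k k' hkk y hy y' hy'
        have h4 := dist_triangle_left y y' x
        linarith)
  have hcov : ∀ x ∈ cthickening 1 AA, ∃ k, x ∈ cthickening 1 (part a m P γ κ k) := by
    intro x hx
    rw [hcompA.cthickening_eq_biUnion_closedBall zero_le_one] at hx
    simp only [mem_iUnion, mem_closedBall, exists_prop] at hx
    obtain ⟨y, hy, hxy⟩ := hx
    obtain ⟨k, hk⟩ := hpart' y hy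
    exact ⟨k, mem_cthickening_of_dist_le x y 1 _ hk hxy⟩
  have hRm : ∀ x ∈ cthickening 1 AA, R x ∈ AA := by
    intro x hx
    obtain ⟨k, hk⟩ := hcov x hx
    rw [hRe k x hk]
    exact hpart k (hrm k hk)
  refine ⟨fun x => ⟨R x.1, hRm x.1 x.2⟩, ?_, ?_⟩
  · apply Continuous.subtype_mk
    have : ContinuousOn R (cthickening 1 AA) := hR.mono (fun x hx => by
      obtain ⟨k, hk⟩ := hcov x hx
      exact mem_iUnion.2 ⟨k, hk⟩)
    exact continuousOn_iff_continuous_domRestrict.1 this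
  · rintro ⟨x, hx⟩ hxA
    show R x = x
    obtain ⟨k, hk⟩ := hpart' x hxA
    have hk' := self_subset_cthickening (δ := (1:ℝ)) _ hk
    rw [hRe k x hk']
    exact hrid k x hk' hk

end ArcSys

/-- General position for a finite family of perturbed points. -/
theorem gen_pos {Node : Type} [Fintype Node] (h4 : 4 ≤ Fintype.card Node)
    (b : Node → Fin 3 → ℝ) :
    ∃ q : Node → Fin 3 → ℝ, (∀ ν j, |q ν j - b ν j| ≤ 1) ∧
      ∀ (c : Node → ℝ) (S : Finset Node), S.card ≤ 4 → (∀ ν, ν ∉ S → c ν = 0) →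
        ∑ ν, c ν = 0 → (∀ j, ∑ ν, c ν * q ν j = 0) → ∀ ν, c ν = 0 := by
  obtain ⟨t, ht⟩ : ∃ t : Node → ℝ, Injective t :=
    ⟨fun ν => ((Fintype.equivFin Node ν : ℕ) : ℝ), fun x y h => by
      have : ((Fintype.equivFin Node x : ℕ)) = (Fintype.equivFin Node y : ℕ) := by
        simpa using h
      exact (Fintype.equivFin Node).injective (Fin.ext this)⟩
  let Bm : (Fin 4 → Node) → Matrix (Fin 4) (Fin 4) ℝ := fun g i j =>
    Fin.cases (motive := fun _ => ℝ) 0 (fun k => b (g i) k) j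
  let Vm : (Fin 4 → Node) → Matrix (Fin 4) (Fin 4) ℝ := fun g =>
    Matrix.vandermonde (fun i => t (g i))
  let p : (Fin 4 → Node) → Polynomial ℝ := fun g =>
    Matrix.det ((Polynomial.X : Polynomial ℝ) • (Vm g).map Polynomial.C + (Bm g).map Polynomial.C)
  have hp : ∀ g, Injective g → p g ≠ 0 := by
    intro g hg h0
    have h := Polynomial.coeff_det_X_add_C_card (Vm g) (Bm g)
    have h1 : (p g).coeff (Fintype.card (Fin 4)) = (Vm g).det := h
    rw [h0, Polynomial.coeff_zero] at h1
    exact (Matrix.det_vandermonde_ne_zero_iff.2 (ht.comp hg)) h1.symm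
  have hev : ∀ g ε, (p g).eval ε = (ε • Vm g + Bm g).det := by
    intro g ε
    simp only [p]
    rw [← Polynomial.coe_evalRingHom, RingHom.map_det]
    congr 1
    ext i j
    simp
    exact mul_comm _ _
  have hfin : (⋃ g ∈ {g : Fin 4 → Node | Injective g}, {ε | (p g).IsRoot ε}).Finite := by
    apply Set.Finite.biUnion (Set.toFinite _)
    intro g hg
    exact Polynomial.finite_setOfPred_isRoot (hp g hg)
  obtain ⟨T, hT⟩ : ∃ T : ℝ, 0 < T ∧ ∀ ν (j : Fin 3), |t ν ^ ((j : ℕ) + 1)| ≤ T := by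
    refine ⟨1 + ∑ ν, ∑ j : Fin 3, |t ν ^ ((j : ℕ) + 1)|, by positivity, fun ν j => ?_⟩
    have h1 := Finset.single_le_sum (f := fun j : Fin 3 => |t ν ^ ((j : ℕ) + 1)|)
      (fun _ _ => abs_nonneg _) (Finset.mem_univ j)
    have h2 := Finset.single_le_sum (f := fun ν => ∑ j : Fin 3, |t ν ^ ((j : ℕ) + 1)|)
      (fun _ _ => by positivity) (Finset.mem_univ ν)
    linarith
  obtain ⟨ε, hε, hεb⟩ : ∃ ε ∈ Ioo (0 : ℝ) (1 / T),
      ε ∉ (⋃ g ∈ {g : Fin 4 → Node | Injective g}, {ε | (p g).IsRoot ε}) := by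
    have : (Ioo (0 : ℝ) (1 / T)).Infinite := Set.Ioo_infinite (by have := hT.1; positivity)
    exact (this.sdiff hfin).nonempty
  have hdet : ∀ g : Fin 4 → Node, Injective g → (ε • Vm g + Bm g).det ≠ 0 := by
    intro g hg h0
    apply hεb
    simp only [mem_iUnion]
    exact ⟨g, hg, by rw [← hev] at h0; exact h0⟩
  refine ⟨fun ν j => b ν j + ε * t ν ^ ((j : ℕ) + 1), fun ν j => ?_, ?_⟩
  · have h := hT.2 ν j
    rw [add_sub_cancel_left, abs_mul, abs_of_pos hε.1]
    have := hε.2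
    rw [lt_div_iff₀ hT.1] at this
    nlinarith [hε.1]
  · intro c S hS hc hs hq
    obtain ⟨S', hSS, hS'⟩ := Finset.exists_superset_card_eq hS h4
    have g0 := (Finset.equivFinOfCardEq hS').symm
    let g : Fin 4 → Node := fun i => (g0 i : Node)
    have hg : Injective g := fun x y h => g0.injective (Subtype.ext h)
    have hsum : ∀ F : Node → ℝ, ∑ ν, c ν * F ν = ∑ i, c (g i) * F (g i) := by
      intro F
      rw [← Finset.sum_subset (Finset.subset_univ S')]
      · rw [← Finset.sum_coe_sort S']
        exact (Equiv.sum_comp g0 (fun x : S' => c x * F x)).symm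
      · intro x _ hx
        rw [hc x (fun h => hx (hSS h)), zero_mul]
    have hv : Matrix.vecMul (fun i => c (g i)) (ε • Vm g + Bm g) = 0 := by
      ext j
      simp only [Matrix.vecMul, dotProduct, Matrix.add_apply, Matrix.smul_apply, smul_eq_mul,
        Pi.zero_apply]
      refine Fin.cases ?_ (fun k => ?_) j
      · have := hsum (fun _ => ε)
        rw [← Finset.sum_mul, hs, zero_mul] at this
        rw [this]
        simp [Vm, Bm, Matrix.vandermonde_apply]
      · have := hsum (fun ν => b ν k + ε * t ν ^ ((k : ℕ) + 1))
        rw [hq k] at this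
        rw [this]
        apply Finset.sum_congr rfl
        intro i _
        simp [Vm, Bm, Matrix.vandermonde_apply]
        ring_nf
        exact Or.inl trivial
    have hz := Matrix.eq_zero_of_vecMul_eq_zero (hdet g hg) hv
    intro ν
    by_cases hν : ν ∈ S'
    · have := congrFun hz (g0.symm ⟨ν, hν⟩)
      simpa [g] using this
    · exact hc ν (fun h => hν (hSS h))

/-- Piecewise linear interpolation of a sequence. -/
noncomputable def pl (x : ℕ → ℝ) (m : ℕ) (τ : ℝ) : ℝ :=
  x 0 + ∑ i ∈ Finset.range m, max 0 (min 1 (τ - i)) * (x (i + 1) - x i)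

theorem pl_cont (x : ℕ → ℝ) (m : ℕ) : Continuous (pl x m) := by
  unfold pl
  fun_prop

theorem pl_ge (x : ℕ → ℝ) (m : ℕ) (τ : ℝ) (h : (m : ℝ) ≤ τ) : pl x m τ = x m := by
  induction m with
  | zero => simp [pl]
  | succ m ih =>
    push_cast at h
    have h1 := ih (by linarith)
    unfold pl at h1 ⊢
    rw [Finset.sum_range_succ, ← add_assoc, h1, min_eq_left (by linarith), max_eq_right (by norm_num)]
    ring

theorem pl_eq (x : ℕ → ℝ) (m k : ℕ) (τ : ℝ) (hk : k < m) (h1 : (k : ℝ) ≤ τ) (h2 : τ ≤ k + 1) :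
    pl x m τ = (1 - (τ - k)) * x k + (τ - k) * x (k + 1) := by
  induction m with
  | zero => omega
  | succ m ih =>
    have hs : pl x (m + 1) τ = pl x m τ + max 0 (min 1 (τ - m)) * (x (m + 1) - x m) := by
      unfold pl
      rw [Finset.sum_range_succ, ← add_assoc]
    rw [hs]
    rcases Nat.lt_succ_iff_lt_or_eq.1 hk with h | h
    · rw [ih h]
      have : ((k : ℝ) + 1) ≤ m := by exact_mod_cast h
      rw [max_eq_left ((min_le_right _ _).trans (by linarith))]
      ring
    · subst h
      rw [pl_ge x k τ h1, min_eq_right (by linarith), max_eq_right (by linarith)]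
      ring

theorem pl_zero (x : ℕ → ℝ) (m : ℕ) (hm : 0 < m) : pl x m 0 = x 0 := by
  rw [pl_eq x m 0 0 hm (by simp) (by simp)]
  simp

theorem exists_seg (m : ℕ) (τ : ℝ) (hm : 0 < m) (h : τ ∈ Icc (0 : ℝ) m) :
    ∃ k : ℕ, k < m ∧ (k : ℝ) ≤ τ ∧ τ ≤ k + 1 ∧ (τ < m → τ < k + 1) := by
  rcases lt_or_eq_of_le h.2 with h2 | h2
  · refine ⟨⌊τ⌋₊, ?_, Nat.floor_le h.1, (Nat.lt_floor_add_one τ).le, fun _ => Nat.lt_floor_add_one τ⟩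
    exact (Nat.floor_lt h.1).2 h2
  · refine ⟨m - 1, by omega, ?_, ?_, fun h => absurd h2 h.ne⟩ <;>
    · rw [Nat.cast_sub (by omega), h2]; simp

theorem gp_two {Node : Type} [Fintype Node] {q : Node → Fin 3 → ℝ}
    (hq : ∀ (c : Node → ℝ) (S : Finset Node), S.card ≤ 4 → (∀ ν, ν ∉ S → c ν = 0) →
        ∑ ν, c ν = 0 → (∀ j, ∑ ν, c ν * q ν j = 0) → ∀ ν, c ν = 0)
    (n1 n2 n3 n4 : Node) (t t' : ℝ)
    (h : ∀ j, (1 - t) * q n1 j + t * q n2 j = (1 - t') * q n3 j + t' * q n4 j) (F : Node → ℝ) :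
    (1 - t) * F n1 + t * F n2 = (1 - t') * F n3 + t' * F n4 := by
  set c : Node → ℝ := fun ν => (1 - t) * (if ν = n1 then 1 else 0) + t * (if ν = n2 then 1 else 0)
    - (1 - t') * (if ν = n3 then 1 else 0) - t' * (if ν = n4 then 1 else 0) with hc
  have key : ∀ F : Node → ℝ, ∑ ν, c ν * F ν =
      (1 - t) * F n1 + t * F n2 - (1 - t') * F n3 - t' * F n4 := by
    intro F
    simp only [hc, sub_mul, add_mul, Finset.sum_sub_distrib, Finset.sum_add_distrib]
    simp
  have h0 := hq c {n1, n2, n3, n4} Finset.card_le_four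
    (fun ν hν => by
      simp only [Finset.mem_insert, Finset.mem_singleton, not_or] at hν
      simp [hc, hν.1, hν.2.1, hν.2.2.1, hν.2.2.2])
    (by have := key (fun _ => 1); simp only [mul_one] at this; rw [this]; ring)
    (fun j => by rw [key (fun ν => q ν j)]; linarith [h j])
  have := key F
  simp only [h0, zero_mul, Finset.sum_const_zero] at this
  linarith

/-- The polygonal arc system. -/
theorem poly_arcs {V ι Node : Type} [Fintype Node] {q : Node → Fin 3 → ℝ}
    (hq : ∀ (c : Node → ℝ) (S : Finset Node), S.card ≤ 4 → (∀ ν, ν ∉ S → c ν = 0) →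
        ∑ ν, c ν = 0 → (∀ j, ∑ ν, c ν * q ν j = 0) → ∀ ν, c ν = 0)
    (a b : ι → V) (hab : ∀ e, a e ≠ b e) (m : ℕ) (hm : 2 ≤ m)
    (vert : V → Node) (node : ι → ℕ → Node) (hvi : Injective vert)
    (h0 : ∀ e, node e 0 = vert (a e)) (h1 : ∀ e, node e m = vert (b e))
    (own lev : ι → Node → ℝ)
    (hv : ∀ e v, own e (vert v) = 0)
    (hown : ∀ e k, 0 < k → k < m → own e (node e k) = 1)
    (hown' : ∀ e e' k, e ≠ e' → k ≤ m → own e (node e' k) = 0)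
    (hlev : ∀ e k, k ≤ m → lev e (node e k) = k) :
    ArcSys a b (m : ℝ) (fun v => (WithLp.toLp 2 (q (vert v)) : EuclideanSpace ℝ (Fin 3)))
      (fun e τ => WithLp.toLp 2 (fun j => pl (fun k => q (node e k) j) m τ)) := by
  have hown0 : ∀ e k, k ≤ m → 0 ≤ own e (node e k) := by
    intro e k hk
    rcases Nat.eq_zero_or_pos k with h | h
    · rw [h, h0, hv]
    · rcases hk.lt_or_eq with h' | h'
      · rw [hown e k h h']; norm_num
      · rw [h', h1, hv]
  have hpos : ∀ e k (τ : ℝ), τ ∈ Ioo (0 : ℝ) m → k < m → (k : ℝ) ≤ τ → τ < k + 1 →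
      0 < (1 - (τ - k)) * own e (node e k) + (τ - k) * own e (node e (k + 1)) := by
    intro e k τ hτ hk hk1 hk2
    rcases Nat.eq_zero_or_pos k with h | h
    · subst h
      rw [h0, hv, hown e _ (by omega) (by omega)]
      have := hτ.1
      simpa using this
    · rw [hown e k h hk]
      have := mul_nonneg (sub_nonneg.2 hk1) (hown0 e (k + 1) hk)
      linarith
  refine ⟨by positivity, hab, ?_, ?_, ?_, ?_, ?_, ?_⟩
  · intro e
    have : ∀ j, Continuous (pl (fun k => q (node e k) j) m) := fun j => pl_cont _ _
    fun_prop
  · intro e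
    ext j
    simp [pl_zero _ m (by omega), h0]
  · intro e
    ext j
    simp [pl_ge, h1]
  · intro v v' h
    have hh : ∀ j, q (vert v) j = q (vert v') j := fun j => congrFun (WithLp.toLp_injective 2 h) j
    have := gp_two hq (vert v) (vert v) (vert v') (vert v') 0 0 (by simpa using hh)
      (fun ν => if ν = vert v then 1 else 0)
    by_contra hne
    have hne' : vert v' ≠ vert v := fun h => hne (hvi h).symm
    simp [hne'] at this
  · intro e e' s s' hs hs' h
    have hh : ∀ j, pl (fun k => q (node e k) j) m s = pl (fun k => q (node e' k) j) m s' :=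
      fun j => congrFun (WithLp.toLp_injective 2 h) j
    obtain ⟨k, hk, hk1, hk2, hk3⟩ := exists_seg m s (by omega) ⟨hs.1.le, hs.2.le⟩
    obtain ⟨k', hk', hk1', hk2', hk3'⟩ := exists_seg m s' (by omega) ⟨hs'.1.le, hs'.2.le⟩
    have h2 : ∀ j, _ := fun j => by
      have := hh j
      rw [pl_eq _ m k s hk hk1 hk2, pl_eq _ m k' s' hk' hk1' hk2'] at this
      exact this
    have key := gp_two hq _ _ _ _ _ _ h2
    have hee : e = e' := by
      by_contra hne
      have h3 := key (own e)
      have h4 := hpos e k s hs hk hk1 (hk3 hs.2)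
      rw [h3, hown' e e' _ hne hk'.le, hown' e e' _ hne hk'] at h4
      simp at h4
    subst hee
    refine ⟨rfl, ?_⟩
    have h3 := key (lev e)
    rw [hlev e k hk.le, hlev e _ hk, hlev e k' hk'.le, hlev e _ hk'] at h3
    push_cast at h3
    linarith
  · intro e s v hs h
    have hh : ∀ j, pl (fun k => q (node e k) j) m s = q (vert v) j :=
      fun j => congrFun (WithLp.toLp_injective 2 h) j
    obtain ⟨k, hk, hk1, hk2, hk3⟩ := exists_seg m s (by omega) ⟨hs.1.le, hs.2.le⟩
    have key := gp_two hq (node e k) (node e (k + 1)) (vert v) (vert v) (s - k) 0 (fun j => by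
      have := hh j
      rw [pl_eq _ m k s hk hk1 hk2] at this
      rw [this]; ring) (own e)
    have h4 := hpos e k s hs hk hk1 (hk3 hs.2)
    rw [key, hv] at h4
    simp at h4

theorem ranks {𝒦 ι : Type} [Fintype 𝒦] [Fintype ι] (κ : ι → 𝒦) :
    ∃ (base : 𝒦 → ℕ) (pos : ι → ℕ), Injective pos ∧ (∀ e, base (κ e) < pos e) ∧
      (∀ e, pos e < Fintype.card 𝒦 + Fintype.card ι) ∧
      (∀ k, base k < Fintype.card 𝒦 + Fintype.card ι) ∧
      ∀ k k', k ≠ k' → (base k < base k' ∧ ∀ e, κ e = k → pos e < base k') ∨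
        (base k' < base k ∧ ∀ e, κ e = k' → pos e < base k) := by
  let nk : 𝒦 → ℕ := fun k => Fintype.equivFin 𝒦 k
  let ni : ι → ℕ := fun e => Fintype.equivFin ι e
  have hnk : Injective nk := fun x y h => (Fintype.equivFin 𝒦).injective (Fin.ext h)
  have hni : Injective ni := fun x y h => (Fintype.equivFin ι).injective (Fin.ext h)
  have hlt : ∀ e, ni e < Fintype.card ι := fun e => (Fintype.equivFin ι e).2
  set c := Fintype.card ι + 1 with hc
  let key : 𝒦 ⊕ ι → ℕ := Sum.elim (fun k => nk k * c) (fun e => nk (κ e) * c + 1 + ni e)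
  let r : 𝒦 ⊕ ι → ℕ := fun j => (Finset.univ.filter (fun j' => key j' < key j)).card
  have hmono : ∀ i j, key i < key j → r i < r j := by
    intro i j h
    apply Finset.card_lt_card
    rw [Finset.ssubset_iff_of_subset]
    · exact ⟨i, by simp [h], by simp⟩
    · intro x hx
      simp only [Finset.mem_filter, Finset.mem_univ, true_and] at hx ⊢
      omega
  have hr : ∀ j, r j < Fintype.card 𝒦 + Fintype.card ι := by
    intro j
    rw [← Fintype.card_sum, ← Finset.card_univ]
    apply Finset.card_lt_card
    rw [Finset.ssubset_iff_of_subset (Finset.subset_univ _)]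
    exact ⟨j, by simp, by simp⟩
  have hsplit : ∀ i j, i < j → i * c + c ≤ j * c := by
    intro i j h
    have : (i + 1) * c ≤ j * c := Nat.mul_le_mul_right _ h
    linarith
  have hcmp : ∀ k k', nk k < nk k' → r (Sum.inl k) < r (Sum.inl k') ∧
      ∀ e, κ e = k → r (Sum.inr e) < r (Sum.inl k') := by
    intro k k' h
    have := hsplit _ _ h
    refine ⟨hmono _ _ ?_, fun e he => hmono _ _ ?_⟩
    · simp only [key, Sum.elim_inl]; omega
    · simp only [key, Sum.elim_inl, Sum.elim_inr, he]
      have := hlt e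
      omega
  refine ⟨fun k => r (Sum.inl k), fun e => r (Sum.inr e), ?_, ?_, fun e => hr _, fun e => hr _, ?_⟩
  · intro e e' h
    have hk : key (Sum.inr e) = key (Sum.inr e') := by
      rcases lt_trichotomy (key (Sum.inr e)) (key (Sum.inr e')) with h' | h' | h'
      · exact absurd h (hmono _ _ h').ne
      · exact h'
      · exact absurd h (hmono _ _ h').ne'
    simp only [key, Sum.elim_inr] at hk
    have h1 := hlt e
    have h2 := hlt e'
    apply hni
    rcases lt_trichotomy (nk (κ e)) (nk (κ e')) with h' | h' | h'
    · have := hsplit _ _ h'; omega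
    · rw [h'] at hk; omega
    · have := hsplit _ _ h'; omega
  · intro e
    apply hmono
    simp only [key, Sum.elim_inl, Sum.elim_inr]; omega
  · intro k k' h
    rcases lt_or_gt_of_ne (fun h' => h (hnk h') : nk k ≠ nk k') with h' | h'
    · exact Or.inl (hcmp _ _ h')
    · exact Or.inr (hcmp _ _ h')

/-- Adjacent lattice points. -/
def Adj3 (p q : Fin 3 → ℤ) : Prop :=
  (p 0 = q 0 ∧ p 1 = q 1 ∧ p 2 ≤ q 2 + 1 ∧ q 2 ≤ p 2 + 1) ∨
  (p 0 = q 0 ∧ p 2 = q 2 ∧ p 1 ≤ q 1 + 1 ∧ q 1 ≤ p 1 + 1) ∨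
  (p 1 = q 1 ∧ p 2 = q 2 ∧ p 0 ≤ q 0 + 1 ∧ q 0 ≤ p 0 + 1)

theorem adj3_sep {p q p' q' : Fin 3 → ℤ} (h : Adj3 p q) (h' : Adj3 p' q')
    (h1 : p ≠ p') (h2 : p ≠ q') (h3 : q ≠ p') (h4 : q ≠ q') :
    ∃ j, max (p j) (q j) + 1 ≤ min (p' j) (q' j) ∨ max (p' j) (q' j) + 1 ≤ min (p j) (q j) := by
  have hne : ∀ u v : Fin 3 → ℤ, u ≠ v → u 0 ≠ v 0 ∨ u 1 ≠ v 1 ∨ u 2 ≠ v 2 := by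
    intro u v h
    by_contra hc
    push Not at hc
    apply h
    ext j
    fin_cases j
    · exact hc.1
    · exact hc.2.1
    · exact hc.2.2
  have g1 := hne _ _ h1
  have g2 := hne _ _ h2
  have g3 := hne _ _ h3
  have g4 := hne _ _ h4
  by_contra hc
  push Not at hc
  have c0 := hc 0
  have c1 := hc 1
  have c2 := hc 2
  unfold Adj3 at h h'
  clear hc hne h1 h2 h3 h4
  generalize p 0 = p0 at *
  generalize p 1 = p1 at *
  generalize p 2 = p2 at *
  generalize q 0 = q0 at *
  generalize q 1 = q1 at *
  generalize q 2 = q2 at *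
  generalize p' 0 = p0' at *
  generalize p' 1 = p1' at *
  generalize p' 2 = p2' at *
  generalize q' 0 = q0' at *
  generalize q' 1 = q1' at *
  generalize q' 2 = q2' at *
  rcases h with h | h | h <;> rcases h' with h' | h' | h' <;>
    obtain ⟨r1, r2, r3, r4⟩ := h <;> obtain ⟨r1', r2', r3', r4'⟩ := h' <;> subst r1 r2 r1' r2' <;>
    simp only [max_self, min_self] at * <;> omega

/-- Reflection in every other row. -/
def ref (n q r : ℕ) : ℤ := if q % 2 = 0 then (r : ℤ) else (n : ℤ) - 1 - r

/-- The boustrophedon path. -/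
def snake (n : ℕ) (k : ℕ) : Fin 3 → ℤ :=
  ![ref n (k / n) (k % n), ref n (k / n / n) (k / n % n), (k / n / n : ℕ)]

theorem step_div (n k : ℕ) (hn : 0 < n) :
    ((k + 1) / n = k / n ∧ (k + 1) % n = k % n + 1) ∨
    ((k + 1) / n = k / n + 1 ∧ k % n = n - 1 ∧ (k + 1) % n = 0) := by
  have h1 := Nat.div_add_mod k n
  have h2 := Nat.mod_lt k hn
  by_cases h : k % n + 1 < n
  · left
    have : (k + 1) = (k % n + 1) + n * (k / n) := by omega
    constructor
    · conv_lhs => rw [this]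
      rw [Nat.add_mul_div_left _ _ hn, Nat.div_eq_of_lt h, zero_add]
    · conv_lhs => rw [this]
      rw [Nat.add_mul_mod_self_left, Nat.mod_eq_of_lt h]
  · right
    have : (k + 1) = n * (k / n + 1) := by rw [mul_add]; omega
    refine ⟨?_, by omega, ?_⟩
    · conv_lhs => rw [this]
      exact Nat.mul_div_cancel_left _ hn
    · conv_lhs => rw [this]
      exact Nat.mul_mod_right _ _

theorem snake_adj (n k : ℕ) (hn : 0 < n) : Adj3 (snake n k) (snake n (k + 1)) := by
  unfold Adj3 snake ref
  simp only [Matrix.cons_val_zero, Matrix.cons_val_one, Matrix.cons_val]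
  have h2 := Nat.mod_lt k hn
  have h3 := Nat.mod_lt (k / n) hn
  rcases step_div n k hn with ⟨e1, e2⟩ | ⟨e1, e2, e3⟩
  · rw [e1, e2]
    right; right
    refine ⟨rfl, rfl, ?_, ?_⟩ <;> split_ifs <;> push_cast <;> omega
  · rcases step_div n (k / n) hn with ⟨f1, f2⟩ | ⟨f1, f2, f3⟩
    · rw [e1, e2, e3, f1, f2]
      right; left
      refine ⟨?_, rfl, ?_, ?_⟩ <;> split_ifs <;> push_cast <;> omega
    · rw [e1, e2, e3, f1, f2, f3]
      left
      refine ⟨?_, ?_, ?_, ?_⟩ <;> (try split_ifs) <;> push_cast <;> omega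

theorem ref_inj {n q r r' : ℕ} (h : ref n q r = ref n q r') : r = r' := by
  unfold ref at h
  split_ifs at h <;> omega

theorem snake_inj (n : ℕ) : Injective (snake n) := by
  intro k k' h
  have h0 := congrFun h 0
  have h1 := congrFun h 1
  have h2 := congrFun h 2
  unfold snake at h0 h1 h2
  simp only [Matrix.cons_val_zero, Matrix.cons_val_one, Matrix.cons_val] at h0 h1 h2
  have g2 : k / n / n = k' / n / n := by exact_mod_cast h2
  rw [g2] at h1
  have g1 := ref_inj h1
  have g : k / n = k' / n := by
    rw [← Nat.div_add_mod (k / n) n, ← Nat.div_add_mod (k' / n) n, g1, g2]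
  rw [g] at h0
  have g0 := ref_inj h0
  rw [← Nat.div_add_mod k n, ← Nat.div_add_mod k' n, g, g0]

theorem snake_bound (n k : ℕ) (hn : 0 < n) (hk : k < n ^ 3) (j : Fin 3) :
    0 ≤ snake n k j ∧ snake n k j ≤ n := by
  have h2 := Nat.mod_lt k hn
  have h3 := Nat.mod_lt (k / n) hn
  have h4 : k / n / n < n := by
    rw [Nat.div_lt_iff_lt_mul hn, Nat.div_lt_iff_lt_mul hn]
    calc k < n ^ 3 := hk
      _ = n * n * n := by ring
  unfold snake ref
  fin_cases j
  · simp only [Fin.zero_eta, Matrix.cons_val_zero]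
    split_ifs <;> omega
  · simp only [Fin.mk_one, Matrix.cons_val_one, Matrix.cons_val_zero]
    split_ifs <;> omega
  · simp only [Fin.reduceFinMk, Matrix.cons_val]
    exact ⟨by positivity, by exact_mod_cast h4.le⟩

theorem adj3_refl (p : Fin 3 → ℤ) : Adj3 p p := by
  left; refine ⟨rfl, rfl, ?_, ?_⟩ <;> omega

theorem adj3_symm {p q : Fin 3 → ℤ} (h : Adj3 p q) : Adj3 q p := by
  unfold Adj3 at *
  omega

/-- Unperturbed nodes of an edge. -/
noncomputable def bn (s : ℕ → Fin 3 → ℤ) (L β p k : ℕ) (j : Fin 3) : ℝ :=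
  if k ≤ L then 100 * (s (min (β + k) p) j : ℝ)
  else if k = L + 1 then 100 * (s p j : ℝ) + (![20, 20, 0] : Fin 3 → ℝ) j
  else if k = L + 2 then 100 * (s p j : ℝ) + (![20, 20, 40] : Fin 3 → ℝ) j
  else 100 * (s (min (β + (2 * L + 3 - k)) p) j : ℝ)

theorem bn_cases (s : ℕ → Fin 3 → ℤ) (hs : ∀ i, Adj3 (s i) (s (i + 1))) (L β p k : ℕ)
    (hβ : β ≤ p) (hp : p ≤ L) (hk : k < 2 * L + 3) :
    (∃ i i', β ≤ i ∧ i ≤ p ∧ β ≤ i' ∧ i' ≤ p ∧ Adj3 (s i) (s i') ∧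
      (∀ j, bn s L β p k j = 100 * (s i j : ℝ)) ∧
      (∀ j, bn s L β p (k + 1) j = 100 * (s i' j : ℝ))) ∨
    (k = L ∧ (∀ j, bn s L β p k j = 100 * (s p j : ℝ)) ∧
      ∀ j, bn s L β p (k + 1) j = 100 * (s p j : ℝ) + (![20, 20, 0] : Fin 3 → ℝ) j) ∨
    (k = L + 1 ∧ (∀ j, bn s L β p k j = 100 * (s p j : ℝ) + (![20, 20, 0] : Fin 3 → ℝ) j) ∧
      ∀ j, bn s L β p (k + 1) j = 100 * (s p j : ℝ) + (![20, 20, 40] : Fin 3 → ℝ) j) ∨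
    (k = L + 2 ∧ (∀ j, bn s L β p k j = 100 * (s p j : ℝ) + (![20, 20, 40] : Fin 3 → ℝ) j) ∧
      ∀ j, bn s L β p (k + 1) j = 100 * (s p j : ℝ)) := by
  have hadj : ∀ x, Adj3 (s (min x p)) (s (min (x + 1) p)) := by
    intro x
    by_cases h : x < p
    · rw [min_eq_left (by omega), min_eq_left (by omega)]; exact hs x
    · rw [min_eq_right (by omega), min_eq_right (by omega)]; exact adj3_refl _
  rcases lt_trichotomy k L with h | h | h
  · left
    refine ⟨min (β + k) p, min (β + k + 1) p, by omega, by omega, by omega, by omega, hadj _, ?_, ?_⟩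
    · intro j; unfold bn; rw [if_pos h.le]
    · intro j; unfold bn; rw [if_pos (by omega)]; rfl
  · right; left
    refine ⟨h, ?_, ?_⟩
    · intro j; unfold bn; rw [if_pos h.le, min_eq_right (by omega)]
    · intro j; unfold bn; rw [if_neg (by omega), if_pos (by omega)]
  · by_cases h1 : k = L + 1
    · right; right; left
      refine ⟨h1, ?_, ?_⟩
      · intro j; unfold bn; rw [if_neg (by omega), if_pos (by omega)]
      · intro j; unfold bn; rw [if_neg (by omega), if_neg (by omega), if_pos (by omega)]
    by_cases h2 : k = L + 2
    · right; right; right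
      refine ⟨h2, ?_, ?_⟩
      · intro j; unfold bn; rw [if_neg (by omega), if_neg (by omega), if_pos (by omega)]
      · intro j; unfold bn
        rw [if_neg (by omega), if_neg (by omega), if_neg (by omega), min_eq_right (by omega)]
    · left
      refine ⟨min (β + (2 * L + 3 - (k + 1)) + 1) p, min (β + (2 * L + 3 - (k + 1))) p,
        by omega, by omega, by omega, by omega, adj3_symm (hadj _), ?_, ?_⟩
      · intro j; unfold bn; rw [if_neg (by omega), if_neg (by omega), if_neg (by omega)]
        congr 4; omega
      · intro j; unfold bn; rw [if_neg (by omega), if_neg (by omega), if_neg (by omega)]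

/-- Points near the lattice path. -/
def NL (s : ℕ → Fin 3 → ℤ) (β p : ℕ) (x : Fin 3 → ℝ) : Prop :=
  ∃ i i', β ≤ i ∧ i ≤ p ∧ β ≤ i' ∧ i' ≤ p ∧ Adj3 (s i) (s i') ∧
    ∀ j, 100 * min (s i j : ℝ) (s i' j) - 1 ≤ x j ∧ x j ≤ 100 * max (s i j : ℝ) (s i' j) + 1

theorem comb_near {t A B c d : ℝ} (ht : 0 ≤ t) (ht1 : t ≤ 1) (h1 : |A - c| ≤ 1) (h2 : |B - d| ≤ 1) :
    (1 - t) * c + t * d - 1 ≤ (1 - t) * A + t * B ∧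
    (1 - t) * A + t * B ≤ (1 - t) * c + t * d + 1 := by
  rw [abs_le] at h1 h2
  constructor <;> nlinarith [h1.1, h1.2, h2.1, h2.2]

theorem comb_box {t c d : ℝ} (ht : 0 ≤ t) (ht1 : t ≤ 1) :
    100 * min c d ≤ (1 - t) * (100 * c) + t * (100 * d) ∧
    (1 - t) * (100 * c) + t * (100 * d) ≤ 100 * max c d := by
  have h1 := min_le_left c d
  have h2 := min_le_right c d
  have h3 := le_max_left c d
  have h4 := le_max_right c d
  constructor <;> nlinarith

/-- Classification of the points of an edge. -/
theorem edge_cases (s : ℕ → Fin 3 → ℤ) (hs : ∀ i, Adj3 (s i) (s (i + 1))) (L β p : ℕ)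
    (hβ : β ≤ p) (hp : p ≤ L) (Q : ℕ → Fin 3 → ℝ)
    (hQ : ∀ k j, k ≤ 2 * L + 3 → |Q k j - bn s L β p k j| ≤ 1) (τ : ℝ)
    (hτ : τ ∈ Icc (0 : ℝ) ((2 * L + 3 : ℕ) : ℝ)) (x : Fin 3 → ℝ)
    (hx : ∀ j, x j = pl (fun k => Q k j) (2 * L + 3) τ) :
    NL s β p x ∨
    (∃ t : ℝ, 0 ≤ t ∧ t ≤ 1 ∧ ∀ j, 100 * (s p j : ℝ) + t * (![20, 20, 0] : Fin 3 → ℝ) j - 1 ≤ x j ∧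
      x j ≤ 100 * (s p j : ℝ) + t * (![20, 20, 0] : Fin 3 → ℝ) j + 1) ∨
    (τ ∈ Icc ((L : ℝ) + 1) (L + 2) ∧ ∀ j, 100 * (s p j : ℝ) + (![20, 20, 0] : Fin 3 → ℝ) j - 1 ≤ x j ∧
      x j ≤ 100 * (s p j : ℝ) + (![20, 20, 40] : Fin 3 → ℝ) j + 1) ∨
    (∃ t : ℝ, 0 ≤ t ∧ t ≤ 1 ∧ ∀ j, 100 * (s p j : ℝ) + t * (![20, 20, 40] : Fin 3 → ℝ) j - 1 ≤ x j ∧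
      x j ≤ 100 * (s p j : ℝ) + t * (![20, 20, 40] : Fin 3 → ℝ) j + 1) := by
  obtain ⟨k, hk, hk1, hk2, -⟩ := exists_seg _ τ (by omega) hτ
  have hx' : ∀ j, x j = (1 - (τ - k)) * Q k j + (τ - k) * Q (k + 1) j := fun j => by
    rw [hx j, pl_eq _ _ k τ hk hk1 hk2]
  have hn := fun j => comb_near (t := τ - k) (by linarith) (by linarith) (hQ k j hk.le) (hQ (k + 1) j hk)
  rcases bn_cases s hs L β p k hβ hp hk with ⟨i, i', h1, h2, h3, h4, h5, h6, h7⟩ |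
    ⟨h1, h2, h3⟩ | ⟨h1, h2, h3⟩ | ⟨h1, h2, h3⟩
  · left
    refine ⟨i, i', h1, h2, h3, h4, h5, fun j => ?_⟩
    have := hn j
    rw [h6, h7, ← hx'] at this
    have h8 := comb_box (t := τ - k) (c := (s i j : ℝ)) (d := (s i' j : ℝ)) (by linarith) (by linarith)
    constructor <;> linarith [this.1, this.2, h8.1, h8.2]
  · right; left
    refine ⟨τ - k, by linarith, by linarith, fun j => ?_⟩
    have := hn j
    rw [h2, h3, ← hx'] at this
    constructor <;> linarith [this.1, this.2]
  · right; right; left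
    subst h1
    push_cast at hk1 hk2
    refine ⟨⟨by linarith, by linarith⟩, fun j => ?_⟩
    have := hn j
    rw [h2, h3, ← hx'] at this
    push_cast at this
    generalize hw : 100 * (s p j : ℝ) = w at *
    fin_cases j <;> simp at this ⊢ <;> constructor <;> nlinarith [this.1, this.2]
  · right; right; right
    refine ⟨1 - (τ - k), by linarith, by linarith, fun j => ?_⟩
    have := hn j
    rw [h2, h3, ← hx'] at this
    constructor <;> linarith [this.1, this.2]

/-- Coarse location. -/
def Coarse (s : ℕ → Fin 3 → ℤ) (β p : ℕ) (x : Fin 3 → ℝ) : Prop :=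
  ∃ i i', β ≤ i ∧ i ≤ p ∧ β ≤ i' ∧ i' ≤ p ∧ Adj3 (s i) (s i') ∧
    ∀ j, 100 * min (s i j : ℝ) (s i' j) - 1 ≤ x j ∧ x j ≤ 100 * max (s i j : ℝ) (s i' j) + 41

theorem NL.coarse {s : ℕ → Fin 3 → ℤ} {β p : ℕ} {x : Fin 3 → ℝ} (h : NL s β p x) :
    Coarse s β p x := by
  obtain ⟨i, i', h1, h2, h3, h4, h5, h6⟩ := h
  exact ⟨i, i', h1, h2, h3, h4, h5, fun j => ⟨(h6 j).1, by linarith [(h6 j).2]⟩⟩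

theorem edge_coarse (s : ℕ → Fin 3 → ℤ) (hs : ∀ i, Adj3 (s i) (s (i + 1))) (L β p : ℕ)
    (hβ : β ≤ p) (hp : p ≤ L) (Q : ℕ → Fin 3 → ℝ)
    (hQ : ∀ k j, k ≤ 2 * L + 3 → |Q k j - bn s L β p k j| ≤ 1) (τ : ℝ)
    (hτ : τ ∈ Icc (0 : ℝ) ((2 * L + 3 : ℕ) : ℝ)) (x : Fin 3 → ℝ)
    (hx : ∀ j, x j = pl (fun k => Q k j) (2 * L + 3) τ) :
    NL s β p x ∨ ∀ j, 100 * (s p j : ℝ) - 1 ≤ x j ∧ x j ≤ 100 * (s p j : ℝ) + 41 := by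
  rcases edge_cases s hs L β p hβ hp Q hQ τ hτ x hx with h | ⟨t, h1, h2, h3⟩ | ⟨-, h3⟩ |
    ⟨t, h1, h2, h3⟩
  · exact Or.inl h
  all_goals
    right
    intro j
    have := h3 j
    generalize 100 * (s p j : ℝ) = w at *
    fin_cases j <;> simp at this ⊢ <;> constructor <;> linarith [this.1, this.2]

theorem coarse_sep {s : ℕ → Fin 3 → ℤ} (hi : Injective s) {β p β' p' : ℕ} (h : p < β')
    {x y : Fin 3 → ℝ} (hx : Coarse s β p x) (hy : Coarse s β' p' y) : ∃ j, 2 < |x j - y j| := by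
  obtain ⟨i, i', h1, h2, h3, h4, h5, h6⟩ := hx
  obtain ⟨k, k', g1, g2, g3, g4, g5, g6⟩ := hy
  obtain ⟨j, hj⟩ := adj3_sep h5 g5 (hi.ne (by omega)) (hi.ne (by omega)) (hi.ne (by omega))
    (hi.ne (by omega))
  refine ⟨j, ?_⟩
  have a1 := h6 j
  have a2 := g6 j
  rw [lt_abs]
  rcases hj with hj | hj
  · right
    have : max (s i j : ℝ) (s i' j) + 1 ≤ min (s k j : ℝ) (s k' j) := by exact_mod_cast hj
    linarith [a1.2, a2.1]
  · left
    have : max (s k j : ℝ) (s k' j) + 1 ≤ min (s i j : ℝ) (s i' j) := by exact_mod_cast hj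
    linarith [a1.1, a2.2]

theorem int_near {z c : ℤ} (h1 : 100 * (z : ℝ) < 100 * c + 100) (h2 : 100 * (c : ℝ) < 100 * z + 100) :
    z = c := by
  have h3 : (z : ℝ) < c + 1 := by linarith
  have h4 : (c : ℝ) < z + 1 := by linarith
  have h5 : z < c + 1 := by exact_mod_cast h3
  have h6 : c < z + 1 := by exact_mod_cast h4
  omega

theorem NL.not_tunnel {s : ℕ → Fin 3 → ℤ} {β p : ℕ} {x : Fin 3 → ℝ} (h : NL s β p x) (c : Fin 3 → ℤ)
    (hc : ∀ j, |x j - (100 * (c j : ℝ) + 20)| ≤ 6) : False := by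
  obtain ⟨i, i', -, -, -, -, h5, h6⟩ := h
  have key : ∀ j, s i j = s i' j → False := by
    intro j hj
    have h1 := h6 j
    rw [hj, min_self, max_self] at h1
    have h2 := abs_le.1 (hc j)
    have := int_near (z := s i' j) (c := c j) (by linarith [h1.1, h2.2]) (by linarith [h1.2, h2.1])
    rw [this] at h1
    linarith [h1.2, h2.1]
  rcases h5 with h | h | h
  · exact key _ h.1
  · exact key _ h.1
  · exact key _ h.1

theorem coord_dist (x y : EuclideanSpace ℝ (Fin 3)) (j : Fin 3) : |x j - y j| ≤ dist x y := by
  have := PiLp.norm_apply_le (x - y) j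
  rw [dist_eq_norm]
  simpa using this

theorem norm_le_coord (x : EuclideanSpace ℝ (Fin 3)) (r : ℝ) (hr : 0 ≤ r) (h : ∀ j, |x j| ≤ r) :
    ‖x‖ ≤ 2 * r := by
  rw [EuclideanSpace.norm_eq, Real.sqrt_le_left (by positivity), Fin.sum_univ_three]
  have : ∀ j, ‖x j‖ ^ 2 ≤ r ^ 2 := fun j => by
    rw [Real.norm_eq_abs]
    exact pow_le_pow_left₀ (abs_nonneg _) (h j) 2
  nlinarith [this 0, this 1, this 2]

theorem layout {V ι 𝒦 : Type} [Fintype V] [Fintype ι] [Fintype 𝒦] (a b : ι → V)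
    (hab : ∀ e, a e ≠ b e) (κ : V → 𝒦) (hκs : Surjective κ) (hκ : ∀ e, κ (a e) = κ (b e))
    (hconn : ∀ k (S : Set V), (∃ v ∈ S, κ v = k) → (∀ e, a e ∈ S ↔ b e ∈ S) →
      ∀ v, κ v = k → v ∈ S)
    (n : ℕ) (hn : 0 < n) (hM : Fintype.card 𝒦 + Fintype.card ι ≤ n ^ 3) :
    ∃ (m : ℝ) (P : V → EuclideanSpace ℝ (Fin 3)) (γ : ι → ℝ → EuclideanSpace ℝ (Fin 3)),
      ArcSys a b m P γ ∧
      RetractsOnto (cthickening 1 (range P ∪ ⋃ e, γ e '' Icc 0 m))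
        (range P ∪ ⋃ e, γ e '' Icc 0 m) ∧
      ∀ x ∈ (range P ∪ ⋃ e, γ e '' Icc 0 m), ‖x‖ ≤ 300 * n := by
  obtain ⟨base, pos, hposi, hbp, hposb, hbaseb, hord⟩ := ranks (fun e => κ (a e))
  obtain ⟨L, hL⟩ : ∃ L, L = n ^ 3 := ⟨_, rfl⟩
  obtain ⟨s, hs⟩ : ∃ s, s = snake n := ⟨_, rfl⟩
  have hadj : ∀ i, Adj3 (s i) (s (i + 1)) := fun i => hs ▸ snake_adj n i hn
  have hsi : Injective s := hs ▸ snake_inj n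
  have hsb : ∀ i j, i < n ^ 3 → 0 ≤ s i j ∧ s i j ≤ n := fun i j h => hs ▸ snake_bound n i hn h j
  have hpL : ∀ e, pos e ≤ L := fun e => by have := hposb e; omega
  obtain ⟨m, hm⟩ : ∃ m, m = 2 * L + 3 := ⟨_, rfl⟩
  let β : ι → ℕ := fun e => base (κ (a e))
  have hβ : ∀ e, β e ≤ pos e := fun e => (hbp e).le
  let bb : V ⊕ (Option ι × Fin (m + 1)) → Fin 3 → ℝ := Sum.elim
    (fun v j => 100 * (s (base (κ v)) j : ℝ))
    (fun z => match z with
      | (none, _) => fun _ => 0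
      | (some e, k) => bn s L (β e) (pos e) k)
  obtain ⟨q, hq1, hq⟩ := gen_pos (Node := V ⊕ (Option ι × Fin (m + 1))) (by
    simp only [Fintype.card_sum, Fintype.card_prod, Fintype.card_option, Fintype.card_fin]
    nlinarith [Nat.zero_le (Fintype.card V), Nat.zero_le (Fintype.card ι)]) bb
  let node : ι → ℕ → V ⊕ (Option ι × Fin (m + 1)) := fun e k =>
    if k = 0 then Sum.inl (a e) else if k = m then Sum.inl (b e) else
      Sum.inr (some e, Fin.ofNat (m + 1) k)
  have hnode0 : ∀ e, node e 0 = Sum.inl (a e) := fun e => by simp [node]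
  have hnodem : ∀ e, node e m = Sum.inl (b e) := fun e => by
    simp only [node]; rw [if_neg (by omega)]; simp
  have hnodek : ∀ e k, 0 < k → k < m → node e k = Sum.inr (some e, Fin.ofNat (m + 1) k) := by
    intro e k h1 h2
    simp only [node]; rw [if_neg (by omega), if_neg (by omega)]
  have hof : ∀ k, k < m → ((Fin.ofNat (m + 1) k : Fin (m + 1)) : ℕ) = k := by
    intro k hk
    simp only [Fin.val_ofNat]
    exact Nat.mod_eq_of_lt (by omega)
  have hbb : ∀ e k j, k ≤ m → bb (node e k) j = bn s L (β e) (pos e) k j := by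
    intro e k j hk
    rcases Nat.eq_zero_or_pos k with h | h
    · subst h
      rw [hnode0]
      simp only [bb, Sum.elim_inl, bn]
      rw [if_pos (by omega), add_zero, min_eq_left (hβ e)]
    · rcases hk.lt_or_eq with h' | h'
      · rw [hnodek e k h h']
        simp only [bb, Sum.elim_inr]
        rw [hof k h']
      · subst h'
        rw [hnodem]
        simp only [bb, Sum.elim_inl, bn]
        rw [if_neg (by omega), if_neg (by omega), if_neg (by omega), ← hκ,
          show 2 * L + 3 - k = 0 by omega, add_zero, min_eq_left (hβ e)]
  have hQ : ∀ e k j, k ≤ 2 * L + 3 → |q (node e k) j - bn s L (β e) (pos e) k j| ≤ 1 := by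
    intro e k j hk
    rw [← hbb e k j (by omega)]
    exact hq1 _ _
  have A := poly_arcs hq a b hab m (by omega) Sum.inl node Sum.inl_injective hnode0 hnodem
    (fun e => Sum.elim (fun _ => 0) (fun z => if z.1 = some e then 1 else 0))
    (fun e => Sum.elim (fun v => if v = b e then (m : ℝ) else 0) (fun z => ((z.2 : ℕ) : ℝ)))
    (fun e v => rfl)
    (fun e k h1 h2 => by rw [hnodek e k h1 h2]; simp)
    (fun e e' k hne hk => by
      rcases Nat.eq_zero_or_pos k with h | h
      · subst h; rw [hnode0]; rfl
      · rcases hk.lt_or_eq with h' | h'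
        · rw [hnodek e' k h h']; simp [Ne.symm hne]
        · subst h'; rw [hnodem]; rfl)
    (fun e k hk => by
      rcases Nat.eq_zero_or_pos k with h | h
      · subst h; rw [hnode0]; simp [hab e]
      · rcases hk.lt_or_eq with h' | h'
        · rw [hnodek e k h h']; simp only [Sum.elim_inr]; rw [hof k h']
        · subst h'; rw [hnodem]; simp)
  set P : V → EuclideanSpace ℝ (Fin 3) := fun v => WithLp.toLp 2 (q (Sum.inl v)) with hP
  set γ : ι → ℝ → EuclideanSpace ℝ (Fin 3) :=
    fun e τ => WithLp.toLp 2 (fun j => pl (fun k => q (node e k) j) m τ) with hγ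
  have hγj : ∀ e τ j, γ e τ j = pl (fun k => q (node e k) j) (2 * L + 3) τ := by
    intro e τ j; rw [← hm]
  have hmR : (m : ℝ) = ((2 * L + 3 : ℕ) : ℝ) := by rw [hm]
  have hmR' : (m : ℝ) = 2 * L + 3 := by rw [hm]; push_cast; ring
  -- vertices
  have hvert : ∀ v, NL s (base (κ v)) (base (κ v)) (fun j => P v j) := by
    intro v
    refine ⟨_, _, le_rfl, le_rfl, le_rfl, le_rfl, adj3_refl _, fun j => ?_⟩
    have := abs_le.1 (hq1 (Sum.inl v) j)
    simp only [bb, Sum.elim_inl] at this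
    rw [min_self, max_self]
    have h2 : P v j = q (Sum.inl v) j := rfl
    show _ ≤ P v j ∧ P v j ≤ _
    rw [h2]
    constructor <;> linarith [this.1, this.2]
  have hedge := fun e τ (hτ : τ ∈ Icc (0 : ℝ) m) =>
    edge_cases s hadj L (β e) (pos e) (hβ e) (hpL e) (fun k => q (node e k)) (hQ e) τ (hmR ▸ hτ)
      (fun j => γ e τ j) (hγj e τ)
  have hedge' := fun e τ (hτ : τ ∈ Icc (0 : ℝ) m) =>
    edge_coarse s hadj L (β e) (pos e) (hβ e) (hpL e) (fun k => q (node e k)) (hQ e) τ (hmR ▸ hτ)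
      (fun j => γ e τ j) (hγj e τ)
  have hcoarse : ∀ e τ, τ ∈ Icc (0 : ℝ) m → Coarse s (β e) (pos e) (fun j => γ e τ j) := by
    intro e τ hτ
    rcases hedge' e τ hτ with h | h
    · exact h.coarse
    · exact ⟨pos e, pos e, hβ e, le_rfl, hβ e, le_rfl, adj3_refl _, fun j => by
        rw [min_self, max_self]; exact h j⟩
  have hpart : ∀ k x, x ∈ ArcSys.part a (m : ℝ) P γ κ k → ∃ p, Coarse s (base k) p (fun j => x j) ∧
      (p = base k ∨ ∃ e, κ (a e) = k ∧ p = pos e) := by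
    rintro k x (⟨v, rfl, rfl⟩ | ⟨e, τ, rfl, hτ, rfl⟩)
    · exact ⟨_, (hvert v).coarse, Or.inl rfl⟩
    · exact ⟨pos e, hcoarse e τ hτ, Or.inr ⟨e, rfl, rfl⟩⟩
  have hcl : ∀ x, x ∈ (range P ∪ ⋃ e, γ e '' Icc 0 (m : ℝ)) →
      ∃ k, x ∈ ArcSys.part a (m : ℝ) P γ κ k := by
    rintro x (⟨v, rfl⟩ | hx)
    · exact ⟨κ v, Or.inl ⟨v, rfl, rfl⟩⟩
    · obtain ⟨e, τ, hτ, rfl⟩ := mem_iUnion.1 hx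
      exact ⟨κ (a e), Or.inr ⟨e, τ, rfl, hτ, rfl⟩⟩
  -- the tunnel claim
  let ctr : ι → Fin 3 → ℝ := fun e j => 100 * (s (pos e) j : ℝ) + 20
  have hmid : ∀ e τ, τ ∈ Icc ((L : ℝ) + 1) (L + 2) →
      |γ e τ 0 - ctr e 0| ≤ 1 ∧ |γ e τ 1 - ctr e 1| ≤ 1 ∧
      γ e τ 2 = (1 - (τ - (L + 1))) * q (node e (L + 1)) 2 + (τ - (L + 1)) * q (node e (L + 2)) 2 := by
    intro e τ hτ
    have hval : ∀ j, γ e τ j = (1 - (τ - (L + 1))) * q (node e (L + 1)) j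
        + (τ - (L + 1)) * q (node e (L + 2)) j := by
      intro j
      rw [hγj, pl_eq _ _ (L + 1) τ (by omega) (by push_cast; exact hτ.1)
        (by push_cast; linarith [hτ.2])]
      push_cast
      rfl
    have hn := fun j => comb_near (t := τ - (L + 1)) (by linarith [hτ.1]) (by linarith [hτ.2])
      (hQ e (L + 1) j (by omega)) (hQ e (L + 2) j (by omega))
    have h1 : ∀ j, bn s L (β e) (pos e) (L + 1) j = 100 * (s (pos e) j : ℝ) + (![20, 20, 0] : Fin 3 → ℝ) j := by
      intro j; unfold bn; rw [if_neg (by omega), if_pos rfl]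
    have h2 : ∀ j, bn s L (β e) (pos e) (L + 2) j = 100 * (s (pos e) j : ℝ) + (![20, 20, 40] : Fin 3 → ℝ) j := by
      intro j; unfold bn; rw [if_neg (by omega), if_neg (by omega), if_pos rfl]
    refine ⟨?_, ?_, hval 2⟩
    · have := hn 0
      rw [h1, h2, ← hval] at this
      simp only [Matrix.cons_val_zero] at this
      rw [abs_le]
      constructor <;> simp only [ctr] <;> linarith [this.1, this.2]
    · have := hn 1
      rw [h1, h2, ← hval] at this
      simp only [Matrix.cons_val_one, Matrix.cons_val_zero] at this
      rw [abs_le]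
      constructor <;> simp only [ctr] <;> linarith [this.1, this.2]
  have hzu : ∀ e, ctr e 2 - 21 ≤ q (node e (L + 1)) 2 ∧ q (node e (L + 1)) 2 ≤ ctr e 2 - 19 := by
    intro e
    have h1 : bn s L (β e) (pos e) (L + 1) 2 = 100 * (s (pos e) 2 : ℝ) + 0 := by
      unfold bn; rw [if_neg (by omega), if_pos rfl]; rfl
    have h2 := abs_le.1 (hQ e (L + 1) 2 (by omega))
    rw [h1] at h2
    constructor <;> simp only [ctr] <;> linarith [h2.1, h2.2]
  have hzv : ∀ e, ctr e 2 + 19 ≤ q (node e (L + 2)) 2 ∧ q (node e (L + 2)) 2 ≤ ctr e 2 + 21 := by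
    intro e
    have h1 : bn s L (β e) (pos e) (L + 2) 2 = 100 * (s (pos e) 2 : ℝ) + 40 := by
      unfold bn; rw [if_neg (by omega), if_neg (by omega), if_pos rfl]; rfl
    have h2 := abs_le.1 (hQ e (L + 2) 2 (by omega))
    rw [h1] at h2
    constructor <;> simp only [ctr] <;> linarith [h2.1, h2.2]
  have hctr_inj : ∀ e e', (∀ j, 100 * (s (pos e) j : ℝ) < 100 * s (pos e') j + 100 ∧
      100 * (s (pos e') j : ℝ) < 100 * s (pos e) j + 100) → e = e' := by
    intro e e' h
    apply hposi
    apply hsi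
    ext j
    exact int_near (h j).1 (h j).2
  have htun : ∀ e x, x ∈ (range P ∪ ⋃ e, γ e '' Icc 0 (m : ℝ)) → |x 0 - ctr e 0| ≤ 6 →
      |x 1 - ctr e 1| ≤ 6 → |x 2 - ctr e 2| ≤ 4 →
      ∃ τ ∈ Icc ((L : ℝ) + 1) (L + 2), x = γ e τ := by
    intro e x hx h0 h1 h2
    have hall : ∀ j, |x j - ctr e j| ≤ 6 := by
      intro j
      fin_cases j
      · exact h0
      · exact h1
      · exact h2.trans (by norm_num)
    rcases hx with ⟨v, rfl⟩ | hx
    · exact ((hvert v).not_tunnel (s (pos e)) hall).elim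
    · obtain ⟨e', τ, hτ, rfl⟩ := mem_iUnion.1 hx
      have hee : e = e' := by
        rcases hedge' e' τ hτ with h | h
        · exact (h.not_tunnel (s (pos e)) hall).elim
        · apply hctr_inj
          intro j
          have g1 := h j
          have g2 := abs_le.1 (hall j)
          simp only [ctr] at g2
          constructor <;> linarith [g1.1, g1.2, g2.1, g2.2]
      subst hee
      rw [abs_le] at h0 h2
      rcases hedge e τ hτ with h | ⟨t, t0, t1, h3⟩ | ⟨h, -⟩ | ⟨t, t0, t1, h3⟩
      · exact (h.not_tunnel (s (pos e)) hall).elim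
      · have g := h3 2
        simp [ctr] at g h2
        linarith [g.2, h2.1]
      · exact ⟨τ, h, rfl⟩
      · have g := h3 2
        have g0 := h3 0
        simp [ctr] at g g0 h2 h0
        linarith [g.1, h2.2, g0.2, h0.1]
  refine ⟨m, P, γ, A, ?_, ?_⟩
  · refine A.retract_all κ hκs hκ hconn ?_
      (fun e => L + 1 + (ctr e 2 - 2 - q (node e (L + 1)) 2) / (q (node e (L + 2)) 2 - q (node e (L + 1)) 2))
      (fun e => L + 1 + (ctr e 2 + 2 - q (node e (L + 1)) 2) / (q (node e (L + 2)) 2 - q (node e (L + 1)) 2))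
      ?_ ?_ ?_
      (fun e => {x | |x 0 - ctr e 0| < 3 ∧ |x 1 - ctr e 1| < 3 ∧ |x 2 - ctr e 2| < 2})
      (fun e => {x | |x 0 - ctr e 0| ≤ 3 ∧ |x 1 - ctr e 1| ≤ 3 ∧ |x 2 - ctr e 2| ≤ 2})
      ?_ ?_ ?_ ?_
      (fun e x => L + 1 + (x 2 - q (node e (L + 1)) 2) / (q (node e (L + 2)) 2 - q (node e (L + 1)) 2))
      ?_ ?_ ?_ ?_ ?_
    · intro k k' hne x hx y hy
      obtain ⟨p, hp, hp'⟩ := hpart k x hx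
      obtain ⟨p1, hp1, hp1'⟩ := hpart k' y hy
      rcases hord k k' hne with ⟨o1, o2⟩ | ⟨o1, o2⟩
      · have : p < base k' := by
          rcases hp' with h | ⟨e, h, h'⟩
          · rw [h]; exact o1
          · rw [h']; exact o2 e h
        obtain ⟨j, hj⟩ := coarse_sep hsi this hp hp1
        exact hj.trans_le (coord_dist x y j)
      · have : p1 < base k := by
          rcases hp1' with h | ⟨e, h, h'⟩
          · rw [h]; exact o1
          · rw [h']; exact o2 e h
        obtain ⟨j, hj⟩ := coarse_sep hsi this hp1 hp
        rw [dist_comm]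
        exact hj.trans_le (coord_dist y x j)
    · intro e
      have h1 := hzu e
      have h2 := hzv e
      have : 0 ≤ (ctr e 2 - 2 - q (node e (L + 1)) 2) / (q (node e (L + 2)) 2 - q (node e (L + 1)) 2) :=
        div_nonneg (by linarith [h1.2]) (by linarith [h1.2, h2.1])
      positivity
    · intro e
      have h1 := hzu e
      have h2 := hzv e
      have := div_lt_div_of_pos_right (show ctr e 2 - 2 - q (node e (L + 1)) 2 <
        ctr e 2 + 2 - q (node e (L + 1)) 2 by linarith)
        (show 0 < q (node e (L + 2)) 2 - q (node e (L + 1)) 2 by linarith [h1.2, h2.1])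
      linarith
    · intro e
      have h1 := hzu e
      have h2 := hzv e
      have : (ctr e 2 + 2 - q (node e (L + 1)) 2) / (q (node e (L + 2)) 2 - q (node e (L + 1)) 2) ≤ 1 :=
        (div_le_one (by linarith [h1.2, h2.1])).2 (by linarith [h2.1])
      have hL0 : (0 : ℝ) ≤ L := by positivity
      rw [hmR']
      linarith
    · intro e
      have c : ∀ j, Continuous (fun x : EuclideanSpace ℝ (Fin 3) => |x j - ctr e j|) := fun j => by fun_prop
      exact (isOpen_lt (c 0) continuous_const).inter
        ((isOpen_lt (c 1) continuous_const).inter (isOpen_lt (c 2) continuous_const))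
    · intro e
      have c : ∀ j, Continuous (fun x : EuclideanSpace ℝ (Fin 3) => |x j - ctr e j|) := fun j => by fun_prop
      exact (isClosed_le (c 0) continuous_const).inter
        ((isClosed_le (c 1) continuous_const).inter (isClosed_le (c 2) continuous_const))
    · rintro e x ⟨h0, h1, h2⟩
      exact ⟨h0.le, h1.le, h2.le⟩
    · rintro e e' x ⟨h0, h1, h2⟩ ⟨g0, g1, g2⟩
      apply hctr_inj
      have : ∀ j, |x j - ctr e j| ≤ 3 ∧ |x j - ctr e' j| ≤ 3 := by
        intro j
        fin_cases j
        · exact ⟨h0, g0⟩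
        · exact ⟨h1, g1⟩
        · exact ⟨h2.trans (by norm_num), g2.trans (by norm_num)⟩
      intro j
      have k1 := abs_le.1 (this j).1
      have k2 := abs_le.1 (this j).2
      simp only [ctr] at k1 k2
      constructor <;> linarith [k1.1, k1.2, k2.1, k2.2]
    · intro e
      fun_prop
    · rintro e x y hy hd ⟨h0, h1, h2⟩ hxO
      have d := fun j => abs_le.1 ((coord_dist x y j).trans hd)
      have k0 := abs_le.1 h0
      have k1 := abs_le.1 h1
      have k2 := abs_le.1 h2
      obtain ⟨τ, hτ, rfl⟩ := htun e y hy
        (abs_le.2 (by constructor <;> linarith [(d 0).1, (d 0).2, k0.1, k0.2]))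
        (abs_le.2 (by constructor <;> linarith [(d 1).1, (d 1).2, k1.1, k1.2]))
        (abs_le.2 (by constructor <;> linarith [(d 2).1, (d 2).2, k2.1, k2.2]))
      obtain ⟨m0, m1, -⟩ := hmid e τ hτ
      rw [abs_le] at m0 m1
      have hx2 : ¬ |x 2 - ctr e 2| < 2 := by
        intro h
        apply hxO
        refine ⟨abs_lt.2 ?_, abs_lt.2 ?_, h⟩
        · constructor <;> linarith [(d 0).1, (d 0).2, m0.1, m0.2]
        · constructor <;> linarith [(d 1).1, (d 1).2, m1.1, m1.2]
      have hx2' : |x 2 - ctr e 2| = 2 := le_antisymm h2 (not_lt.1 hx2)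
      rcases (abs_eq (by norm_num)).1 hx2' with h | h
      · right
        have : x 2 = ctr e 2 + 2 := by linarith
        simp only [this]
      · left
        have : x 2 = ctr e 2 - 2 := by linarith
        simp only [this]
    · rintro e x ⟨h0, h1, h2⟩
      have k2 := abs_le.1 h2
      have g1 := hzu e
      have g2 := hzv e
      have hp : 0 ≤ q (node e (L + 2)) 2 - q (node e (L + 1)) 2 := by linarith [g1.2, g2.1]
      constructor
      · have := div_le_div_of_nonneg_right (show ctr e 2 - 2 - q (node e (L + 1)) 2 ≤
          x 2 - q (node e (L + 1)) 2 by linarith [k2.1]) hp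
        linarith
      · have := div_le_div_of_nonneg_right (show x 2 - q (node e (L + 1)) 2 ≤
          ctr e 2 + 2 - q (node e (L + 1)) 2 by linarith [k2.2]) hp
        linarith
    · rintro e x hx ⟨h0, h1, h2⟩
      obtain ⟨τ, hτ, rfl⟩ := htun e x hx (h0.trans (by norm_num)) (h1.trans (by norm_num))
        (h2.trans (by norm_num))
      congr 1
      rw [(hmid e τ hτ).2.2]
      have g1 := hzu e
      have g2 := hzv e
      have hp : q (node e (L + 2)) 2 - q (node e (L + 1)) 2 ≠ 0 := by
        apply ne_of_gt; linarith [g1.2, g2.1]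
      field_simp
      ring
    · rintro e τ ⟨h1, h2⟩
      have g1 := hzu e
      have g2 := hzv e
      have hp : 0 < q (node e (L + 2)) 2 - q (node e (L + 1)) 2 := by linarith [g1.2, g2.1]
      have h1' : (ctr e 2 - 2 - q (node e (L + 1)) 2) / (q (node e (L + 2)) 2 - q (node e (L + 1)) 2)
        < τ - (L + 1) := by linarith
      have h2' : τ - (L + 1) < (ctr e 2 + 2 - q (node e (L + 1)) 2) /
        (q (node e (L + 2)) 2 - q (node e (L + 1)) 2) := by linarith
      rw [div_lt_iff₀ hp] at h1'
      rw [lt_div_iff₀ hp] at h2'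
      have t0 : 0 ≤ τ - (L + 1) := by
        by_contra hc
        push Not at hc
        nlinarith [g1.2]
      have t1 : τ - (L + 1) ≤ 1 := by
        by_contra hc
        push Not at hc
        nlinarith [g2.1]
      obtain ⟨m0, m1, m2⟩ := hmid e τ ⟨by linarith, by linarith⟩
      refine ⟨m0.trans_lt (by norm_num), m1.trans_lt (by norm_num), ?_⟩
      rw [m2, abs_lt]
      constructor <;> linarith
  · intro x hx
    obtain ⟨k, hk⟩ := hcl x hx
    obtain ⟨p, ⟨i, i', h1, h2, h3, h4, -, h6⟩, hp⟩ := hpart k x hk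
    have hpn : p < n ^ 3 := by
      rcases hp with h | ⟨e, -, h⟩
      · have := hbaseb k; omega
      · have := hposb e; omega
    have hn1 : (1 : ℝ) ≤ n := by exact_mod_cast hn
    have := norm_le_coord x (141 * n) (by positivity) (fun j => by
      have b1 := hsb i j (by omega)
      have b2 := hsb i' j (by omega)
      have b1' : (0 : ℝ) ≤ s i j ∧ (s i j : ℝ) ≤ n := by exact_mod_cast b1
      have b2' : (0 : ℝ) ≤ s i' j ∧ (s i' j : ℝ) ≤ n := by exact_mod_cast b2
      have b3 : (0 : ℝ) ≤ min (s i j : ℝ) (s i' j) := le_min b1'.1 b2'.1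
      have b4 : max (s i j : ℝ) (s i' j) ≤ n := max_le b1'.2 b2'.2
      rw [abs_le]
      constructor <;> linarith [(h6 j).1, (h6 j).2])
    linarith

/-- For every `d ≥ 1` there is `C(d) > 0` such that every finite
simple graph with `N ≥ 1` vertices and maximum degree at most `d` admits a topological
embedding of its polyhedron into the closed ball of radius `C(d) * N^(1/3)` in `ℝ³`
whose closed `1`-neighborhood retracts onto the image. -/
theorem statement11 (d : ℕ) (hd : 1 ≤ d) :
    ∃ C : ℝ, 0 < C ∧
      ∀ (V : Type) [Fintype V] (G : SimpleGraph V) [DecidableRel G.Adj],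
        1 ≤ Fintype.card V → (∀ v : V, G.degree v ≤ d) →
        ∀ (E : Type) [NormedAddCommGroup E] [NormedSpace ℝ E]
          (K : Geometry.SimplicialComplex ℝ E) (f : V → E),
          IsGraphRealization G K f →
          ∃ I : K.space → EuclideanSpace ℝ (Fin 3),
            Continuous I ∧ Function.Injective I ∧
            (∀ x, I x ∈ Metric.closedBall (0 : EuclideanSpace ℝ (Fin 3))
              (C * (Fintype.card V : ℝ) ^ ((1 : ℝ) / 3))) ∧
            RetractsOnto (Metric.cthickening 1 (Set.range I)) (Set.range I) := by
  refine ⟨600 * (d + 1), by positivity, ?_⟩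
  intro V _ G _ hN hdeg E _ _ K f hK
  have hex : ∀ e : G.edgeSet, ∃ x y : V, (e : Sym2 V) = s(x, y) := by
    intro e
    obtain ⟨z, hz⟩ := e
    induction z with
    | _ x y => exact ⟨x, y, rfl⟩
  choose a b hab using hex
  have hadj : ∀ e : G.edgeSet, G.Adj (a e) (b e) := by
    intro e
    have := e.2
    rw [hab e] at this
    exact this
  obtain ⟨n, hn, hM, hnb⟩ : ∃ n : ℕ, 0 < n ∧
      Fintype.card G.ConnectedComponent + Fintype.card G.edgeSet ≤ n ^ 3 ∧
      300 * (n : ℝ) ≤ 600 * (d + 1) * (Fintype.card V : ℝ) ^ ((1 : ℝ) / 3) := by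
    set R : ℝ := (Fintype.card V : ℝ) ^ ((1 : ℝ) / 3) with hR
    have hN1 : (1 : ℝ) ≤ Fintype.card V := by exact_mod_cast hN
    have hR1 : 1 ≤ R := Real.one_le_rpow hN1 (by norm_num)
    have hR3 : R ^ 3 = Fintype.card V := by
      rw [hR, ← Real.rpow_natCast, ← Real.rpow_mul (by positivity)]
      norm_num
    have hc1 : Fintype.card G.ConnectedComponent ≤ Fintype.card V :=
      Fintype.card_le_of_surjective G.connectedComponentMk (Quot.exists_rep)
    have hc2 : Fintype.card G.edgeSet ≤ d * Fintype.card V := by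
      have h1 := G.sum_degrees_eq_twice_card_edges
      have h2 : ∑ v, G.degree v ≤ ∑ _v : V, d := Finset.sum_le_sum (fun v _ => hdeg v)
      simp only [Finset.sum_const, Finset.card_univ, smul_eq_mul] at h2
      have h3 : G.edgeFinset.card = Fintype.card G.edgeSet := by
        rw [SimpleGraph.edgeFinset_card]
      rw [mul_comm] at h2
      omega
    refine ⟨(d + 1) * ⌈R⌉₊, ?_, ?_, ?_⟩
    · have : 0 < ⌈R⌉₊ := Nat.ceil_pos.2 (by linarith)
      positivity
    · have h1 : Fintype.card V ≤ ⌈R⌉₊ ^ 3 := by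
        have : (Fintype.card V : ℝ) ≤ (⌈R⌉₊ : ℝ) ^ 3 := by
          rw [← hR3]
          exact pow_le_pow_left₀ (by linarith) (Nat.le_ceil R) 3
        exact_mod_cast this
      have h2 : d + 1 ≤ (d + 1) ^ 3 := Nat.le_self_pow (by norm_num) _
      calc _ ≤ (d + 1) * Fintype.card V := by linarith
        _ ≤ (d + 1) ^ 3 * ⌈R⌉₊ ^ 3 := Nat.mul_le_mul h2 h1
        _ = _ := by ring
    · have h1 : (⌈R⌉₊ : ℝ) < R + 1 := Nat.ceil_lt_add_one (by linarith)
      push_cast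
      have h2 : (0 : ℝ) < d + 1 := by positivity
      nlinarith
  obtain ⟨m, P, γ, A', hret, hbd⟩ := layout a b (fun e => (hadj e).ne) G.connectedComponentMk
    Quot.exists_rep
    (fun e => SimpleGraph.ConnectedComponent.sound (hadj e).reachable)
    (by
      intro k S hS hcl v hv
      obtain ⟨w, hw, hwk⟩ := hS
      have hr : G.Reachable w v := SimpleGraph.ConnectedComponent.exact (hwk.trans hv.symm)
      obtain ⟨p⟩ := hr
      clear hwk hv
      induction p with
      | nil => exact hw
      | cons h p ih =>
        apply ih
        have hc := hcl ⟨s(_, _), h⟩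
        have hs := hab ⟨s(_, _), h⟩
        simp only [Sym2.eq_iff] at hs
        rcases hs with ⟨h1, h2⟩ | ⟨h1, h2⟩
        · rw [← h1, ← h2] at hc
          exact hc.1 hw
        · rw [← h1, ← h2] at hc
          exact hc.2 hw)
    n hn hM
  obtain ⟨A, hAK⟩ := real_arcs G K f hK m A'.hm a b hab
  obtain ⟨I, hIc, hIi, hIr⟩ := A.lift A' K.space hAK
  refine ⟨I, hIc, hIi, ?_, ?_⟩
  · intro x
    rw [mem_closedBall_zero_iff]
    exact (hbd (I x) (hIr ▸ mem_range_self x)).trans hnb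
  · rw [hIr]
    exact hret
end

section
/- Let n ≥ 1. There is a constant C(n) > 0 with the following property: let X ⊆ ℝⁿ be a compact set homeomorphic to the polyhedron of a finite simplicial complex, let T > 0, suppose the closed T-neighborhood of X admits a retraction onto X, and let V be the Lebesgue measure of the closed T-neighborhood of X. Then the sum over all i ≥ 0 of the dimensions of the singular homology groups H_i(X; ℚ) as ℚ-vector spaces is at most C(n)·V·T^{−n}. -/
open scoped Classical
open Metric Set Function MeasureTheory CategoryTheory

/-- The `i`-th singular homology of a topological space `X` with rational coefficients:
the `i`-th homology of the alternating face map complex of the free `ℚ`-module on the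
singular simplicial set of `X`. -/
noncomputable def singularHomology (X : Type) [TopologicalSpace X] (i : ℕ) :
    ModuleCat ℚ :=
  ((AlgebraicTopology.alternatingFaceMapComplex (ModuleCat ℚ)).obj
    (((CategoryTheory.SimplicialObject.whiskering _ _).obj (ModuleCat.free ℚ)).obj
      (TopCat.toSSet.obj (TopCat.of X)))).homology i

namespace Betti

/-- presimplicial sets -/
structure PS where
  S : ℕ → Type
  δ : ∀ k, Fin (k + 2) → S (k + 1) → S k
  rel : ∀ k (i j : Fin (k + 2)) (x : S (k + 2)), i ≤ j →
    δ k i (δ (k + 1) j.succ x) = δ k j (δ (k + 1) i.castSucc x)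

abbrev Ch (P : PS) (k : ℕ) := P.S k →₀ ℚ

noncomputable def bd (P : PS) (k : ℕ) : Ch P (k + 1) →ₗ[ℚ] Ch P k :=
  ∑ i : Fin (k + 2), ((-1 : ℚ) ^ (i : ℕ)) • Finsupp.lmapDomain ℚ ℚ (P.δ k i)

lemma bd_single (P : PS) (k : ℕ) (x : P.S (k + 1)) (a : ℚ) :
    bd P k (Finsupp.single x a) =
      ∑ i : Fin (k + 2), ((-1 : ℚ) ^ (i : ℕ)) • Finsupp.single (P.δ k i x) a := by
  simp [bd, LinearMap.sum_apply, Finsupp.mapDomain_single]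

lemma bd_bd (P : PS) (k : ℕ) (c : Ch P (k + 2)) : bd P k (bd P (k + 1) c) = 0 := by
  induction c using Finsupp.induction_linear with
  | zero => simp
  | add f g hf hg => simp [hf, hg]
  | single x a =>
    rw [bd_single, map_sum]
    simp_rw [map_smul, bd_single, Finset.smul_sum, smul_smul]
    rw [← Finset.sum_product']
    rw [Finset.univ_product_univ]
    let Q : Finset (Fin (k + 3) × Fin (k + 2)) := Finset.univ.filter fun p => p.1 ≤ p.2.castSucc
    rw [← Finset.sum_add_sum_compl Q, ← eq_neg_iff_add_eq_zero, ← Finset.sum_neg_distrib]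
    refine Finset.sum_bij'
      (fun p hp => (p.2.succ, p.1.castLT (lt_of_le_of_lt (Finset.mem_filter.mp hp).2 p.2.2)))
      (fun p hp => (p.2.castSucc, p.1.pred (by
        rintro h
        simp only [Q, Finset.compl_filter, Finset.mem_filter_univ, h] at hp
        exact hp (Fin.zero_le _)))) ?_ ?_ ?_ ?_ ?_
    · rintro ⟨i, j⟩ hp
      simp only [Q, Finset.compl_filter, Finset.mem_filter_univ, Fin.le_def] at hp ⊢
      simp at hp ⊢
      omega
    · rintro ⟨i, j⟩ hp
      simp only [Q, Finset.compl_filter, Finset.mem_filter_univ, Fin.le_def] at hp ⊢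
      simp at hp ⊢
      omega
    · rintro ⟨i, j⟩ hp
      simp
    · rintro ⟨i, j⟩ hp
      simp
    · rintro ⟨i, j⟩ hp
      simp only [Q, Finset.mem_filter_univ, Fin.le_def] at hp
      have := P.rel k (i.castLT (lt_of_le_of_lt hp j.2)) j x hp
      simp only [Fin.castSucc_castLT] at this
      simp only
      rw [this, ← neg_smul]
      congr 1
      simp only [Fin.val_succ, Fin.val_castLT, pow_succ]
      ring

/-- cone lemma -/
lemma bd_cone (P : PS) (k : ℕ) (K : ∀ k, P.S k → P.S (k + 1))
    (h0 : ∀ k x, P.δ k 0 (K k x) = x)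
    (h1 : ∀ k i x, P.δ (k + 1) (Fin.succ i) (K (k + 1) x) = K k (P.δ k i x)) (c : Ch P (k + 1)) :
    bd P (k + 1) (Finsupp.lmapDomain ℚ ℚ (K (k + 1)) c) =
      c - Finsupp.lmapDomain ℚ ℚ (K k) (bd P k c) := by
  induction c using Finsupp.induction_linear with
  | zero => simp
  | add f g hf hg => rw [map_add, map_add, map_add, map_add, hf, hg]; abel
  | single x a =>
    rw [Finsupp.lmapDomain_apply, Finsupp.mapDomain_single, bd_single, Fin.sum_univ_succ,
      bd_single, map_sum]
    simp only [h0, h1, map_smul, Finsupp.lmapDomain_apply, Finsupp.mapDomain_single]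
    simp [pow_succ, sub_eq_add_neg]

/-- tuples -/
abbrev tup (A : Type) : PS where
  S k := Fin (k + 1) → A
  δ k i v := v ∘ i.succAbove
  rel k i j x h := by
    funext l
    simp only [Function.comp]
    congr 1
    ext
    simp only [Fin.succAbove, Fin.lt_def, Fin.le_def] at *
    split_ifs <;> simp at * <;> omega

abbrev Δ (k : ℕ) := stdSimplex ℝ (Fin (k + 1))

noncomputable def face (k : ℕ) (i : Fin (k + 2)) : C(Δ k, Δ (k + 1)) :=
  ⟨stdSimplex.map i.succAbove, stdSimplex.continuous_map _⟩

/-- singular simplices -/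
noncomputable abbrev sing (X : Type) [TopologicalSpace X] : PS where
  S k := C(Δ k, X)
  δ k i s := s.comp (face k i)
  rel k i j x h := by
    ext l
    simp only [face, ContinuousMap.comp_apply, ContinuousMap.coe_mk, stdSimplex.map_comp_apply]
    congr 2
    ext l
    simp only [Function.comp, Fin.succAbove, Fin.lt_def, Fin.le_def] at *
    split_ifs <;> simp at * <;> omega

end Betti

namespace Betti

noncomputable def affFun {k N : ℕ} (v : Fin (k + 1) → Δ N) (t : Δ k) : Δ N :=
  ⟨fun x => ∑ j, t j * v j x,
    fun x => Finset.sum_nonneg fun j _ => mul_nonneg (t.2.1 j) ((v j).2.1 x), by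
      rw [Finset.sum_comm]
      simp_rw [← Finset.mul_sum]
      have : ∀ j, ∑ i, v j i = 1 := fun j => (v j).2.2
      simp [this]⟩

lemma affFun_apply {k N : ℕ} (v : Fin (k + 1) → Δ N) (t : Δ k) (x : Fin (N + 1)) :
    affFun v t x = ∑ j, t j * v j x := rfl

noncomputable def aff {k N : ℕ} (v : Fin (k + 1) → Δ N) : C(Δ k, Δ N) :=
  ⟨affFun v, by
    refine Continuous.subtype_mk (continuous_pi fun x => ?_) _
    refine continuous_finsetSum _ fun j _ => Continuous.mul ?_ continuous_const
    exact (continuous_apply j).comp continuous_subtype_val⟩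

lemma aff_apply {k N : ℕ} (v : Fin (k + 1) → Δ N) (t : Δ k) (x : Fin (N + 1)) :
    aff v t x = ∑ j, t j * v j x := rfl

lemma Δext {N : ℕ} {a b : Δ N} (h : ∀ x, a x = b x) : a = b :=
  stdSimplex.ext (funext h)

lemma aff_aff {k N M : ℕ} (q : Fin (N + 1) → Δ M) (v : Fin (k + 1) → Δ N) :
    aff (aff q ∘ v) = (aff q).comp (aff v) := by
  ext1 t
  apply Δext
  intro x
  simp only [aff_apply, ContinuousMap.comp_apply, Function.comp, Finset.mul_sum, Finset.sum_mul]
  rw [Finset.sum_comm]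
  simp only [mul_assoc]

noncomputable def vtx (k : ℕ) : Fin (k + 1) → Δ k := fun i => stdSimplex.vertex i

lemma vtx_apply (k : ℕ) (i j : Fin (k + 1)) : vtx k i j = if j = i then 1 else 0 := by
  simp only [vtx]
  change (stdSimplex.vertex (S := ℝ) i : Fin (k + 1) → ℝ) j = _
  rw [stdSimplex.vertex_coe, Pi.single_apply]

lemma aff_vtx (k : ℕ) : aff (vtx k) = ContinuousMap.id _ := by
  ext1 t
  apply Δext
  intro x
  simp [aff_apply, vtx_apply]

lemma aff_comp_vtx {k N : ℕ} (v : Fin (k + 1) → Δ N) : aff v ∘ vtx k = v := by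
  funext i
  apply Δext
  intro x
  simp [aff_apply, vtx_apply]

lemma face_eq (k : ℕ) (i : Fin (k + 2)) : face k i = aff (vtx (k + 1) ∘ i.succAbove) := by
  ext1 t
  apply Δext
  intro x
  simp only [aff_apply, vtx_apply, Function.comp, mul_ite, mul_one, mul_zero]
  change (stdSimplex.map i.succAbove t : _ → ℝ) x = _
  rw [stdSimplex.map_coe, FunOnFinite.linearMap_apply_apply, Finset.sum_filter]
  exact Finset.sum_congr rfl fun j _ => if_congr eq_comm rfl rfl

lemma aff_face {k N : ℕ} (v : Fin (k + 2) → Δ N) (i : Fin (k + 2)) :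
    (aff v).comp (face k i) = aff (v ∘ i.succAbove) := by
  rw [face_eq, ← aff_aff, ← Function.comp_assoc, aff_comp_vtx]

noncomputable def bary {k N : ℕ} (v : Fin (k + 1) → Δ N) : Δ N := aff v stdSimplex.barycenter

lemma aff_bary {k N M : ℕ} (q : Fin (N + 1) → Δ M) (v : Fin (k + 1) → Δ N) :
    aff q (bary v) = bary (aff q ∘ v) := by
  simp [bary, aff_aff]

lemma dist_bary_le {k N : ℕ} (v : Fin (k + 1) → Δ N) (x : Δ N) (r : ℝ)
    (h : ∀ j, dist x (v j) ≤ r) (t : Δ k) : dist x (aff v t) ≤ r := by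
  have hr : 0 ≤ r := dist_nonneg.trans (h 0)
  rw [Subtype.dist_eq, dist_pi_le_iff hr]
  intro y
  have e : x.1 y = ∑ j, t j * x.1 y := by
    rw [← Finset.sum_mul]
    have : ∑ j, t j = 1 := t.2.2
    rw [this, one_mul]
  have e2 : (aff v t).1 y = ∑ j, t j * (v j).1 y := rfl
  have e3 : r = ∑ j, t j * r := by
    rw [← Finset.sum_mul]
    have : ∑ j, t j = 1 := t.2.2
    rw [this, one_mul]
  rw [Real.dist_eq, e2, e, ← Finset.sum_sub_distrib, e3]
  refine (Finset.abs_sum_le_sum_abs _ _).trans (Finset.sum_le_sum fun j _ => ?_)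
  rw [← mul_sub, abs_mul, abs_of_nonneg (show 0 ≤ t j from t.2.1 j)]
  refine mul_le_mul_of_nonneg_left ?_ (t.2.1 j)
  refine le_trans ?_ (h j)
  rw [Subtype.dist_eq, ← Real.dist_eq]
  exact dist_le_pi_dist x.1 (v j).1 y

lemma dist_bary_vert {k N : ℕ} (v : Fin (k + 1) → Δ N) (d : ℝ)
    (h : ∀ i j, dist (v i) (v j) ≤ d) (i : Fin (k + 1)) :
    dist (bary v) (v i) ≤ k / (k + 1) * d := by
  have hd : 0 ≤ d := dist_nonneg.trans (h 0 0)
  rw [Subtype.dist_eq, dist_pi_le_iff (by positivity)]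
  intro y
  have hk : (k + 1 : ℝ) ≠ 0 := by positivity
  have e1 : (bary v).1 y = ∑ j, (1 / (k + 1 : ℝ)) * (v j).1 y := by
    change aff v stdSimplex.barycenter y = _
    rw [aff_apply]
    refine Finset.sum_congr rfl fun j _ => ?_
    change (stdSimplex.barycenter : Δ k).1 j * (v j).1 y = _
    rw [stdSimplex.barycenter_apply]
    simp
  have e2 : (v i).1 y = ∑ j : Fin (k + 1), (1 / (k + 1 : ℝ)) * (v i).1 y := by
    simp
    field_simp
  rw [Real.dist_eq, e1]
  rw [show (∑ j, (1 / (k + 1 : ℝ)) * (v j).1 y) - (v i).1 y = (∑ j, (1 / (k + 1 : ℝ)) * (v j).1 y) -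
    ∑ j : Fin (k + 1), (1 / (k + 1 : ℝ)) * (v i).1 y from congrArg _ e2]
  rw [← Finset.sum_sub_distrib]
  refine (Finset.abs_sum_le_sum_abs _ _).trans ?_
  have : ∀ j ∈ Finset.univ, |1 / (k + 1 : ℝ) * (v j).1 y - 1 / (k + 1 : ℝ) * (v i).1 y| ≤
      if j = i then 0 else 1 / (k + 1 : ℝ) * d := by
    intro j _
    split_ifs with hj
    · simp [hj]
    · rw [← mul_sub, abs_mul, abs_of_nonneg (by positivity)]
      refine mul_le_mul_of_nonneg_left ?_ (by positivity)
      rw [← Real.dist_eq]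
      exact (dist_le_pi_dist (v j).1 (v i).1 y).trans (h j i)
  refine (Finset.sum_le_sum this).trans ?_
  rw [Finset.sum_ite]
  simp [Finset.filter_ne']
  apply le_of_eq
  field_simp

end Betti

namespace Betti

def consT {A : Type} (b : A) (k : ℕ) (v : (tup A).S k) : (tup A).S (k + 1) :=
  (Fin.cons b v : Fin (k + 2) → A)

noncomputable def cone {A : Type} (b : A) (k : ℕ) : Ch (tup A) k →ₗ[ℚ] Ch (tup A) (k + 1) :=
  Finsupp.lmapDomain ℚ ℚ (consT b k)

lemma cone_single {A : Type} (b : A) (k : ℕ) (v : (tup A).S k) (a : ℚ) :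
    cone b k (Finsupp.single v a) = Finsupp.single (consT b k v) a := by
  simp [cone, Finsupp.mapDomain_single]

lemma bd_coneT {A : Type} (b : A) (k : ℕ) (c : Ch (tup A) (k + 1)) :
    bd (tup A) (k + 1) (cone b (k + 1) c) = c - cone b k (bd (tup A) k c) := by
  refine bd_cone (tup A) k (consT b) ?_ ?_ c
  · intro k x
    funext j
    simp [consT]
  · intro k i x
    funext j
    refine Fin.cases ?_ (fun j => ?_) j <;> simp [consT]

noncomputable def TT (N : ℕ) : ∀ k : ℕ, Ch (tup (Δ N)) k →ₗ[ℚ] Ch (tup (Δ N)) (k + 1)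
  | 0 => 0
  | k + 1 => Finsupp.lsum ℚ fun v => LinearMap.toSpanSingleton ℚ _
      (cone (bary (k := k + 1) v) (k + 1)
        (Finsupp.single v 1 - TT N k (bd (tup (Δ N)) k (Finsupp.single v 1))))

lemma TT_succ (N k : ℕ) (v : (tup (Δ N)).S (k + 1)) :
    TT N (k + 1) (Finsupp.single v 1) = cone (bary (k := k + 1) v) (k + 1)
        (Finsupp.single v 1 - TT N k (bd (tup (Δ N)) k (Finsupp.single v 1))) := by
  simp [TT]

noncomputable def SS (N : ℕ) : ∀ k : ℕ, Ch (tup (Δ N)) k →ₗ[ℚ] Ch (tup (Δ N)) k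
  | 0 => LinearMap.id
  | k + 1 => LinearMap.id - (bd (tup (Δ N)) (k + 1)) ∘ₗ TT N (k + 1) - TT N k ∘ₗ bd (tup (Δ N)) k

lemma SS_apply (N k : ℕ) (c : Ch (tup (Δ N)) (k + 1)) :
    SS N (k + 1) c = c - bd (tup (Δ N)) (k + 1) (TT N (k + 1) c) - TT N k (bd (tup (Δ N)) k c) :=
  rfl

lemma SS_succ (N k : ℕ) (v : (tup (Δ N)).S (k + 1)) :
    SS N (k + 1) (Finsupp.single v 1) = cone (bary (k := k + 1) v) k
        (SS N k (bd (tup (Δ N)) k (Finsupp.single v 1))) := by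
  rw [SS_apply, TT_succ, bd_coneT]
  cases k with
  | zero =>
    simp [SS, TT]
  | succ k =>
    rw [SS_apply, bd_bd]
    simp only [map_sub, map_zero]
    abel

/-- induced map on tuples -/
noncomputable def mapT {A B : Type} (f : A → B) (k : ℕ) : Ch (tup A) k →ₗ[ℚ] Ch (tup B) k :=
  Finsupp.lmapDomain ℚ ℚ (fun v : Fin (k + 1) → A => (f ∘ v : Fin (k + 1) → B))

lemma mapT_single {A B : Type} (f : A → B) (k : ℕ) (v : (tup A).S k) (a : ℚ) :
    mapT f k (Finsupp.single v a) =
      Finsupp.single ((f ∘ (v : Fin (k + 1) → A) : Fin (k + 1) → B) : (tup B).S k) a := by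
  simp only [mapT]
  exact Finsupp.mapDomain_single

lemma mapT_bd {A B : Type} (f : A → B) (k : ℕ) (c : Ch (tup A) (k + 1)) :
    mapT f k (bd (tup A) k c) = bd (tup B) k (mapT f (k + 1) c) := by
  induction c using Finsupp.induction_linear with
  | zero => simp
  | add f g hf hg => simp only [map_add, hf, hg]
  | single x a =>
    rw [mapT_single, bd_single, bd_single, map_sum]
    refine Finset.sum_congr rfl fun i _ => ?_
    rw [map_smul, mapT_single]
    rfl

lemma mapT_cone {A B : Type} (f : A → B) (b : A) (k : ℕ) (c : Ch (tup A) k) :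
    mapT f (k + 1) (cone b k c) = cone (f b) k (mapT f k c) := by
  induction c using Finsupp.induction_linear with
  | zero => simp
  | add f g hf hg => simp only [map_add, hf, hg]
  | single x a =>
    rw [mapT_single, cone_single, cone_single, mapT_single]
    congr 1
    funext j
    refine Fin.cases ?_ (fun j => ?_) j <;> simp [consT]

lemma mapT_TT {N M : ℕ} (q : Fin (N + 1) → Δ M) : ∀ (k : ℕ) (c : Ch (tup (Δ N)) k),
    mapT (aff q) (k + 1) (TT N k c) = TT M k (mapT (aff q) k c) := by
  intro k
  induction k with
  | zero => intro c; simp [TT]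
  | succ k ih =>
    intro c
    induction c using Finsupp.induction_linear with
    | zero => simp
    | add f g hf hg => simp only [map_add, hf, hg]
    | single x a =>
      have hx : (Finsupp.single x a : Ch (tup (Δ N)) (k + 1)) = a • Finsupp.single x 1 := by simp
      rw [hx]
      simp only [map_smul]
      rw [mapT_single, TT_succ, TT_succ, mapT_cone, aff_bary, map_sub, ih, mapT_bd, mapT_single]

/-- small tuples -/
def small (N k : ℕ) (v : (tup (Δ N)).S k) (ρ : ℝ) : Set ((tup (Δ N)).S k) :=
  {w | (∀ i j, dist ((w : Fin (k + 1) → Δ N) i) ((w : Fin (k + 1) → Δ N) j) ≤ ρ) ∧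
    ∀ (x : Δ N) r, (∀ j, dist x ((v : Fin (k + 1) → Δ N) j) ≤ r) →
      ∀ i, dist x ((w : Fin (k + 1) → Δ N) i) ≤ r}

lemma SS_small (N : ℕ) : ∀ (k : ℕ) (v : (tup (Δ N)).S k) (d : ℝ),
    (∀ i j, dist ((v : Fin (k + 1) → Δ N) i) ((v : Fin (k + 1) → Δ N) j) ≤ d) →
    SS N k (Finsupp.single v 1) ∈ Finsupp.supported ℚ ℚ (small N k v (k / (k + 1) * d)) := by
  intro k
  induction k with
  | zero =>
    intro v d h
    refine Finsupp.single_mem_supported ℚ _ ⟨fun i j => ?_, fun x r h => h⟩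
    rw [show i = j from (by omega)]
    simp
  | succ k ih =>
    intro v d h
    have hd : 0 ≤ d := dist_nonneg.trans (h 0 0)
    rw [SS_succ, bd_single, map_sum, map_sum]
    refine Submodule.sum_mem _ fun i _ => ?_
    rw [map_smul, map_smul]
    refine Submodule.smul_mem _ _ ?_
    have := ih ((tup (Δ N)).δ k i v) d (fun a b => h _ _)
    rw [cone]
    have h2 : Finsupp.lmapDomain ℚ ℚ (consT (bary (k := k + 1) v) k)
        (SS N k (Finsupp.single ((tup (Δ N)).δ k i v) 1)) ∈ Finsupp.supported ℚ ℚ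
          (consT (bary (k := k + 1) v) k '' small N k ((tup (Δ N)).δ k i v) (k / (k + 1) * d)) := by
      rw [← Finsupp.lmapDomain_supported]
      exact Submodule.mem_map_of_mem this
    refine Finsupp.supported_mono ?_ h2
    rintro _ ⟨w, ⟨hw1, hw2⟩, rfl⟩
    have hle : (k / (k + 1) * d : ℝ) ≤ ((k + 1 : ℕ) : ℝ) / ((k + 1 : ℕ) + 1) * d := by
      refine mul_le_mul_of_nonneg_right ?_ hd
      rw [div_le_div_iff₀ (by positivity) (by positivity)]
      push_cast
      nlinarith
    have hb : ∀ j, dist (bary (k := k + 1) v) ((w : Fin (k + 1) → Δ N) j) ≤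
        ((k + 1 : ℕ) : ℝ) / ((k + 1 : ℕ) + 1) * d := by
      refine hw2 _ _ fun j => ?_
      exact dist_bary_vert (k := k + 1) v d h _
    refine ⟨fun a b => ?_, fun x r hx a => ?_⟩
    · refine Fin.cases ?_ (fun a => ?_) a <;> refine Fin.cases ?_ (fun b => ?_) b
      · simp only [consT, dist_self]
        positivity
      · simpa [consT] using hb b
      · simpa [consT, dist_comm] using hb a
      · simpa [consT] using (hw1 a b).trans hle
    · refine Fin.cases ?_ (fun a => ?_) a
      · simpa [consT, bary] using dist_bary_le (k := k + 1) v x r hx _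
      · simpa [consT] using hw2 x r (fun j => hx _) a

lemma SS_iter_small (N k : ℕ) (v : (tup (Δ N)).S k) (d : ℝ)
    (h : ∀ i j, dist ((v : Fin (k + 1) → Δ N) i) ((v : Fin (k + 1) → Δ N) j) ≤ d) (m : ℕ) :
    ((SS N k) ^ m) (Finsupp.single v 1) ∈ Finsupp.supported ℚ ℚ
      {w : (tup (Δ N)).S k | ∀ i j, dist ((w : Fin (k + 1) → Δ N) i)
        ((w : Fin (k + 1) → Δ N) j) ≤ (k / (k + 1) : ℝ) ^ m * d} := by
  induction m with
  | zero =>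
    refine Finsupp.single_mem_supported ℚ _ ?_
    simpa using h
  | succ m ih =>
    rw [pow_succ' (SS N k), Module.End.mul_apply]
    set c := ((SS N k) ^ m) (Finsupp.single v 1)
    rw [← Finsupp.sum_single c, Finsupp.sum, map_sum]
    refine Submodule.sum_mem _ fun w hw => ?_
    have hw' := ih hw
    rw [show (Finsupp.single w (c w) : Ch (tup (Δ N)) k) = c w • Finsupp.single w 1 by simp,
      map_smul]
    refine Submodule.smul_mem _ _ ?_
    refine Finsupp.supported_mono ?_ (SS_small N k w _ hw')
    intro u hu
    simpa [pow_succ', mul_assoc] using hu.1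

end Betti

namespace Betti

variable {X : Type} [TopologicalSpace X]

noncomputable def real {N : ℕ} (s : C(Δ N, X)) (k : ℕ) :
    Ch (tup (Δ N)) k →ₗ[ℚ] Ch (sing X) k :=
  Finsupp.lmapDomain ℚ ℚ (fun v : (tup (Δ N)).S k => (s.comp (aff (k := k) v) : (sing X).S k))

lemma real_single {N : ℕ} (s : C(Δ N, X)) (k : ℕ) (v : (tup (Δ N)).S k) (a : ℚ) :
    real s k (Finsupp.single v a) = Finsupp.single (s.comp (aff (k := k) v) : (sing X).S k) a := by
  simp only [real]
  exact Finsupp.mapDomain_single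

lemma real_bd {N : ℕ} (s : C(Δ N, X)) (k : ℕ) (c : Ch (tup (Δ N)) (k + 1)) :
    real s k (bd _ k c) = bd _ k (real s (k + 1) c) := by
  induction c using Finsupp.induction_linear with
  | zero => simp
  | add f g hf hg => simp only [map_add, hf, hg]
  | single x a =>
    rw [real_single, bd_single, bd_single, map_sum]
    refine Finset.sum_congr rfl fun i _ => ?_
    rw [map_smul, real_single]
    change _ • Finsupp.single (s.comp (aff (x ∘ i.succAbove))) a =
      _ • Finsupp.single ((s.comp (aff x)).comp (face k i)) a
    rw [ContinuousMap.comp_assoc, aff_face]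

lemma real_comp {N M : ℕ} (s : C(Δ M, X)) (q : Fin (N + 1) → Δ M) (k : ℕ)
    (c : Ch (tup (Δ N)) k) :
    real (s.comp (aff q)) k c = real s k (mapT (aff q) k c) := by
  induction c using Finsupp.induction_linear with
  | zero => simp
  | add f g hf hg => simp only [map_add, hf, hg]
  | single x a =>
    rw [real_single, mapT_single, real_single, aff_aff]
    rfl

variable (X) in
noncomputable def Ts (k : ℕ) : Ch (sing X) k →ₗ[ℚ] Ch (sing X) (k + 1) :=
  Finsupp.lsum ℚ fun s => LinearMap.toSpanSingleton ℚ _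
    (real (N := k) s (k + 1) (TT k k (Finsupp.single (vtx k : (tup (Δ k)).S k) 1)))

lemma Ts_single (k : ℕ) (s : (sing X).S k) : Ts X k (Finsupp.single s 1) =
    real (N := k) s (k + 1) (TT k k (Finsupp.single (vtx k : (tup (Δ k)).S k) 1)) := by
  simp [Ts]

lemma Ts_real {N : ℕ} (s : C(Δ N, X)) (k : ℕ) (c : Ch (tup (Δ N)) k) :
    Ts X k (real s k c) = real s (k + 1) (TT N k c) := by
  induction c using Finsupp.induction_linear with
  | zero => simp
  | add f g hf hg => simp only [map_add, hf, hg]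
  | single x a =>
    rw [show (Finsupp.single x a : Ch (tup (Δ N)) k) = a • Finsupp.single x 1 by simp]
    simp only [map_smul]
    rw [real_single, Ts_single, real_comp, mapT_TT, mapT_single, aff_comp_vtx]

variable (X) in
noncomputable def Ss (k : ℕ) : Ch (sing X) (k + 1) →ₗ[ℚ] Ch (sing X) (k + 1) :=
  LinearMap.id - (bd (sing X) (k + 1)) ∘ₗ Ts X (k + 1) - Ts X k ∘ₗ bd (sing X) k

lemma Ss_apply (k : ℕ) (c : Ch (sing X) (k + 1)) :
    Ss X k c = c - bd (sing X) (k + 1) (Ts X (k + 1) c) - Ts X k (bd (sing X) k c) := rfl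

lemma Ss_real {N : ℕ} (s : C(Δ N, X)) (k : ℕ) (c : Ch (tup (Δ N)) (k + 1)) :
    Ss X k (real s (k + 1) c) = real s (k + 1) (SS N (k + 1) c) := by
  rw [Ss_apply, SS_apply, Ts_real, ← real_bd, ← real_bd, Ts_real, map_sub, map_sub]

lemma Ss_iter_real {N : ℕ} (s : C(Δ N, X)) (k m : ℕ) (c : Ch (tup (Δ N)) (k + 1)) :
    (Ss X k ^ m) (real s (k + 1) c) = real s (k + 1) ((SS N (k + 1) ^ m) c) := by
  induction m with
  | zero => rfl
  | succ m ih =>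
    rw [pow_succ' (Ss X k), pow_succ' (SS N (k + 1)), Module.End.mul_apply, Module.End.mul_apply,
      ih, Ss_real]

lemma single_eq_real (k : ℕ) (s : (sing X).S k) : (Finsupp.single s 1 : Ch (sing X) k) =
    real (N := k) s k (Finsupp.single (vtx k : (tup (Δ k)).S k) 1) := by
  rw [real_single, aff_vtx]
  rfl

/-- chains in `U` -/
noncomputable def CU (U : Set X) (k : ℕ) : Submodule ℚ (Ch (sing X) k) :=
  Finsupp.supported ℚ ℚ {s : (sing X).S k | ∀ t : Δ k, (s : C(Δ k, X)) t ∈ U}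

lemma CU_mono {U V : Set X} (h : U ⊆ V) (k : ℕ) : CU U k ≤ CU V k :=
  Finsupp.supported_mono fun _ hs t => h (hs t)

lemma CU_le {M : Type} [AddCommGroup M] [Module ℚ M] {U : Set X} {k : ℕ} (f : Ch (sing X) k →ₗ[ℚ] M)
    (W : Submodule ℚ M)
    (h : ∀ s : C(Δ k, X), (∀ t, s t ∈ U) → f (Finsupp.single (s : (sing X).S k) 1) ∈ W) :
    ∀ c ∈ CU U k, f c ∈ W := by
  intro c hc
  rw [CU, Finsupp.supported_eq_span_single] at hc
  have : Submodule.span ℚ ((fun i => Finsupp.single i (1 : ℚ)) ''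
    {s : (sing X).S k | ∀ t : Δ k, (s : C(Δ k, X)) t ∈ U}) ≤ W.comap f := by
    rw [Submodule.span_le]
    rintro _ ⟨s, hs, rfl⟩
    exact h s hs
  exact this hc

lemma CU_single {U : Set X} {k : ℕ} (s : C(Δ k, X)) (h : ∀ t, s t ∈ U) (a : ℚ) :
    Finsupp.single (s : (sing X).S k) a ∈ CU U k :=
  Finsupp.single_mem_supported ℚ _ h

lemma bd_CU {U : Set X} {k : ℕ} : ∀ c ∈ CU U (k + 1), bd (sing X) k c ∈ CU U k := by
  refine CU_le _ _ fun s hs => ?_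
  rw [bd_single]
  exact Submodule.sum_mem _ fun i _ => Submodule.smul_mem _ _
    (CU_single (s.comp (face k i)) (fun t => hs _) _)

lemma real_CU {U : Set X} {N : ℕ} (s : C(Δ N, X)) (hs : ∀ t, s t ∈ U) (k : ℕ)
    (c : Ch (tup (Δ N)) k) : real s k c ∈ CU U k := by
  induction c using Finsupp.induction_linear with
  | zero => simp
  | add f g hf hg => rw [map_add]; exact add_mem hf hg
  | single x a =>
    rw [real_single]
    exact CU_single (s.comp (aff (k := k) x)) (fun t => hs _) _

lemma Ts_CU {U : Set X} {k : ℕ} : ∀ c ∈ CU U k, Ts X k c ∈ CU U (k + 1) := by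
  refine CU_le _ _ fun s hs => ?_
  rw [Ts_single]
  exact real_CU _ hs _ _

lemma Ss_CU {U : Set X} {k : ℕ} (c) (hc : c ∈ CU U (k + 1)) : Ss X k c ∈ CU U (k + 1) := by
  rw [Ss_apply]
  exact sub_mem (sub_mem hc (bd_CU _ (Ts_CU _ hc))) (Ts_CU _ (bd_CU _ hc))

lemma Ss_iter_cycle {U : Set X} {k : ℕ} (c) (hc : c ∈ CU U (k + 1)) (h0 : bd (sing X) k c = 0)
    (m : ℕ) : (Ss X k ^ m) c ∈ CU U (k + 1) ∧ bd (sing X) k ((Ss X k ^ m) c) = 0 ∧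
      ∃ e ∈ CU U (k + 2), c - (Ss X k ^ m) c = bd (sing X) (k + 1) e := by
  induction m with
  | zero => exact ⟨hc, h0, 0, zero_mem _, by simp⟩
  | succ m ih =>
    obtain ⟨h1, h2, e, he, h3⟩ := ih
    rw [pow_succ' (Ss X k), Module.End.mul_apply]
    set c' := (Ss X k ^ m) c
    refine ⟨Ss_CU _ h1, ?_, e + Ts X (k + 1) c', add_mem he (Ts_CU _ h1), ?_⟩
    · rw [Ss_apply, map_sub, map_sub, bd_bd, h2]
      simp
    · rw [Ss_apply, h2, map_add, ← h3, map_zero]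
      abel

lemma simplex_small {A B : Set X} (hA : IsOpen A) (hB : IsOpen B) (k : ℕ) (s : C(Δ (k + 1), X))
    (hs : ∀ t, s t ∈ A ∪ B) : ∃ m0, ∀ m ≥ m0,
      (Ss X k ^ m) (Finsupp.single (s : (sing X).S (k + 1)) 1) ∈ CU A (k + 1) ⊔ CU B (k + 1) := by
  obtain ⟨ε, hε, hleb⟩ := lebesgue_number_lemma_of_metric (s := (univ : Set (Δ (k + 1))))
    (c := fun b : Bool => if b then s ⁻¹' A else s ⁻¹' B) isCompact_univ
    (by
      rintro (_ | _)
      · exact hB.preimage s.continuous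
      · exact hA.preimage s.continuous)
    (by
      intro t _
      rw [mem_iUnion]
      rcases hs t with h | h
      · exact ⟨true, h⟩
      · exact ⟨false, h⟩)
  have hr0 : (0 : ℝ) ≤ ((k + 1 : ℕ) : ℝ) / ((k + 1 : ℕ) + 1) := by positivity
  have hr1 : ((k + 1 : ℕ) : ℝ) / ((k + 1 : ℕ) + 1) < 1 := by
    rw [div_lt_one (by positivity)]
    linarith
  set d : ℝ := Metric.diam (univ : Set (Δ (k + 1)))
  have hdist : ∀ i j, dist (vtx (k + 1) i) (vtx (k + 1) j) ≤ d := fun i j =>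
    Metric.dist_le_diam_of_mem isCompact_univ.isBounded (mem_univ _) (mem_univ _)
  have htend : Filter.Tendsto (fun m : ℕ => (((k + 1 : ℕ) : ℝ) / ((k + 1 : ℕ) + 1)) ^ m * d)
      Filter.atTop (nhds 0) := by
    simpa using (tendsto_pow_atTop_nhds_zero_of_lt_one hr0 hr1).mul_const d
  obtain ⟨m0, hm0⟩ := Filter.eventually_atTop.1 (htend.eventually (gt_mem_nhds hε))
  refine ⟨m0, fun m hm => ?_⟩
  rw [single_eq_real, Ss_iter_real]
  have hsm := SS_iter_small (k + 1) (k + 1) (vtx (k + 1)) d hdist m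
  set c := (SS (k + 1) (k + 1) ^ m) (Finsupp.single (vtx (k + 1) : (tup (Δ (k + 1))).S (k + 1)) 1)
  rw [← Finsupp.sum_single c, Finsupp.sum, map_sum]
  refine Submodule.sum_mem _ fun w hw => ?_
  have hw' : ∀ i j, dist (w i) (w j) ≤ _ := hsm hw
  rw [real_single]
  obtain ⟨b, hb⟩ := hleb (w 0) (mem_univ _)
  have key : ∀ t, aff w t ∈ ball (w 0) ε := by
    intro t
    rw [mem_ball, dist_comm]
    exact (dist_bary_le w (w 0) _ (fun j => hw' 0 j) t).trans_lt (hm0 m hm)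
  cases b with
  | true => exact Submodule.mem_sup_left (CU_single (s.comp (aff w)) (fun t => hb (key t)) _)
  | false => exact Submodule.mem_sup_right (CU_single (s.comp (aff w)) (fun t => hb (key t)) _)

lemma chain_small {A B : Set X} (hA : IsOpen A) (hB : IsOpen B) (k : ℕ) (c : Ch (sing X) (k + 1))
    (hc : c ∈ CU (A ∪ B) (k + 1)) : ∃ m, (Ss X k ^ m) c ∈ CU A (k + 1) ⊔ CU B (k + 1) := by
  have h : ∀ s : (sing X).S (k + 1), ∃ m0, s ∈ c.support → ∀ m ≥ m0,
      (Ss X k ^ m) (Finsupp.single s 1) ∈ CU A (k + 1) ⊔ CU B (k + 1) := by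
    intro s
    by_cases hs : s ∈ c.support
    · obtain ⟨m0, h⟩ := simplex_small hA hB k s (hc hs)
      exact ⟨m0, fun _ => h⟩
    · exact ⟨0, fun h => absurd h hs⟩
  choose m0 h using h
  refine ⟨c.support.sup m0, ?_⟩
  generalize hM : c.support.sup m0 = M
  rw [← Finsupp.sum_single c, Finsupp.sum, map_sum]
  refine Submodule.sum_mem _ fun w hw => ?_
  rw [show (Finsupp.single w (c w) : Ch (sing X) (k + 1)) = c w • Finsupp.single w 1 by simp,
      map_smul]
  exact Submodule.smul_mem _ _ (h w hw M (hM ▸ Finset.le_sup hw))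

end Betti

namespace Betti

section
variable {X : Type} [TopologicalSpace X]

noncomputable def Zc (U : Set X) : ∀ i : ℕ, Submodule ℚ (Ch (sing X) i)
  | 0 => CU U 0
  | i + 1 => CU U (i + 1) ⊓ LinearMap.ker (bd (sing X) i)

noncomputable def Bc (U : Set X) (i : ℕ) : Submodule ℚ (Ch (sing X) i) :=
  (CU U (i + 1)).map (bd (sing X) i)

lemma Zc_le (U : Set X) (i : ℕ) : Zc U i ≤ CU U i := by
  cases i with
  | zero => exact le_rfl
  | succ i => exact inf_le_left

lemma Bc_mono {U V : Set X} (h : U ⊆ V) (i : ℕ) : Bc U i ≤ Bc V i :=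
  Submodule.map_mono (CU_mono h _)

lemma bd_mem_Zc {U : Set X} {i : ℕ} {c} (hc : c ∈ CU U (i + 1)) : bd (sing X) i c ∈ Zc U i := by
  cases i with
  | zero => exact bd_CU _ hc
  | succ i => exact ⟨bd_CU _ hc, bd_bd _ _ _⟩

/-- the `i`-th Betti number of `U` is at most `d` -/
def HB (U : Set X) (i d : ℕ) : Prop :=
  ∃ W : Submodule ℚ (Ch (sing X) i), Module.Finite ℚ W ∧ Module.finrank ℚ W ≤ d ∧
    Zc U i ≤ W ⊔ Bc U i

lemma CU_inter (A B : Set X) (k : ℕ) : CU A k ⊓ CU B k = CU (A ∩ B) k := by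
  rw [CU, CU, CU, ← Finsupp.supported_inter]
  congr 1
  ext s
  simp only [mem_inter_iff, mem_ofPred_eq, forall_and]

lemma HB_zero {A B : Set X} {a b : ℕ} (hA : HB A 0 a) (hB : HB B 0 b) :
    HB (A ∪ B) 0 (a + b) := by
  obtain ⟨W, hW, hWr, hWZ⟩ := hA
  obtain ⟨W', hW', hWr', hWZ'⟩ := hB
  refine ⟨W ⊔ W', inferInstance,
    (Submodule.finrank_add_le_finrank_add_finrank W W').trans (add_le_add hWr hWr'), ?_⟩
  refine CU_le (LinearMap.id) _ fun s hs => ?_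
  rw [LinearMap.id_apply]
  have hu : ∀ t u : Δ 0, t = u := fun t u => by
    apply Δext
    intro x
    rw [show x = 0 by omega]
    have h1 := t.2.2
    have h2 := u.2.2
    simp only [Fin.sum_univ_succ, Finset.univ_eq_empty, Finset.sum_empty, add_zero] at h1 h2
    exact h1.trans h2.symm
  rcases hs (vtx 0 0) with h | h
  · have : Finsupp.single (s : (sing X).S 0) (1 : ℚ) ∈ Zc A 0 :=
      CU_single s (fun t => by rw [hu t (vtx 0 0)]; exact h) 1
    exact (sup_le_sup le_sup_left (Bc_mono subset_union_left 0)) (hWZ this)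
  · have : Finsupp.single (s : (sing X).S 0) (1 : ℚ) ∈ Zc B 0 :=
      CU_single s (fun t => by rw [hu t (vtx 0 0)]; exact h) 1
    exact (sup_le_sup le_sup_right (Bc_mono subset_union_right 0)) (hWZ' this)

lemma exists_section {V W : Type} [AddCommGroup V] [Module ℚ V] [AddCommGroup W] [Module ℚ W]
    (f : V →ₗ[ℚ] W) : ∃ g : LinearMap.range f →ₗ[ℚ] V, f.rangeRestrict ∘ₗ g = LinearMap.id :=
  f.rangeRestrict.exists_rightInverse_of_surjective f.range_rangeRestrict

lemma range_aux {V W U : Type} [AddCommGroup V] [Module ℚ V] [AddCommGroup W] [Module ℚ W]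
    [AddCommGroup U] [Module ℚ U] [Module.Finite ℚ W]
    (f : V →ₗ[ℚ] W) (φ : LinearMap.range f →ₗ[ℚ] U) :
    Module.Finite ℚ (LinearMap.range φ) ∧
      Module.finrank ℚ (LinearMap.range φ) ≤ Module.finrank ℚ W :=
  ⟨inferInstance, (LinearMap.finrank_range_le φ).trans (Submodule.finrank_le _)⟩

lemma sup_fin {U : Type} [AddCommGroup U] [Module ℚ U] (A B : Submodule ℚ U) {a b : ℕ}
    (hA : Module.Finite ℚ A ∧ Module.finrank ℚ A ≤ a)
    (hB : Module.Finite ℚ B ∧ Module.finrank ℚ B ≤ b) :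
    Module.Finite ℚ (A ⊔ B : Submodule ℚ U) ∧
      Module.finrank ℚ (A ⊔ B : Submodule ℚ U) ≤ a + b := by
  obtain ⟨h1, h2⟩ := hA
  obtain ⟨h3, h4⟩ := hB
  exact ⟨inferInstance, (Submodule.finrank_add_le_finrank_add_finrank A B).trans (add_le_add h2 h4)⟩

lemma HB_succ {A B : Set X} (oA : IsOpen A) (oB : IsOpen B) {i a b c : ℕ} (hA : HB A (i + 1) a)
    (hB : HB B (i + 1) b) (hAB : HB (A ∩ B) i c) :
    HB (A ∪ B) (i + 1) (a + b + c) := by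
  obtain ⟨W, hW, hWr, hWZ⟩ := hA
  obtain ⟨W', hW', hWr', hWZ'⟩ := hB
  obtain ⟨V, hV, hVr, hVZ⟩ := hAB
  -- pairs (x, y)
  let R : Submodule ℚ (Ch (sing X) (i + 1) × Ch (sing X) (i + 1)) :=
    ((CU A (i + 1)).prod (CU B (i + 1)) ⊓
      LinearMap.ker ((bd (sing X) i).coprod (bd (sing X) i))) ⊓
      V.comap ((bd (sing X) i) ∘ₗ LinearMap.fst ℚ _ _)
  let f : R →ₗ[ℚ] V := LinearMap.codRestrict V
    (((bd (sing X) i) ∘ₗ LinearMap.fst ℚ _ _) ∘ₗ R.subtype) (fun x => x.2.2)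
  obtain ⟨g, hg⟩ := exists_section f
  let φ : LinearMap.range f →ₗ[ℚ] Ch (sing X) (i + 1) :=
    ((LinearMap.id).coprod LinearMap.id ∘ₗ R.subtype) ∘ₗ g
  have hφf := range_aux f φ
  have hfin := sup_fin (W ⊔ W') (LinearMap.range φ) (sup_fin W W' ⟨hW, hWr⟩ ⟨hW', hWr'⟩)
    ⟨hφf.1, hφf.2.trans hVr⟩
  refine ⟨(W ⊔ W') ⊔ LinearMap.range φ, hfin.1, hfin.2, ?_⟩
  rintro z ⟨hz, hz0⟩
  have hz0 : bd (sing X) i z = 0 := hz0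
  obtain ⟨m, hm⟩ := chain_small oA oB i z hz
  obtain ⟨-, hm0, e, he, hze⟩ := Ss_iter_cycle z hz hz0 m
  set z' := (Ss X i ^ m) z
  obtain ⟨x, hx, y, hy, hxy⟩ := Submodule.mem_sup.1 hm
  have hbd : bd (sing X) i x = - bd (sing X) i y := by
    rw [← hxy, map_add] at hm0
    exact eq_neg_of_add_eq_zero_left hm0
  have hzz : bd (sing X) i x ∈ Zc (A ∩ B) i := by
    have h1 : bd (sing X) i x ∈ CU (A ∩ B) i := by
      rw [← CU_inter]
      exact ⟨bd_CU _ hx, hbd ▸ neg_mem (bd_CU _ hy)⟩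
    cases i with
    | zero => exact h1
    | succ i => exact ⟨h1, bd_bd _ _ _⟩
  obtain ⟨v, hv, _, ⟨q, hq, rfl⟩, hvq⟩ := Submodule.mem_sup.1 (hVZ hzz)
  have hqA := CU_mono (inter_subset_left (s := A) (t := B)) _ hq
  have hqB := CU_mono (inter_subset_right (s := A) (t := B)) _ hq
  -- the pair (x - q, y + q)
  have hbx : bd (sing X) i (x - q) = v := by rw [map_sub, ← hvq]; abel
  have hby : bd (sing X) i (y + q) = -v := by
    rw [map_add, ← hbx, map_sub, hbd]; abel
  have hR : (x - q, y + q) ∈ R := by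
    refine ⟨⟨⟨sub_mem hx hqA, add_mem hy hqB⟩, ?_⟩, ?_⟩
    · change bd (sing X) i (x - q) + bd (sing X) i (y + q) = 0
      rw [hbx, hby]; abel
    · change bd (sing X) i (x - q) ∈ V
      rwa [hbx]
  let v' : LinearMap.range f := f.rangeRestrict ⟨_, hR⟩
  have hgv : f.rangeRestrict (g v') = v' := LinearMap.congr_fun hg v'
  have hgv1 : bd (sing X) i (g v').1.1 = bd (sing X) i (x - q) :=
    congrArg (fun t : LinearMap.range f => (t.1.1 : Ch (sing X) i)) hgv
  obtain ⟨⟨⟨hgA, hgB⟩, hg0⟩, -⟩ := (g v').2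
  have hg0 : bd (sing X) i (g v').1.1 + bd (sing X) i (g v').1.2 = 0 := hg0
  have hφ : φ v' = (g v').1.1 + (g v').1.2 := rfl
  have e1 : z = (((x - q - (g v').1.1) + (y + q - (g v').1.2)) + φ v') + bd (sing X) (i + 1) e := by
    rw [← hze, ← hxy, hφ]; abel
  rw [e1]
  refine add_mem (add_mem (add_mem ?_ ?_) ?_) ?_
  · have : x - q - (g v').1.1 ∈ Zc A (i + 1) :=
      ⟨sub_mem (sub_mem hx hqA) hgA, by
        change bd (sing X) i _ = 0
        rw [map_sub, hgv1]; abel⟩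
    exact (sup_le_sup (le_sup_left.trans le_sup_left) (Bc_mono subset_union_left _)) (hWZ this)
  · have : y + q - (g v').1.2 ∈ Zc B (i + 1) :=
      ⟨sub_mem (add_mem hy hqB) hgB, by
        change bd (sing X) i _ = 0
        rw [map_sub, hby, eq_neg_of_add_eq_zero_right hg0, hgv1, hbx]; abel⟩
    exact (sup_le_sup (le_sup_right.trans le_sup_left) (Bc_mono subset_union_right _)) (hWZ' this)
  · exact Submodule.mem_sup_left (Submodule.mem_sup_right ⟨v', rfl⟩)
  · exact Submodule.mem_sup_right ⟨e, he, rfl⟩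

def THB (U : Set X) (N : ℕ) : Prop :=
  ∃ d : ℕ → ℕ, (∀ i, HB U i (d i)) ∧ ∑' i, (d i : ENNReal) ≤ N

lemma THB_union {A B : Set X} (oA : IsOpen A) (oB : IsOpen B) {a b c : ℕ} (hA : THB A a)
    (hB : THB B b) (hAB : THB (A ∩ B) c) : THB (A ∪ B) (a + b + c) := by
  obtain ⟨d, hd, hds⟩ := hA
  obtain ⟨d', hd', hds'⟩ := hB
  obtain ⟨d'', hd'', hds''⟩ := hAB
  refine ⟨fun i => d i + d' i + Nat.casesOn i 0 d'', fun i => ?_, ?_⟩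
  · cases i with
    | zero => exact HB_zero (a := d 0) (b := d' 0) (hd 0) (hd' 0)
    | succ i => exact HB_succ oA oB (hd _) (hd' _) (hd'' _)
  · push_cast
    rw [ENNReal.tsum_add, ENNReal.tsum_add]
    refine add_le_add (add_le_add hds hds') ?_
    rw [tsum_eq_zero_add' ENNReal.summable]
    simpa using hds''

lemma THB_empty : THB (∅ : Set X) 0 := by
  refine ⟨fun _ => 0, fun i => ⟨⊥, inferInstance, by simp, ?_⟩, by simp⟩
  refine (Zc_le _ _).trans ?_
  refine CU_le LinearMap.id _ fun s hs => ?_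
  exact absurd (hs (vtx i 0)) (by simp)

end

end Betti

namespace Betti

section

lemma face_apply (k : ℕ) (i : Fin (k + 2)) (t : Δ k) (x : Fin (k + 2)) :
    face k i t x = ∑ j, if i.succAbove j = x then t j else 0 := by
  rw [face_eq]
  simp [aff_apply, vtx_apply, eq_comm]

lemma face_self (k : ℕ) (i : Fin (k + 2)) (t : Δ k) : face k i t i = 0 := by
  rw [face_apply]
  exact Finset.sum_eq_zero fun j _ => by simp [Fin.succAbove_ne]

lemma face_succAbove (k : ℕ) (i : Fin (k + 2)) (t : Δ k) (j : Fin (k + 1)) :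
    face k i t (i.succAbove j) = t j := by
  rw [face_apply]
  simp

noncomputable def join {k : ℕ} (p : Δ k × unitInterval) : Δ (k + 1) :=
  ⟨(Fin.cons (p.2 : ℝ) (fun j => (1 - (p.2 : ℝ)) * p.1 j) : Fin (k + 2) → ℝ), by
    intro x
    refine Fin.cases ?_ (fun j => ?_) x
    · simpa using p.2.2.1
    · exact mul_nonneg (sub_nonneg.2 p.2.2.2) (p.1.2.1 j), by
    rw [Fin.sum_univ_succ]
    simp only [Fin.cons_zero, Fin.cons_succ]
    rw [← Finset.mul_sum, show ∑ j, p.1 j = 1 from p.1.2.2]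
    ring⟩

lemma join_zero {k : ℕ} (p : Δ k × unitInterval) : join p 0 = (p.2 : ℝ) := rfl

lemma join_succ {k : ℕ} (p : Δ k × unitInterval) (j : Fin (k + 1)) :
    join p j.succ = (1 - (p.2 : ℝ)) * p.1 j := rfl

lemma join_cont {k : ℕ} : Continuous (join (k := k)) := by
  refine Continuous.subtype_mk (continuous_pi fun x => ?_) _
  refine Fin.cases ?_ (fun j => ?_) x
  · simp only [Fin.cons_zero]
    fun_prop
  · simp only [Fin.cons_succ]
    refine Continuous.mul (by fun_prop) ?_
    exact (continuous_apply j).comp (continuous_subtype_val.comp continuous_fst)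

noncomputable def unjoin {k : ℕ} (t : Δ (k + 1)) : Δ k × unitInterval :=
  (if h : t 0 = 1 then vtx k 0 else ⟨fun j => t j.succ / (1 - t 0),
    fun j => div_nonneg (t.2.1 _) (sub_nonneg.2 (stdSimplex.le_one t 0)), by
      have h1 : ∑ j, t j = 1 := t.2.2
      rw [Fin.sum_univ_succ] at h1
      rw [← Finset.sum_div, div_eq_one_iff_eq (by intro h2; apply h; linarith)]
      linarith⟩, ⟨t 0, t.2.1 0, stdSimplex.le_one t 0⟩)

lemma join_unjoin {k : ℕ} (t : Δ (k + 1)) : join (unjoin t) = t := by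
  apply Δext
  intro x
  refine Fin.cases ?_ (fun j => ?_) x
  · rfl
  · rw [join_succ]
    by_cases h : t 0 = 1
    · have h1 : ∑ j, t j = 1 := t.2.2
      rw [Fin.sum_univ_succ, h] at h1
      have h2 : ∑ j : Fin (k + 1), t j.succ = 0 := by linarith
      rw [Finset.sum_eq_zero_iff_of_nonneg (fun j _ => show 0 ≤ t j.succ from t.2.1 _)] at h2
      rw [h2 j (Finset.mem_univ _)]
      simp [unjoin, h]
    · have h' : 1 - t 0 ≠ 0 := by intro h2; apply h; linarith
      simp only [unjoin, h, dite_false]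
      change (1 - t 0) * (t j.succ / (1 - t 0)) = _
      field_simp

lemma join_surj {k : ℕ} : Function.Surjective (join (k := k)) := fun t => ⟨_, join_unjoin t⟩

lemma join_quot {k : ℕ} : Topology.IsQuotientMap (join (k := k)) :=
  (join_cont.isClosedMap).isQuotientMap join_cont join_surj

lemma face_zero_eq (k : ℕ) (t : Δ k) : face k 0 t = join (t, 0) := by
  apply Δext
  intro x
  refine Fin.cases ?_ (fun j => ?_) x
  · rw [face_self, join_zero]; rfl
  · rw [join_succ]
    have := face_succAbove k 0 t j
    rw [Fin.zero_succAbove] at this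
    rw [this]
    simp

lemma face_succ_eq (k : ℕ) (i : Fin (k + 2)) (p : Δ k × unitInterval) :
    face (k + 1) i.succ (join p) = join (face k i p.1, p.2) := by
  apply Δext
  intro x
  refine Fin.cases ?_ (fun j => ?_) x
  · have := face_succAbove (k + 1) i.succ (join p) 0
    rw [Fin.succ_succAbove_zero] at this
    rw [this]; rfl
  · rw [join_succ]
    refine Fin.succAboveCases i ?_ (fun j => ?_) j
    · rw [face_self, face_self]; simp
    · rw [← Fin.succ_succAbove_succ, face_succAbove, face_succAbove, join_succ]

variable {E : Type} [NormedAddCommGroup E] [NormedSpace ℝ E]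

noncomputable def coneFun (p : E) {k : ℕ} (s : C(Δ k, E)) (t : Δ (k + 1)) : E :=
  p + (1 - t 0) • (s (unjoin t).1 - p)

lemma coneFun_join (p : E) {k : ℕ} (s : C(Δ k, E)) (q : Δ k × unitInterval) :
    coneFun p s (join q) = p + (1 - (q.2 : ℝ)) • (s q.1 - p) := by
  rw [coneFun, join_zero]
  by_cases h : (q.2 : ℝ) = 1
  · simp [h]
  · congr 4
    apply Δext
    intro j
    have h0 : ¬ (join q) 0 = 1 := h
    have h' : 1 - (q.2 : ℝ) ≠ 0 := by intro h2; apply h; linarith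
    simp only [unjoin, h0, dite_false]
    change (join q) j.succ / (1 - (q.2 : ℝ)) = _
    rw [join_succ]
    field_simp

noncomputable def coneS (p : E) (k : ℕ) (s : (sing E).S k) : (sing E).S (k + 1) :=
  (⟨coneFun p s, by
    rw [join_quot.continuous_iff]
    have : coneFun p s ∘ join = fun q : Δ k × unitInterval =>
      p + (1 - (q.2 : ℝ)) • (s q.1 - p) := funext fun q => coneFun_join p s q
    rw [this]
    fun_prop⟩ : C(Δ (k + 1), E))

lemma coneS_join (p : E) (k : ℕ) (s : (sing E).S k) (q : Δ k × unitInterval) :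
    coneS p k s (join q) = p + (1 - (q.2 : ℝ)) • (s q.1 - p) := coneFun_join p s q

lemma coneS_zero (p : E) (k : ℕ) (s : (sing E).S k) : (sing E).δ k 0 (coneS p k s) = s := by
  change ContinuousMap.comp (coneS p k s) (face k 0) = s
  ext1 t
  rw [ContinuousMap.comp_apply, face_zero_eq, coneS_join]
  simp

lemma coneS_succ (p : E) (k : ℕ) (i : Fin (k + 2)) (s : (sing E).S (k + 1)) :
    (sing E).δ (k + 1) i.succ (coneS p (k + 1) s) = coneS p k ((sing E).δ k i s) := by
  change ContinuousMap.comp (coneS p (k + 1) s) (face (k + 1) i.succ) =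
    coneS p k (ContinuousMap.comp s (face k i))
  ext1 t
  obtain ⟨q, rfl⟩ := join_surj t
  rw [ContinuousMap.comp_apply, face_succ_eq, coneS_join, coneS_join]
  rfl

lemma coneS_mem {U : Set E} (hU : Convex ℝ U) {p : E} (hp : p ∈ U) {k : ℕ} (s : C(Δ k, E))
    (hs : ∀ t, s t ∈ U) (t : Δ (k + 1)) : (coneS p k s) t ∈ U := by
  obtain ⟨q, rfl⟩ := join_surj t
  rw [coneS_join]
  have := hU hp (hs q.1) q.2.2.1 (sub_nonneg.2 q.2.2.2) (by ring)
  convert this using 1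
  module

lemma THB_convex {U : Set E} (hU : Convex ℝ U) (hne : U.Nonempty) : THB U 1 := by
  obtain ⟨p, hp⟩ := hne
  refine ⟨fun i => if i = 0 then 1 else 0, fun i => ?_, ?_⟩
  · cases i with
    | zero =>
      let c : C(Δ 0, E) := ContinuousMap.const _ p
      refine ⟨Submodule.span ℚ {Finsupp.single (c : (sing E).S 0) (1 : ℚ)}, inferInstance,
        (finrank_span_singleton (by simp)).le, ?_⟩
      refine CU_le LinearMap.id _ fun s hs => ?_
      have : ((LinearMap.id : Ch (sing E) 0 →ₗ[ℚ] Ch (sing E) 0) (Finsupp.single (s : (sing E).S 0) (1 : ℚ))) =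
          Finsupp.single (c : (sing E).S 0) (1 : ℚ) +
          bd (sing E) 0 (Finsupp.single (coneS p 0 s) 1) := by
        rw [bd_single, Fin.sum_univ_two, coneS_zero]
        have : (sing E).δ 0 1 (coneS p 0 s) = c := by
          change ContinuousMap.comp (coneS p 0 s) (face 0 1) = c
          ext1 t
          rw [ContinuousMap.comp_apply]
          change coneFun p s (face 0 1 t) = p
          have : face 0 1 t 0 = 1 := by
            have h := (face 0 1 t).2.2
            have h' : (face 0 1 t).1 1 = 0 := face_self 0 1 t
            rw [Fin.sum_univ_two, h', add_zero] at h
            exact h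
          simp [coneFun, this]
        rw [this]
        simp
      rw [this]
      refine add_mem (Submodule.mem_sup_left (Submodule.mem_span_singleton_self _))
        (Submodule.mem_sup_right ⟨_, CU_single _ (coneS_mem hU hp s hs) 1, rfl⟩)
    | succ i =>
      refine ⟨⊥, inferInstance, by simp, ?_⟩
      rintro z ⟨hz, hz0⟩
      have hz0 : bd (sing E) i z = 0 := hz0
      have := bd_cone (sing E) i (coneS p) (coneS_zero p) (coneS_succ p) z
      rw [hz0, map_zero, sub_zero] at this
      refine Submodule.mem_sup_right ⟨_, ?_, this⟩
      refine CU_le _ _ (fun s hs => ?_) z hz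
      rw [Finsupp.lmapDomain_apply, Finsupp.mapDomain_single]
      exact CU_single _ (coneS_mem hU hp s hs) 1
  · rw [tsum_eq_single 0 (fun i hi => by simp [hi])]
    simp

/-- number of nonempty subfamilies with nonempty intersection -/
noncomputable def nerveCard {ι : Type} (J : Finset ι) (B : ι → Set E) : ℕ :=
  (J.powerset.filter fun S => S.Nonempty ∧ (⋂ j ∈ S, B j).Nonempty).card

lemma THB_mono {X : Type} [TopologicalSpace X] {U : Set X} {a b : ℕ} (h : a ≤ b) (hU : THB U a) :
    THB U b := by
  obtain ⟨d, h1, h2⟩ := hU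
  exact ⟨d, h1, h2.trans (by exact_mod_cast h)⟩

lemma THB_nerve {ι : Type} (J : Finset ι) : ∀ (B : ι → Set E), (∀ j, Convex ℝ (B j)) →
    (∀ j, IsOpen (B j)) → THB (⋃ j ∈ J, B j) (nerveCard J B) := by
  induction J using Finset.induction_on with
  | empty =>
    intro B _ _
    simpa [nerveCard] using THB_mono (Nat.zero_le _) THB_empty
  | insert k J hk ih =>
    intro B hB oB
    rw [Finset.set_biUnion_insert]
    by_cases hne : (B k).Nonempty
    · have h1 := ih B hB oB
      have h2 := ih (fun j => B k ∩ B j) (fun j => (hB k).inter (hB j)) (fun j => (oB k).inter (oB j))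
      rw [← inter_iUnion₂] at h2
      have := THB_union (oB k) (isOpen_biUnion fun j _ => oB j) (THB_convex (hB k) hne) h1 h2
      refine THB_mono ?_ this
      let F1 := J.powerset.filter fun S => S.Nonempty ∧ (⋂ j ∈ S, B j).Nonempty
      let F2 := J.powerset.filter fun S => S.Nonempty ∧ (⋂ j ∈ S, (B k ∩ B j)).Nonempty
      have hF : ({{k}} ∪ F1) ∪ F2.image (insert k) ⊆
          (insert k J).powerset.filter fun S => S.Nonempty ∧ (⋂ j ∈ S, B j).Nonempty := by
        intro S hS
        simp only [Finset.mem_union, Finset.mem_singleton, F1, F2, Finset.mem_filter,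
          Finset.mem_powerset, Finset.mem_image] at hS ⊢
        rcases hS with (rfl | ⟨h1, h2⟩) | ⟨S, ⟨g1, ⟨j', hj'⟩, ⟨x, hx⟩⟩, rfl⟩
        · refine ⟨by simp, by simp, by simpa using hne⟩
        · exact ⟨h1.trans (Finset.subset_insert _ _), h2⟩
        · refine ⟨Finset.insert_subset_insert _ g1, by simp, x, ?_⟩
          simp only [mem_iInter, Finset.mem_insert] at hx ⊢
          rintro j (hj | hj)
          · rw [hj]
            exact (hx j' hj').1
          · exact (hx j hj).2
      refine le_trans ?_ (Finset.card_le_card hF)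
      have hkS : ∀ S ∈ J.powerset, k ∉ S := fun S hS h => hk (Finset.mem_powerset.1 hS h)
      rw [Finset.card_union_of_disjoint, Finset.card_union_of_disjoint, Finset.card_image_of_injOn]
      · exact le_rfl
      · intro S hS S' hS' h
        have a1 := hkS S (Finset.mem_filter.1 hS).1
        have a2 := hkS S' (Finset.mem_filter.1 hS').1
        rw [← Finset.erase_insert a1, ← Finset.erase_insert a2]
        exact congrArg (fun s => s.erase k) h
      · rw [Finset.disjoint_left]
        intro S hS hS'
        rw [Finset.mem_singleton] at hS
        exact hkS S (Finset.mem_filter.1 hS').1 (by simp [hS])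
      · rw [Finset.disjoint_left]
        intro S hS hS'
        obtain ⟨S', hS2, rfl⟩ := Finset.mem_image.1 hS'
        rcases Finset.mem_union.1 hS with h | h
        · rw [Finset.mem_singleton] at h
          obtain ⟨x, hx⟩ := (Finset.mem_filter.1 hS2).2.1
          have : x ∈ insert k S' := Finset.mem_insert_of_mem hx
          rw [h, Finset.mem_singleton] at this
          exact hkS S' (Finset.mem_filter.1 hS2).1 (this ▸ hx)
        · exact hkS _ (Finset.mem_filter.1 h).1 (by simp)
    · rw [not_nonempty_iff_eq_empty] at hne
      rw [hne, empty_union]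
      refine THB_mono (Finset.card_le_card ?_) (ih B hB oB)
      exact Finset.filter_subset_filter _ (Finset.powerset_mono.2 (Finset.subset_insert _ _))

end

end Betti

namespace Betti

lemma sc_bound (S : ShortComplex (ModuleCat.{0} ℚ)) (W : Submodule ℚ S.X₂) (hW : Module.Finite ℚ W)
    (d : ℕ) (hd : Module.finrank ℚ W ≤ d)
    (h : ∀ z : S.X₂, S.g.hom z = 0 → z ∈ W ⊔ LinearMap.range S.f.hom) :
    Module.Finite ℚ S.homology ∧ Module.finrank ℚ S.homology ≤ d := by
  let e : S.homology ≃ₗ[ℚ] (LinearMap.ker S.g.hom ⧸ LinearMap.range S.moduleCatToCycles) :=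
    S.moduleCatHomologyIso.toLinearEquiv
  let N : Submodule ℚ (LinearMap.ker S.g.hom) := W.comap (LinearMap.ker S.g.hom).subtype
  let j : N →ₗ[ℚ] W := LinearMap.codRestrict W
    ((LinearMap.ker S.g.hom).subtype ∘ₗ N.subtype) (fun x => x.2)
  have hj : Function.Injective j := by
    intro x y hxy
    apply Subtype.ext
    apply Subtype.ext
    exact congrArg (fun t : W => (t : S.X₂)) hxy
  have hN : Module.Finite ℚ N := Module.Finite.of_injective j hj
  have hNd : Module.finrank ℚ N ≤ d := (LinearMap.finrank_le_finrank_of_injective hj).trans hd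
  let q : N →ₗ[ℚ] (LinearMap.ker S.g.hom ⧸ LinearMap.range S.moduleCatToCycles) :=
    (LinearMap.range S.moduleCatToCycles).mkQ ∘ₗ N.subtype
  have hq : Function.Surjective q := by
    intro y
    obtain ⟨⟨z, hz⟩, rfl⟩ := Submodule.mkQ_surjective _ y
    obtain ⟨w, hw, _, ⟨b, rfl⟩, hwb⟩ := Submodule.mem_sup.1 (h z hz)
    have hgf : S.g.hom (S.f.hom b) = 0 := (S.moduleCatToCycles b).2
    have hwk : S.g.hom w = 0 := by
      have hz' : S.g.hom z = 0 := hz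
      rw [← hwb, map_add, hgf, add_zero] at hz'
      exact hz'
    refine ⟨⟨⟨w, hwk⟩, hw⟩, ?_⟩
    change Submodule.Quotient.mk _ = Submodule.Quotient.mk _
    rw [eq_comm, Submodule.Quotient.eq]
    refine ⟨b, ?_⟩
    apply Subtype.ext
    change S.f.hom b = z - w
    rw [← hwb]; abel
  have hs : Function.Surjective (e.symm.toLinearMap ∘ₗ q) := e.symm.surjective.comp hq
  exact ⟨Module.Finite.of_surjective _ hs,
    (LinearMap.finrank_le_finrank_of_surjective hs).trans hNd⟩

lemma cx_bound (K : ChainComplex (ModuleCat.{0} ℚ) ℕ) (i : ℕ) (W : Submodule ℚ (K.X i))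
    (hW : Module.Finite ℚ W) (d : ℕ) (hd : Module.finrank ℚ W ≤ d)
    (h : ∀ z : K.X i, (∀ j, i = j + 1 → (K.d i j).hom z = 0) →
      z ∈ W ⊔ LinearMap.range (K.d (i + 1) i).hom) :
    Module.Finite ℚ (K.homology i) ∧ Module.finrank ℚ (K.homology i) ≤ d := by
  refine sc_bound (K.sc i) W hW d hd ?_
  have e : LinearMap.range (K.sc i).f.hom = LinearMap.range (K.d (i + 1) i).hom := by
    change LinearMap.range (K.d ((ComplexShape.down ℕ).prev i) i).hom = _
    rw [ChainComplex.prev]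
  intro z hz
  rw [e]
  refine h z ?_
  rintro j rfl
  change (K.d (j + 1) ((ComplexShape.down ℕ).next (j + 1))).hom z = 0 at hz
  rwa [ChainComplex.next_nat_succ] at hz

noncomputable abbrev SC (X : Type) [TopologicalSpace X] : ChainComplex (ModuleCat.{0} ℚ) ℕ :=
  (AlgebraicTopology.alternatingFaceMapComplex (ModuleCat ℚ)).obj
    (((CategoryTheory.SimplicialObject.whiskering _ _).obj (ModuleCat.free ℚ)).obj
      (TopCat.toSSet.obj (TopCat.of X)))

noncomputable def eqv (X : Type) [TopologicalSpace X] (k : ℕ) :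
    (TopCat.toSSet.obj (TopCat.of X)).obj (Opposite.op (SimplexCategory.mk k)) ≃ (sing X).S k :=
  TopCat.toSSetObjEquiv (TopCat.of X) (Opposite.op (SimplexCategory.mk k))

open AlgebraicTopology in
lemma eqv_δ (X : Type) [TopologicalSpace X] (k : ℕ) (i : Fin (k + 2)) (s) :
    eqv X k ((TopCat.toSSet.obj (TopCat.of X)).δ i s) = (sing X).δ k i (eqv X (k + 1) s) := by
  rfl

noncomputable def iso (X : Type) [TopologicalSpace X] (k : ℕ) :
    (SC X).X k ≃ₗ[ℚ] Ch (sing X) k :=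
  (Finsupp.domLCongr (eqv X k) : _ ≃ₗ[ℚ] _)

lemma hom_sum {M N : ModuleCat.{0} ℚ} {ι : Type} (s : Finset ι) (f : ι → (M ⟶ N)) (a : ι → ℤ)
    (z : M) : (∑ i ∈ s, a i • f i).hom z = ∑ i ∈ s, a i • (f i).hom z := by
  rw [ModuleCat.hom_sum, LinearMap.sum_apply]
  rfl

lemma iso_δ (X : Type) [TopologicalSpace X] (k : ℕ) (i : Fin (k + 2))
    (z : (TopCat.toSSet.obj (TopCat.of X)).obj (Opposite.op (SimplexCategory.mk (k + 1))) →₀ ℚ) :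
    Finsupp.domLCongr (R := ℚ) (eqv X k)
      (Finsupp.lmapDomain ℚ ℚ ((TopCat.toSSet.obj (TopCat.of X)).δ i) z) =
    Finsupp.lmapDomain ℚ ℚ ((sing X).δ k i) (Finsupp.domLCongr (R := ℚ) (eqv X (k + 1)) z) := by
  induction z using Finsupp.induction_linear with
  | zero => simp
  | add f g hf hg => rw [map_add, map_add, hf, hg, map_add, map_add]
  | single x a =>
    rw [Finsupp.lmapDomain_apply, Finsupp.mapDomain_single, Finsupp.domLCongr_single,
      Finsupp.domLCongr_single, Finsupp.lmapDomain_apply, Finsupp.mapDomain_single, eqv_δ]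

lemma iso_bd (X : Type) [TopologicalSpace X] (k : ℕ) (z : (SC X).X (k + 1)) :
    iso X k (((SC X).d (k + 1) k).hom z) = bd (sing X) k (iso X (k + 1) z) := by
  rw [AlgebraicTopology.alternatingFaceMapComplex_obj_d,
    AlgebraicTopology.AlternatingFaceMapComplex.objD]
  refine (congrArg (iso X k) (hom_sum _ _ _ z)).trans ?_
  rw [map_sum, bd, LinearMap.sum_apply]
  refine Finset.sum_congr rfl fun i _ => ?_
  rw [map_zsmul, LinearMap.smul_apply, ← Int.cast_smul_eq_zsmul ℚ]
  push_cast
  exact congrArg (fun c : Ch (sing X) k => ((-1 : ℚ) ^ (i : ℕ)) • c) (iso_δ X k i z)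

variable {E : Type} [TopologicalSpace E]

noncomputable def rho {X : Set E} (U B : Set E) (hUB : U ⊆ B) (r : C(B, X)) (k : ℕ) :
    Ch (sing E) k →ₗ[ℚ] Ch (sing X) k :=
  Finsupp.linearCombination ℚ fun s : C(Δ k, E) =>
    if h : ∀ t, s t ∈ U then
      Finsupp.single (M := ℚ) ((r.comp ⟨fun t => ⟨s t, hUB (h t)⟩, by fun_prop⟩ : C(Δ k, X)) :
        (sing X).S k) 1
    else 0

lemma rho_single {X : Set E} (U B : Set E) (hUB : U ⊆ B) (r : C(B, X)) (k : ℕ) (s : C(Δ k, E))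
    (h : ∀ t, s t ∈ U) :
    rho U B hUB r k (Finsupp.single (s : (sing E).S k) 1) =
      Finsupp.single (M := ℚ) ((r.comp ⟨fun t => ⟨s t, hUB (h t)⟩, by fun_prop⟩ : C(Δ k, X)) :
        (sing X).S k) 1 := by
  rw [rho, Finsupp.linearCombination_single, one_smul, dif_pos h]

lemma rho_bd {X : Set E} (U B : Set E) (hUB : U ⊆ B) (r : C(B, X)) (k : ℕ) (c)
    (hc : c ∈ CU U (k + 1)) :
    rho U B hUB r k (bd (sing E) k c) = bd (sing X) k (rho U B hUB r (k + 1) c) := by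
  have := CU_le (rho U B hUB r k ∘ₗ bd (sing E) k - bd (sing X) k ∘ₗ rho U B hUB r (k + 1)) ⊥
    (fun s hs => ?_) c hc
  · rw [Submodule.mem_bot, LinearMap.sub_apply, sub_eq_zero] at this
    exact this
  · rw [Submodule.mem_bot, LinearMap.sub_apply, sub_eq_zero, LinearMap.comp_apply,
      LinearMap.comp_apply, rho_single U B hUB r (k + 1) s hs, bd_single, bd_single, map_sum]
    refine Finset.sum_congr rfl fun i _ => ?_
    rw [map_smul, rho_single U B hUB r k (s.comp (face k i)) (fun t => hs _)]
    rfl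

noncomputable def inc (X : Set E) (k : ℕ) : Ch (sing X) k →ₗ[ℚ] Ch (sing E) k :=
  Finsupp.lmapDomain ℚ ℚ fun s : C(Δ k, X) => (ContinuousMap.comp ⟨Subtype.val, by fun_prop⟩ s : C(Δ k, E))

lemma inc_single (X : Set E) (k : ℕ) (s : C(Δ k, X)) (a : ℚ) :
    inc X k (Finsupp.single (s : (sing X).S k) a) =
      Finsupp.single ((ContinuousMap.comp ⟨Subtype.val, by fun_prop⟩ s : C(Δ k, E)) : (sing E).S k) a := by
  rw [inc, Finsupp.lmapDomain_apply, Finsupp.mapDomain_single]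

lemma inc_bd (X : Set E) (k : ℕ) (c) :
    inc X k (bd (sing X) k c) = bd (sing E) k (inc X (k + 1) c) := by
  induction c using Finsupp.induction_linear with
  | zero => simp
  | add f g hf hg => rw [map_add, map_add, hf, hg, map_add, map_add]
  | single s a =>
    rw [bd_single, inc_single, bd_single, map_sum]
    refine Finset.sum_congr rfl fun i _ => ?_
    rw [map_smul, inc_single]
    rfl

lemma inc_CU (X U : Set E) (hXU : X ⊆ U) (k : ℕ) (c) : inc X k c ∈ CU U k := by
  induction c using Finsupp.induction_linear with
  | zero => simp
  | add f g hf hg => rw [map_add]; exact add_mem hf hg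
  | single s a =>
    rw [inc_single]
    exact CU_single _ (fun t => hXU (s t).2) a

lemma rho_inc {X : Set E} (U B : Set E) (hXU : X ⊆ U) (hUB : U ⊆ B) (r : C(B, X))
    (hr : ∀ x : B, (x : E) ∈ X → ((r x : E) = (x : E))) (k : ℕ) (c) :
    rho U B hUB r k (inc X k c) = c := by
  induction c using Finsupp.induction_linear with
  | zero => simp
  | add f g hf hg => rw [map_add, map_add, hf, hg]
  | single s a =>
    rw [← mul_one a, ← smul_eq_mul, ← Finsupp.smul_single, map_smul, map_smul, inc_single,
      rho_single U B hUB r k _ (fun t => hXU (s t).2)]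
    congr 2
    ext t
    exact hr _ (s t).2

lemma retract_bound {X : Set E} (U B : Set E) (hXU : X ⊆ U) (hUB : U ⊆ B) (r : C(B, X))
    (hr : ∀ x : B, (x : E) ∈ X → ((r x : E) = (x : E))) (i d : ℕ) (hU : HB U i d) :
    Module.Finite ℚ (singularHomology X i) ∧ Module.finrank ℚ (singularHomology X i) ≤ d := by
  obtain ⟨W, hW, hWd, hWZ⟩ := hU
  let ρ := rho U B hUB r i
  let e := (iso X i).symm.toLinearMap ∘ₗ ρ
  refine cx_bound (SC X) i (W.map e) inferInstance d ((Submodule.finrank_map_le e W).trans hWd) ?_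
  intro z hz
  have hmem : inc X i (iso X i z) ∈ Zc U i := by
    cases i with
    | zero => exact inc_CU X U hXU 0 _
    | succ i =>
      refine ⟨inc_CU X U hXU _ _, ?_⟩
      change bd (sing E) i _ = 0
      rw [← inc_bd, ← iso_bd, hz i rfl, map_zero, map_zero]
  obtain ⟨w, hw, _, ⟨b, hb, rfl⟩, hwb⟩ := Submodule.mem_sup.1 (hWZ hmem)
  have h1 : ρ (inc X i (iso X i z)) = iso X i z := rho_inc U B hXU hUB r hr i _
  rw [← hwb, map_add] at h1
  have h2 : ρ (bd (sing E) i b) = bd (sing X) i (rho U B hUB r (i + 1) b) :=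
    rho_bd U B hUB r i b hb
  obtain ⟨b', hb'⟩ := (iso X (i + 1)).surjective (rho U B hUB r (i + 1) b)
  rw [h2, ← hb', ← iso_bd] at h1
  have h3 : z = (iso X i).symm (ρ w) + ((SC X).d (i + 1) i).hom b' := by
    apply (iso X i).injective
    rw [map_add, LinearEquiv.apply_symm_apply, h1]
  rw [h3]
  exact add_mem (Submodule.mem_sup_left ⟨w, hw, rfl⟩) (Submodule.mem_sup_right ⟨b', rfl⟩)

end Betti

namespace Betti

section
variable {n : ℕ}

def Qc (s : ℝ) (z : Fin n → ℤ) : Set (EuclideanSpace ℝ (Fin n)) :=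
  {x | ∀ i, |x i - s * z i| < s}

def Pc (s : ℝ) (z : Fin n → ℤ) : Set (EuclideanSpace ℝ (Fin n)) :=
  {x | ∀ i, x i ∈ Ico (s * z i) (s * z i + s)}

lemma Qc_eq (s : ℝ) (z : Fin n → ℤ) : Qc s z = ⋂ i, {x : EuclideanSpace ℝ (Fin n) | |x i - s * z i| < s} := by
  ext x
  simp [Qc]

lemma Qc_open (s : ℝ) (z : Fin n → ℤ) : IsOpen (Qc s z) := by
  rw [Qc_eq]
  exact isOpen_iInter_of_finite fun i => isOpen_lt (by fun_prop) continuous_const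

lemma Qc_convex (s : ℝ) (z : Fin n → ℤ) : Convex ℝ (Qc s z) := by
  intro x hx y hy a b ha hb hab i
  have h1 := abs_lt.1 (hx i)
  have h2 := abs_lt.1 (hy i)
  have e : (a • x + b • y) i - s * z i = a * (x i - s * z i) + b * (y i - s * z i) := by
    simp only [PiLp.add_apply, PiLp.smul_apply, smul_eq_mul]
    have : b = 1 - a := by linarith
    rw [this]; ring
  rw [e]
  have := (convex_Ioo (-s) s) (show _ ∈ Ioo (-s) s from h1) (show _ ∈ Ioo (-s) s from h2) ha hb hab
  simpa [abs_lt] using this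

lemma Pc_sub {s : ℝ} (hs : 0 < s) (z : Fin n → ℤ) : Pc s z ⊆ Qc s z := by
  intro x hx i
  have := hx i
  rw [abs_lt]
  constructor <;> linarith [this.1, this.2]

lemma Qc_dist {s : ℝ} (hs : 0 < s) (z : Fin n → ℤ) {x y} (hx : x ∈ Qc s z) (hy : y ∈ Qc s z) :
    dist x y ≤ n * (2 * s) := by
  rw [EuclideanSpace.dist_eq]
  apply Real.sqrt_le_iff.2
  refine ⟨by positivity, ?_⟩
  have h : ∀ i, dist (x i) (y i) ^ 2 ≤ (2 * s) ^ 2 := fun i => by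
    have h1 := abs_lt.1 (hx i)
    have h2 := abs_lt.1 (hy i)
    rw [Real.dist_eq, sq_abs, sq_le_sq, abs_of_pos (show 0 < 2 * s by positivity), abs_le]
    constructor <;> linarith
  refine (Finset.sum_le_sum fun i _ => h i).trans ?_
  simp only [Finset.sum_const, Finset.card_univ, Fintype.card_fin, nsmul_eq_mul]
  rw [mul_pow (n : ℝ)]
  refine mul_le_mul_of_nonneg_right ?_ (by positivity)
  have : n ≤ n ^ 2 := Nat.le_self_pow (by norm_num) n
  exact_mod_cast this

lemma Qc_near {s : ℝ} (hs : 0 < s) (z w : Fin n → ℤ) {x} (hx : x ∈ Qc s z) (hy : x ∈ Qc s w) (i) :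
    z i - 1 ≤ w i ∧ w i ≤ z i + 1 := by
  have h1 := abs_lt.1 (hx i)
  have h2 := abs_lt.1 (hy i)
  have a1 : s * (z i : ℝ) < s * (w i + 2) := by linarith
  have a2 : s * (w i : ℝ) < s * (z i + 2) := by linarith
  have b1 := lt_of_mul_lt_mul_left a1 hs.le
  have b2 := lt_of_mul_lt_mul_left a2 hs.le
  have c1 : z i < w i + 2 := by exact_mod_cast b1
  have c2 : w i < z i + 2 := by exact_mod_cast b2
  omega

lemma mem_Pc {s : ℝ} (hs : 0 < s) (x : EuclideanSpace ℝ (Fin n)) (z : Fin n → ℤ) :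
    x ∈ Pc s z ↔ ∀ i, z i = ⌊x i / s⌋ := by
  refine forall_congr' fun i => ?_
  rw [eq_comm, Int.floor_eq_iff, le_div_iff₀ hs, div_lt_iff₀ hs, mem_Ico]
  ring_nf

lemma Pc_disj {s : ℝ} (hs : 0 < s) (z w : Fin n → ℤ) (h : z ≠ w) : Disjoint (Pc s z) (Pc s w) := by
  rw [Set.disjoint_left]
  intro x hx hy
  rw [mem_Pc hs] at hx hy
  exact h (funext fun i => (hx i).trans (hy i).symm)

lemma Pc_pre (s : ℝ) (z : Fin n → ℤ) : Pc s z =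
    (@WithLp.ofLp 2 (Fin n → ℝ)) ⁻¹' (Set.pi univ fun i => Ico (s * z i) (s * z i + s)) := by
  ext x
  simp [Pc]

lemma Pc_meas (s : ℝ) (z : Fin n → ℤ) : MeasurableSet (Pc s z) := by
  rw [Pc_pre]
  exact (PiLp.volume_preserving_ofLp (Fin n)).measurable
    (MeasurableSet.univ_pi fun i => measurableSet_Ico)

lemma Pc_vol (s : ℝ) (z : Fin n → ℤ) : volume (Pc s z) = ENNReal.ofReal s ^ n := by
  rw [Pc_pre, (PiLp.volume_preserving_ofLp (Fin n)).measure_preimage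
    (MeasurableSet.univ_pi fun i => measurableSet_Ico).nullMeasurableSet, Real.volume_pi_Ico]
  simp

lemma J_finite {s : ℝ} (hs : 0 < s) {X : Set (EuclideanSpace ℝ (Fin n))} (hX : IsCompact X) :
    {z : Fin n → ℤ | (Qc s z ∩ X).Nonempty}.Finite := by
  obtain ⟨R, hR⟩ := hX.isBounded.exists_norm_le
  let M : ℤ := ⌈R / s⌉ + 1
  refine (Set.finite_Icc (fun _ => -M : Fin n → ℤ) (fun _ => M)).subset ?_
  rintro z ⟨x, hx, hxX⟩
  have key : ∀ i, |(z i : ℝ)| ≤ M := fun i => by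
    have h1 := hx i
    have h2 : |x i| ≤ R := (PiLp.norm_apply_le x i).trans (hR x hxX)
    have h3 : |s * (z i : ℝ)| ≤ R + s := by
      have := abs_sub_abs_le_abs_sub (s * (z i : ℝ)) (x i)
      rw [abs_sub_comm] at this
      linarith
    rw [abs_mul, abs_of_pos hs] at h3
    have h4 : |(z i : ℝ)| ≤ R / s + 1 := by
      rw [div_add_one hs.ne', le_div_iff₀ hs]
      linarith
    have h5 := Int.le_ceil (R / s)
    simp only [M]
    push_cast
    linarith
  constructor
  · intro i
    have := (abs_le.1 (key i)).1
    exact_mod_cast this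
  · intro i
    have := (abs_le.1 (key i)).2
    exact_mod_cast this

lemma nerve_bound {s : ℝ} (hs : 0 < s) (J : Finset (Fin n → ℤ)) :
    nerveCard J (Qc s) ≤ J.card * 2 ^ (3 ^ n) := by
  let N : (Fin n → ℤ) → Finset (Fin n → ℤ) := fun z =>
    Fintype.piFinset fun i => Finset.Icc (z i - 1) (z i + 1)
  refine (Finset.card_le_card (t := J.biUnion fun z => (N z).powerset) ?_).trans
    (Finset.card_biUnion_le_card_mul _ _ _ fun z _ => ?_)
  · intro S hS
    simp only [Finset.mem_filter, Finset.mem_powerset] at hS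
    obtain ⟨hSJ, ⟨z, hz⟩, ⟨x, hx⟩⟩ := hS
    simp only [mem_iInter] at hx
    rw [Finset.mem_biUnion]
    refine ⟨z, hSJ hz, ?_⟩
    rw [Finset.mem_powerset]
    intro w hw
    rw [Fintype.mem_piFinset]
    intro i
    rw [Finset.mem_Icc]
    exact Qc_near hs z w (hx z hz) (hx w hw) i
  · rw [Finset.card_powerset, Fintype.card_piFinset]
    have : ∀ i, (Finset.Icc (z i - 1) (z i + 1)).card = 3 := fun i => by
      rw [Int.card_Icc]
      have : z i + 1 + 1 - (z i - 1) = 3 := by ring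
      rw [this]; rfl
    simp [this]

lemma main_geom (hn : 1 ≤ n) {X : Set (EuclideanSpace ℝ (Fin n))} (hX : IsCompact X) {T : ℝ}
    (hT : 0 < T) : ∃ (U : Set (EuclideanSpace ℝ (Fin n))) (N : ℕ), X ⊆ U ∧ U ⊆ cthickening T X ∧
      THB U N ∧ (N : ℝ) ≤ (2 ^ (3 ^ n) * (2 * n) ^ n) * (volume (cthickening T X)).toReal *
        T ^ (-(n : ℝ)) := by
  have hn0 : (0 : ℝ) < n := by exact_mod_cast hn
  let s : ℝ := T / (2 * n)
  have hs : 0 < s := by positivity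
  have hsT : n * (2 * s) = T := by simp only [s]; field_simp
  let J := (J_finite hs hX).toFinset
  have hJ : ∀ z, z ∈ J ↔ (Qc s z ∩ X).Nonempty := fun z => by simp [J]
  have hQ : ∀ z ∈ J, Qc s z ⊆ cthickening T X := by
    intro z hz y hy
    obtain ⟨x, hx, hxX⟩ := (hJ z).1 hz
    exact mem_cthickening_of_dist_le y x T X hxX (hsT ▸ Qc_dist hs z hy hx)
  refine ⟨⋃ z ∈ J, Qc s z, nerveCard J (Qc s), ?_, ?_, THB_nerve J (Qc s) (Qc_convex s) (Qc_open s), ?_⟩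
  · intro x hx
    have hxP : x ∈ Pc s (fun i => ⌊x i / s⌋) := (mem_Pc hs _ _).2 fun i => rfl
    exact mem_iUnion₂.2 ⟨_, (hJ _).2 ⟨x, Pc_sub hs _ hxP, hx⟩, Pc_sub hs _ hxP⟩
  · exact iUnion₂_subset hQ
  · have hfin : volume (cthickening T X) ≠ ⊤ := (hX.cthickening).measure_lt_top.ne
    have h1 : (J.card : ENNReal) * ENNReal.ofReal s ^ n ≤ volume (cthickening T X) := by
      rw [← nsmul_eq_mul, ← Finset.sum_const]
      calc _ = ∑ z ∈ J, volume (Pc s z) := Finset.sum_congr rfl fun z _ => (Pc_vol s z).symm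
        _ = volume (⋃ z ∈ J, Pc s z) := (measure_biUnion_finset
            (fun z _ w _ h => Pc_disj hs z w h) (fun z _ => Pc_meas s z)).symm
        _ ≤ _ := measure_mono (iUnion₂_subset fun z hz => (Pc_sub hs z).trans (hQ z hz))
    have h2 : (J.card : ℝ) * s ^ n ≤ (volume (cthickening T X)).toReal := by
      have := ENNReal.toReal_mono hfin h1
      rwa [ENNReal.toReal_mul, ENNReal.toReal_pow, ENNReal.toReal_ofReal hs.le,
        ENNReal.toReal_natCast] at this
    set V := (volume (cthickening T X)).toReal
    have h3 : (J.card : ℝ) ≤ V * (2 * n) ^ n * T ^ (-(n : ℝ)) := by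
      rw [Real.rpow_neg hT.le, Real.rpow_natCast, ← div_eq_mul_inv, le_div_iff₀ (by positivity)]
      simp only [s, div_pow] at h2
      rw [← mul_div_assoc, div_le_iff₀ (by positivity)] at h2
      exact h2
    have h4 : (nerveCard J (Qc s) : ℝ) ≤ J.card * 2 ^ (3 ^ n) := by
      exact_mod_cast nerve_bound hs J
    calc _ ≤ _ := h4
      _ ≤ (V * (2 * n) ^ n * T ^ (-(n : ℝ))) * 2 ^ (3 ^ n) :=
        mul_le_mul_of_nonneg_right h3 (by positivity)
      _ = _ := by ring

end

end Betti

/-- For every `n ≥ 1` there is `C(n) > 0` such that: if `X ⊆ ℝⁿ` is a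
compact set homeomorphic to the polyhedron of a finite simplicial complex, `T > 0`, the
closed `T`-neighborhood of `X` retracts onto `X` and has Lebesgue measure `V`, then each
singular homology group `H_i(X; ℚ)` is finite dimensional and the sum of their dimensions
is at most `C(n) * V * T⁻ⁿ`. -/
theorem statement12 (n : ℕ) (hn : 1 ≤ n) :
    ∃ C : ℝ, 0 < C ∧
      ∀ (X : Set (EuclideanSpace ℝ (Fin n))) (T : ℝ),
        IsCompact X →
        (∃ (m : ℕ) (K : Geometry.SimplicialComplex ℝ (EuclideanSpace ℝ (Fin m))),
          K.faces.Finite ∧ Nonempty (X ≃ₜ K.space)) →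
        0 < T →
        RetractsOnto (Metric.cthickening T X) X →
        (∀ i : ℕ, Module.Finite ℚ (singularHomology X i)) ∧
        ∑' i : ℕ, (Module.finrank ℚ (singularHomology X i) : ENNReal) ≤
          ENNReal.ofReal
            (C * (volume (Metric.cthickening T X)).toReal * T ^ (-(n : ℝ))) := by
  refine ⟨2 ^ (3 ^ n) * (2 * n) ^ n, ?_, ?_⟩
  · have hn0 : (0 : ℝ) < n := by exact_mod_cast hn
    positivity
  intro X T hX _ hT hret
  obtain ⟨r, hrc, hr⟩ := hret
  obtain ⟨U, N, hXU, hUB, ⟨d, hd, hdN⟩, hN⟩ := Betti.main_geom hn hX hT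
  have key := fun i => Betti.retract_bound U _ hXU hUB ⟨r, hrc⟩ hr i (d i) (hd i)
  refine ⟨fun i => (key i).1, ?_⟩
  calc _ ≤ ∑' i, (d i : ENNReal) := ENNReal.tsum_le_tsum fun i => by exact_mod_cast (key i).2
    _ ≤ (N : ENNReal) := hdN
    _ = ENNReal.ofReal N := (ENNReal.ofReal_natCast N).symm
    _ ≤ _ := ENNReal.ofReal_le_ofReal hN
end
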